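/- There is an absolute constant C such that for all x, y with 2 ≤ y ≤ x and all real d ≥ 1, one has Ψ(x/d, y) ≤ C·d^{−α(x,y)}·Ψ(x, y). -/

import Mathlib

open scoped Classical

noncomputable section

/-- `n` is `y`-smooth: every prime factor of `n` is at most `y`. -/
def IsSmooth (y : ℝ) (n : ℕ) : Prop := ∀ p : ℕ, p.Prime → p ∣ n → (p : ℝ) ≤ y

/-- `Ψ(X, y)`: the number of `y`-smooth integers `n` with `1 ≤ n ≤ X`. -/
def Psi (X y : ℝ) : ℕ := Nat.card {n : ℕ | 1 ≤ n ∧ (n : ℝ) ≤ X ∧ IsSmooth y n}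

/-- `e(t) = exp(2πit)`. -/
def e2pi (t : ℝ) : ℂ := Complex.exp (2 * Real.pi * Complex.I * t)

/-- `alphaEq x y a` says `a` solves `∑_{p ≤ y prime} log p / (p^a - 1) = log x`,
i.e. `a = α(x, y)`. -/
def alphaEq (x y a : ℝ) : Prop :=
  ∑ p ∈ (Finset.range (⌊y⌋₊ + 1)).filter Nat.Prime,
    Real.log p / ((p : ℝ) ^ a - 1) = Real.log x

namespace SmoothCount
open MeasureTheory Real Set

/-- The Fourier transform of the tent function `1 - |v|` on `[-1, 1]`. -/
def fejer (x : ℝ) : ℝ := ∫ v in (-1 : ℝ)..1, (1 - |v|) * cos (v * x)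

theorem fejer_eq {x : ℝ} (hx : x ≠ 0) : fejer x = 2 * (1 - cos x) / x ^ 2 := by
  have hc : Continuous fun v : ℝ => (1 - |v|) * cos (v * x) := by fun_prop
  have h1 : ∫ v in (0 : ℝ)..1, (1 - |v|) * cos (v * x) = (1 - cos x) / x ^ 2 := by
    have : ∫ v in (0 : ℝ)..1, (1 - |v|) * cos (v * x)
        = ∫ v in (0 : ℝ)..1, (1 - v) * cos (v * x) := by
      apply intervalIntegral.integral_congr
      intro v hv
      rw [uIcc_of_le zero_le_one] at hv
      simp only [abs_of_nonneg hv.1]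
    rw [this, intervalIntegral.integral_eq_sub_of_hasDerivAt
      (f := fun v => (1 - v) * (sin (v * x) / x) - cos (v * x) / x ^ 2)]
    · simp; field_simp; ring
    · intro v _
      have e : HasDerivAt (fun v : ℝ => v * x) x v := by simpa using (hasDerivAt_id v).mul_const x
      have := (((hasDerivAt_id v).const_sub 1).mul ((e.sin).div_const x)).sub
        ((e.cos).div_const (x ^ 2))
      refine this.congr_deriv ?_
      simp only [id]; field_simp; ring
    · exact (by fun_prop : Continuous fun v : ℝ => (1 - v) * cos (v * x)).intervalIntegrable _ _
  have h2 : ∫ v in (-1 : ℝ)..0, (1 - |v|) * cos (v * x) = (1 - cos x) / x ^ 2 := by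
    have := intervalIntegral.integral_comp_neg (a := 0) (b := 1)
      (f := fun v => (1 - |v|) * cos (v * x))
    simp only [abs_neg, neg_mul, cos_neg, neg_zero] at this
    rw [← this, h1]
  rw [fejer, ← intervalIntegral.integral_add_adjacent_intervals (b := 0)
    (hc.intervalIntegrable _ _) (hc.intervalIntegrable _ _), h1, h2]
  ring

theorem fejer_zero : fejer 0 = 1 := by
  have hc : Continuous fun v : ℝ => (1 - |v|) := by fun_prop
  have h1 : ∫ v in (0 : ℝ)..1, (1 - |v|) = 1 / 2 := by
    have : ∫ v in (0 : ℝ)..1, (1 - |v|) = ∫ v in (0 : ℝ)..1, (1 - v) := by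
      apply intervalIntegral.integral_congr
      intro v hv
      rw [uIcc_of_le zero_le_one] at hv
      simp only [abs_of_nonneg hv.1]
    rw [this, intervalIntegral.integral_sub (by simp) (by simp)]
    norm_num
  have h2 : ∫ v in (-1 : ℝ)..0, (1 - |v|) = 1 / 2 := by
    have := intervalIntegral.integral_comp_neg (a := 0) (b := 1)
      (f := fun v => (1 - |v|))
    simp only [abs_neg, neg_zero] at this
    rw [← this, h1]
  simp only [fejer, mul_zero, cos_zero, mul_one]
  rw [← intervalIntegral.integral_add_adjacent_intervals (b := 0)
    (hc.intervalIntegrable _ _) (hc.intervalIntegrable _ _), h1, h2]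
  norm_num

theorem fejer_nonneg (x : ℝ) : 0 ≤ fejer x := by
  rcases eq_or_ne x 0 with rfl | hx
  · simp [fejer_zero]
  · rw [fejer_eq hx]
    have := cos_le_one x
    have : 0 ≤ 1 - cos x := by linarith
    positivity

theorem fejer_le_one (x : ℝ) : fejer x ≤ 1 := by
  rcases eq_or_ne x 0 with rfl | hx
  · simp [fejer_zero]
  · rw [fejer_eq hx, div_le_one (by positivity)]
    have := one_sub_sq_div_two_le_cos (x := x)
    linarith

theorem fejer_le_div {x : ℝ} (hx : x ≠ 0) : fejer x ≤ 4 / x ^ 2 := by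
  rw [fejer_eq hx]
  have := neg_one_le_cos x
  gcongr
  linarith

theorem third_le_fejer {x : ℝ} (hx : |x| ≤ 1) : 1 / 3 ≤ fejer x := by
  rcases eq_or_ne x 0 with rfl | h0
  · simp [fejer_zero]; norm_num
  · rw [fejer_eq h0, le_div_iff₀ (by positivity)]
    have h3 := cos_le_one_sub_mul_cos_sq (x := x) (hx.trans (by linarith [pi_gt_three]))
    have : 2 / π ^ 2 ≥ 1 / 6 := by
      have := pi_lt_d2
      have hp := pi_pos
      rw [ge_iff_le, le_div_iff₀ (by positivity)]
      nlinarith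
    nlinarith [sq_nonneg x, pow_pos (abs_pos.2 h0) 2, sq_abs x]

theorem measurable_fejer : Measurable fejer := by
  have : fejer = fun x => if x = 0 then 1 else 2 * (1 - cos x) / x ^ 2 := by
    ext x
    split_ifs with h
    · rw [h, fejer_zero]
    · exact fejer_eq h
  rw [this]
  exact Measurable.ite (measurableSet_eq) measurable_const (by fun_prop)


/-- The one-sided exponential kernel. -/
def expKer (α r : ℝ) : ℝ := if 0 ≤ r then exp (-(α * r)) else 0

/-- Smoothing of a measure by the one-sided exponential kernel. -/
def smoothed (α : ℝ) (ν : Measure ℝ) (t : ℝ) : ℝ := ∫ s, expKer α (t - s) ∂ν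

theorem expKer_nonneg (α r : ℝ) : 0 ≤ expKer α r := by
  unfold expKer; split_ifs <;> positivity

theorem expKer_le_one {α : ℝ} (hα : 0 ≤ α) (r : ℝ) : expKer α r ≤ 1 := by
  unfold expKer
  split_ifs with h
  · rw [exp_le_one_iff]; nlinarith [mul_nonneg hα h]
  · exact zero_le_one

theorem measurable_expKer (α : ℝ) : Measurable (expKer α) :=
  Measurable.ite measurableSet_Ici (by fun_prop) measurable_const

theorem integrable_of_bdd {ν : Measure ℝ} [IsFiniteMeasure ν] {g : ℝ → ℝ} (hg : Measurable g)
    {B : ℝ} (h0 : ∀ s, 0 ≤ g s) (hB : ∀ s, g s ≤ B) : Integrable g ν :=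
  Integrable.of_bound hg.aestronglyMeasurable B (Filter.Eventually.of_forall fun s => by
    rw [norm_of_nonneg (h0 s)]; exact hB s)

theorem integrable_expKer {α : ℝ} (hα : 0 ≤ α) (ν : Measure ℝ) [IsFiniteMeasure ν] (t : ℝ) :
    Integrable (fun s => expKer α (t - s)) ν :=
  integrable_of_bdd ((measurable_expKer α).comp (by fun_prop)) (fun _ => expKer_nonneg _ _)
    (fun _ => expKer_le_one hα _)

theorem smoothed_nonneg (α : ℝ) (ν : Measure ℝ) (t : ℝ) : 0 ≤ smoothed α ν t :=
  integral_nonneg fun _ => expKer_nonneg _ _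

theorem smoothed_le_measure {α : ℝ} (hα : 0 ≤ α) (ν : Measure ℝ) [IsFiniteMeasure ν] (t : ℝ) :
    smoothed α ν t ≤ ν.real (Iic t) := by
  rw [← integral_indicator_one measurableSet_Iic]
  apply integral_mono (integrable_expKer hα ν t)
  · exact (integrable_const 1).indicator measurableSet_Iic
  · intro s
    by_cases h : s ≤ t
    · simpa [h] using expKer_le_one hα _
    · have : ¬ 0 ≤ t - s := by linarith
      simp [h, expKer, this]

theorem smoothed_le_univ {α : ℝ} (hα : 0 ≤ α) (ν : Measure ℝ) [IsFiniteMeasure ν] (t : ℝ) :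
    smoothed α ν t ≤ ν.real univ :=
  (smoothed_le_measure hα ν t).trans (measureReal_mono (subset_univ _))

/-- Integrating a pointwise bound by a series of bounded functions. -/
theorem integral_le_of_le_tsum {ν : Measure ℝ} [IsFiniteMeasure ν] {κ g₀ : ℝ → ℝ}
    {g : ℕ → ℝ → ℝ} {a : ℕ → ℝ} {B : ℝ} (hκ : ∀ s, 0 ≤ κ s) (hg₀ : Integrable g₀ ν)
    (hgm : ∀ j, Measurable (g j)) (hg0 : ∀ j s, 0 ≤ g j s) (hg2 : ∀ j s, g j s ≤ 2)
    (ha : ∀ j, 0 ≤ a j) (hs : Summable a) (hle : ∀ s, κ s ≤ g₀ s + ∑' j, a j * g j s)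
    (hB : ∀ j, ∫ s, g j s ∂ν ≤ B) :
    ∫ s, κ s ∂ν ≤ ∫ s, g₀ s ∂ν + (∑' j, a j) * B := by
  have hint : ∀ j, Integrable (fun s => a j * g j s) ν := fun j =>
    (integrable_of_bdd (hgm j) (hg0 j) (hg2 j)).const_mul _
  have hsum : Summable fun j => ∫ s, ‖a j * g j s‖ ∂ν := by
    refine Summable.of_nonneg_of_le (fun j => integral_nonneg fun _ => norm_nonneg _) (fun j => ?_)
      (hs.mul_right B)
    have : (fun s => ‖a j * g j s‖) = fun s => a j * g j s := by
      ext s; exact norm_of_nonneg (mul_nonneg (ha j) (hg0 j s))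
    rw [this, integral_const_mul]
    exact mul_le_mul_of_nonneg_left (hB j) (ha j)
  have hS := hasSum_integral_of_summable_integral_norm hint hsum
  have hbd : ∀ s, ∑' j, a j * g j s ≤ (∑' j, a j) * 2 := fun s => by
    rw [← tsum_mul_right]
    refine Summable.tsum_le_tsum (fun j => mul_le_mul_of_nonneg_left (hg2 j s) (ha j)) ?_
      (hs.mul_right 2)
    exact Summable.of_nonneg_of_le (fun j => mul_nonneg (ha j) (hg0 j s))
      (fun j => mul_le_mul_of_nonneg_left (hg2 j s) (ha j)) (hs.mul_right 2)
  have hI : Integrable (fun s => ∑' j, a j * g j s) ν :=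
    integrable_of_bdd (by fun_prop) (fun s => tsum_nonneg fun j => mul_nonneg (ha j) (hg0 j s)) hbd
  calc ∫ s, κ s ∂ν ≤ ∫ s, (g₀ s + ∑' j, a j * g j s) ∂ν :=
        integral_mono_of_nonneg (Filter.Eventually.of_forall hκ) (hg₀.add hI)
          (Filter.Eventually.of_forall hle)
    _ = ∫ s, g₀ s ∂ν + ∑' j, ∫ s, a j * g j s ∂ν := by rw [integral_add hg₀ hI, hS.tsum_eq]
    _ ≤ _ := by
        gcongr
        rw [← tsum_mul_right]
        refine hS.summable.tsum_le_tsum (fun j => ?_) (hs.mul_right B)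
        rw [integral_const_mul]
        exact mul_le_mul_of_nonneg_left (hB j) (ha j)

theorem le_tsum_of_one {a : ℕ → ℝ} {g : ℕ → ℝ} (ha : ∀ j, 0 ≤ a j) (hs : Summable a)
    (hg0 : ∀ j, 0 ≤ g j) (hg2 : ∀ j, g j ≤ 2) (i : ℕ) : a i * g i ≤ ∑' j, a j * g j := by
  refine Summable.le_tsum (f := fun j => a j * g j) ?_ i fun j _ => mul_nonneg (ha j) (hg0 j)
  exact Summable.of_nonneg_of_le (fun j => mul_nonneg (ha j) (hg0 j))
      (fun j => mul_le_mul_of_nonneg_left (hg2 j) (ha j)) (hs.mul_right 2)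

theorem expKer_scaled {α r x : ℝ} (hα : 0 < α) (h : r = x / α) (hx : 0 ≤ x) :
    expKer α r = exp (-x) := by
  have : 0 ≤ r := by rw [h]; positivity
  rw [expKer, if_pos this, h, mul_div_cancel₀ _ hα.ne']

theorem summable_exp_neg_nat : Summable fun i : ℕ => exp (-(i : ℝ)) := by
  simpa using Real.summable_exp_neg_nat

theorem summable_exp_neg_nat_mul : Summable fun i : ℕ => ((i : ℝ) + 1) * exp (-(i : ℝ)) := by
  have h := Real.summable_pow_mul_exp_neg_nat_mul 1 (r := 1) one_pos
  simp only [pow_one, neg_mul, one_mul] at h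
  refine (h.add summable_exp_neg_nat).congr fun i => by ring

/-- The one-sided exponential average is dominated by Fejér averages. -/
theorem smoothed_le_of_fejer {α ε : ℝ} (hα : 0 < α) (hε : 0 < ε) (hε1 : ε ≤ 1) (ν : Measure ℝ)
    [IsFiniteMeasure ν] {B : ℝ} (hB : ∀ t, ∫ s, fejer (ε * α * (t - s)) ∂ν ≤ B) (t : ℝ) :
    smoothed α ν t ≤ (∑' i : ℕ, 3 * exp (-(i : ℝ))) * B := by
  have hs : Summable fun i : ℕ => 3 * exp (-(i : ℝ)) := summable_exp_neg_nat.mul_left 3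
  have := integral_le_of_le_tsum (ν := ν) (κ := fun s => expKer α (t - s)) (g₀ := fun _ => 0)
    (g := fun i s => fejer (ε * α * ((t - i / α) - s))) (a := fun i : ℕ => 3 * exp (-(i : ℝ)))
    (B := B) (fun _ => expKer_nonneg _ _) (integrable_zero _ _ _)
    (fun j => measurable_fejer.comp (by fun_prop))
    (fun _ _ => fejer_nonneg _) (fun _ _ => (fejer_le_one _).trans one_le_two)
    (fun _ => by positivity) hs ?_ (fun j => hB _)
  · simpa [smoothed] using this
  intro s
  rw [zero_add]
  by_cases h : 0 ≤ t - s
  · set x := α * (t - s) with hx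
    have hx0 : 0 ≤ x := by positivity
    refine le_trans ?_ (le_tsum_of_one (fun _ => by positivity) hs (fun _ => fejer_nonneg _)
      (fun _ => (fejer_le_one _).trans one_le_two) ⌊x⌋₊)
    have h1 := Nat.floor_le hx0
    have h2 := Nat.lt_floor_add_one x
    have h3 : ε * α * (t - ⌊x⌋₊ / α - s) = ε * (x - ⌊x⌋₊) := by
      rw [hx]; field_simp; ring
    have h4 : 1 / 3 ≤ fejer (ε * α * (t - ⌊x⌋₊ / α - s)) := by
      rw [h3]
      apply third_le_fejer
      rw [abs_of_nonneg (by apply mul_nonneg hε.le; linarith)]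
      nlinarith
    rw [expKer, if_pos h, ← hx]
    have h5 : exp (-x) ≤ exp (-(⌊x⌋₊ : ℝ)) := exp_le_exp.2 (by linarith)
    nlinarith [exp_pos (-(⌊x⌋₊ : ℝ))]
  · rw [expKer, if_neg h]
    exact tsum_nonneg fun j => mul_nonneg (by positivity) (fejer_nonneg _)

theorem summable_tail (c : ℝ) (N : ℕ) : Summable fun j : ℕ => c / ((j + N : ℕ) : ℝ) ^ 2 := by
  have h : Summable fun j : ℕ => c / (j : ℝ) ^ 2 := by
    simpa [div_eq_mul_inv] using (Real.summable_nat_pow_inv.2 one_lt_two).mul_left c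
  exact (summable_nat_add_iff N).2 h

/-- Fejér averages are dominated by one-sided exponential averages. -/
theorem fejer_le_smoothed {α ε : ℝ} (hα : 0 < α) (hε : 0 < ε) (ν : Measure ℝ)
    [IsFiniteMeasure ν] {B : ℝ} (hB : ∀ t, smoothed α ν t ≤ B) {N : ℕ} (hN : 1 ≤ N) (t : ℝ) :
    ∫ s, fejer (ε * α * (t - s)) ∂ν ≤ exp (2 * N) * smoothed α ν (t + N / α)
      + (∑' j : ℕ, (4 * exp 1 / ε ^ 2) / ((j + N : ℕ) : ℝ) ^ 2) * (2 * B) := by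
  have hs := summable_tail (4 * exp 1 / ε ^ 2) N
  have hN' : (1 : ℝ) ≤ N := by exact_mod_cast hN
  have := integral_le_of_le_tsum (ν := ν) (κ := fun s => fejer (ε * α * (t - s)))
    (g₀ := fun s => exp (2 * N) * expKer α (t + N / α - s))
    (g := fun j s => expKer α (t - (j + N : ℕ) / α - s) + expKer α (t + ((j + N : ℕ) + 1) / α - s))
    (a := fun j : ℕ => (4 * exp 1 / ε ^ 2) / ((j + N : ℕ) : ℝ) ^ 2)
    (B := 2 * B) (fun _ => fejer_nonneg _) ((integrable_expKer hα.le _ _).const_mul _)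
    (fun j => ((measurable_expKer α).comp (by fun_prop)).add
      ((measurable_expKer α).comp (by fun_prop)))
    (fun _ _ => add_nonneg (expKer_nonneg _ _) (expKer_nonneg _ _))
    (fun j s => by linarith [expKer_le_one hα.le (t - (j + N : ℕ) / α - s),
      expKer_le_one hα.le (t + ((j + N : ℕ) + 1) / α - s)])
    (fun _ => by positivity) hs ?_ (fun j => ?_)
  · rw [integral_const_mul] at this; exact this
  · intro s
    have hg0 : ∀ j : ℕ, 0 ≤ expKer α (t - (j + N : ℕ) / α - s)
        + expKer α (t + ((j + N : ℕ) + 1) / α - s) :=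
      fun _ => add_nonneg (expKer_nonneg _ _) (expKer_nonneg _ _)
    have hg2 : ∀ j : ℕ, expKer α (t - (j + N : ℕ) / α - s)
        + expKer α (t + ((j + N : ℕ) + 1) / α - s) ≤ 2 := fun j => by
      linarith [expKer_le_one hα.le (t - (j + N : ℕ) / α - s),
        expKer_le_one hα.le (t + ((j + N : ℕ) + 1) / α - s)]
    have hts := le_tsum_of_one (fun j => by positivity) hs hg0 hg2
    have hts0 : 0 ≤ ∑' j : ℕ, (4 * exp 1 / ε ^ 2) / ((j + N : ℕ) : ℝ) ^ 2 *
        (expKer α (t - (j + N : ℕ) / α - s) + expKer α (t + ((j + N : ℕ) + 1) / α - s)) :=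
      tsum_nonneg fun j => mul_nonneg (by positivity) (hg0 j)
    set x := α * (t - s) with hx
    have hxs : t - s = x / α := by rw [hx]; field_simp
    have harg : ε * α * (t - s) = ε * x := by rw [hx]; ring
    rw [harg]
    by_cases h : |x| ≤ N
    · have ⟨h1, h2⟩ := abs_le.1 h
      have : expKer α (t + N / α - s) = exp (-(x + N)) :=
        expKer_scaled hα (by rw [add_div, ← hxs]; ring) (by linarith)
      rw [this, ← exp_add]
      have : 1 ≤ exp (2 * N + -(x + N)) := one_le_exp (by linarith)
      linarith [fejer_le_one (ε * x)]
    · push Not at h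
      have hax : 0 < |x| := by linarith
      have hx0 : x ≠ 0 := abs_pos.1 hax
      have hj : N ≤ ⌊|x|⌋₊ := Nat.le_floor h.le
      obtain ⟨j, hj⟩ := Nat.exists_eq_add_of_le' hj
      have h1 := Nat.floor_le hax.le
      have h2 := Nat.lt_floor_add_one |x|
      rw [hj] at h1 h2
      have hjN : (0 : ℝ) < (j + N : ℕ) := by
        have : 0 < j + N := by omega
        exact_mod_cast this
      have hw : fejer (ε * x) ≤ (4 * exp 1 / ε ^ 2) / ((j + N : ℕ) : ℝ) ^ 2 * exp (-1) := by
        refine (fejer_le_div (by positivity)).trans ?_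
        have : (4 * exp 1 / ε ^ 2) / ((j + N : ℕ) : ℝ) ^ 2 * exp (-1)
            = 4 / (ε ^ 2 * ((j + N : ℕ) : ℝ) ^ 2) := by
          rw [exp_neg]; field_simp
        rw [this, mul_pow, ← sq_abs x]
        gcongr
      refine hw.trans (le_trans ?_ ((hts j).trans (by
        have := expKer_nonneg α (t + N / α - s)
        have := mul_nonneg (exp_pos (2 * (N : ℝ))).le this
        linarith)))
      refine mul_le_mul_of_nonneg_left ?_ (by positivity)
      rcases le_or_gt 0 x with hp | hn
      · rw [abs_of_nonneg hp] at h1 h2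
        have := expKer_scaled (r := t - (j + N : ℕ) / α - s) (x := x - (j + N : ℕ)) hα
          (by rw [sub_div, ← hxs]; ring) (by linarith)
        have h3 := expKer_nonneg α (t + ((j + N : ℕ) + 1) / α - s)
        have h4 : exp (-1) ≤ exp (-(x - (j + N : ℕ))) := exp_le_exp.2 (by linarith)
        linarith
      · rw [abs_of_neg hn] at h1 h2
        have := expKer_scaled (r := t + ((j + N : ℕ) + 1) / α - s) (x := x + ((j + N : ℕ) + 1)) hα
          (by rw [add_div x, ← hxs]; ring) (by linarith)
        have h3 := expKer_nonneg α (t - (j + N : ℕ) / α - s)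
        have h4 : exp (-1) ≤ exp (-(x + ((j + N : ℕ) + 1))) := exp_le_exp.2 (by linarith)
        linarith
  · rw [integral_add (integrable_expKer hα.le _ _) (integrable_expKer hα.le _ _)]
    have h1 := hB (t - (j + N : ℕ) / α)
    have h2 := hB (t + ((j + N : ℕ) + 1) / α)
    unfold smoothed at h1 h2
    linarith


/-- A finite measure `μ` on `[0, ∞)` and a probability measure `q` on `(0, ∞)` with
`s dμ = L d(μ ∗ q)`. -/
structure SizeBiased (μ q : Measure ℝ) (L : ℝ) : Prop where
  nonneg : ∀ᵐ s ∂μ, 0 ≤ s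
  pos : ∀ᵐ s ∂q, 0 < s
  L_pos : 0 < L
  bias : μ.withDensity (fun s => ENNReal.ofReal s) = ENNReal.ofReal L • (μ ∗ q)

section
variable {μ q : Measure ℝ} {L : ℝ}

theorem SizeBiased.integral_smul (h : SizeBiased μ q L) {E : Type*} [NormedAddCommGroup E]
    [NormedSpace ℝ E] (G : ℝ → E) :
    ∫ s, s • G s ∂μ = L • ∫ s, G s ∂(μ ∗ q) := by
  have h1 := integral_withDensity_eq_integral_toReal_smul (μ := μ)
    (f := fun s => ENNReal.ofReal s) (by fun_prop) (by simp) G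
  rw [h.bias, integral_smul_measure, ENNReal.toReal_ofReal h.L_pos.le] at h1
  rw [h1]
  apply integral_congr_ae
  filter_upwards [h.nonneg] with s hs
  rw [ENNReal.toReal_ofReal hs]

theorem SizeBiased.integrable_smul (h : SizeBiased μ q L) {E : Type*} [NormedAddCommGroup E]
    [NormedSpace ℝ E] (G : ℝ → E) (hG : Integrable G (μ ∗ q)) :
    Integrable (fun s => s • G s) μ := by
  have h1 := integrable_withDensity_iff_integrable_smul' (μ := μ)
    (f := fun s => ENNReal.ofReal s) (by fun_prop) (by simp) (g := G)
  rw [h.bias] at h1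
  refine (h1.1 (hG.smul_measure (by simp))).congr ?_
  filter_upwards [h.nonneg] with s hs
  rw [ENNReal.toReal_ofReal hs]

variable [IsFiniteMeasure μ] [IsProbabilityMeasure q]

theorem SizeBiased.integrable_id (h : SizeBiased μ q L) : Integrable (fun s => s) μ := by
  simpa using h.integrable_smul (fun _ => (1 : ℝ)) (integrable_const _)

theorem smoothed_conv {α : ℝ} (hα : 0 ≤ α) (ν : Measure ℝ) [IsFiniteMeasure ν] (t : ℝ) :
    smoothed α (ν ∗ q) t = ∫ v, smoothed α ν (t - v) ∂q := by
  rw [smoothed, Measure.conv_comm, integral_conv (integrable_expKer hα _ t)]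
  congr 1; ext v
  simp only [smoothed]
  congr 1; ext s
  congr 1; ring

theorem integrable_smoothed {α : ℝ} (hα : 0 ≤ α) (ν : Measure ℝ) [IsFiniteMeasure ν] (t : ℝ) :
    Integrable (fun v => smoothed α ν (t - v)) q := by
  refine integrable_of_bdd ?_ (fun _ => smoothed_nonneg _ _ _) (fun _ => smoothed_le_univ hα ν _)
  unfold smoothed
  have : Measurable fun p : ℝ × ℝ => expKer α (t - p.1 - p.2) :=
    (measurable_expKer α).comp (by fun_prop)
  exact this.stronglyMeasurable.integral_prod_right.measurable

theorem smoothed_conv_le {α : ℝ} (hα : 0 ≤ α) (ν : Measure ℝ) [IsFiniteMeasure ν] {B : ℝ}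
    (hB : ∀ t, smoothed α ν t ≤ B) (t : ℝ) : smoothed α (ν ∗ q) t ≤ B := by
  rw [smoothed_conv hα]
  calc _ ≤ ∫ _, B ∂q := integral_mono (integrable_smoothed hα ν t) (integrable_const _)
        fun v => hB _
    _ = B := by simp

/-- The smoothed mass dominates its average over backward steps, up to `L`. -/
theorem SizeBiased.smoothed_conv_le (h : SizeBiased μ q L) {α : ℝ} (hα : 0 ≤ α) {t : ℝ}
    (ht : t ≤ L) : smoothed α (μ ∗ q) t ≤ smoothed α μ t := by
  have h1 := h.integral_smul (fun s => expKer α (t - s))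
  simp only [smul_eq_mul] at h1
  have h2 : ∫ s, s * expKer α (t - s) ∂μ ≤ ∫ s, L * expKer α (t - s) ∂μ := by
    refine integral_mono_ae (h.integrable_smul _ (integrable_expKer hα _ t))
      ((integrable_expKer hα _ t).const_mul _) (Filter.Eventually.of_forall fun s => ?_)
    by_cases hs : 0 ≤ t - s
    · exact mul_le_mul_of_nonneg_right (by linarith) (expKer_nonneg _ _)
    · simp [expKer, hs]
  rw [h1, integral_const_mul] at h2
  exact le_of_mul_le_mul_left h2 h.L_pos

theorem SizeBiased.smoothed_conv_conv_le (h : SizeBiased μ q L) {α : ℝ} (hα : 0 ≤ α) :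
    smoothed α ((μ ∗ q) ∗ q) L ≤ smoothed α μ L := by
  refine le_trans ?_ (h.smoothed_conv_le hα le_rfl)
  rw [smoothed_conv hα, smoothed_conv hα]
  refine integral_mono_ae (integrable_smoothed hα _ _) (integrable_smoothed hα _ _) ?_
  filter_upwards [h.pos] with v hv
  exact h.smoothed_conv_le hα (by linarith)

theorem SizeBiased.mul_smoothed_eq (h : SizeBiased μ q L) {α : ℝ} (hα : 0 ≤ α) (t : ℝ) :
    t * smoothed α μ t = L * smoothed α (μ ∗ q) t + ∫ s, (t - s) * expKer α (t - s) ∂μ := by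
  have h1 := h.integral_smul (fun s => expKer α (t - s))
  have hi := h.integrable_smul _ (integrable_expKer hα (μ ∗ q) t)
  simp only [smul_eq_mul] at h1 hi
  have : (fun s => (t - s) * expKer α (t - s)) =
      fun s => t * expKer α (t - s) - s * expKer α (t - s) := by ext; ring
  rw [this, integral_sub ((integrable_expKer hα _ _).const_mul _) hi, h1, integral_const_mul]
  simp only [smoothed]; ring

theorem SizeBiased.mul_smoothed_le (h : SizeBiased μ q L) {α : ℝ} (hα : 0 < α) (t : ℝ) :
    t * smoothed α μ t ≤ L * smoothed α (μ ∗ q) t + μ.real (Iic t) / α := by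
  rw [h.mul_smoothed_eq hα.le]
  gcongr
  rw [← integral_indicator_one measurableSet_Iic, ← integral_div]
  refine integral_mono_of_nonneg (Filter.Eventually.of_forall fun s => ?_)
    (((integrable_const 1).indicator measurableSet_Iic).div_const α)
    (Filter.Eventually.of_forall fun s => ?_)
  · by_cases hs : 0 ≤ t - s
    · exact mul_nonneg hs (expKer_nonneg _ _)
    · simp [expKer, hs]
  · by_cases hs : s ≤ t
    · simp only [hs, mem_Iic, indicator_of_mem, Pi.one_apply]
      have h0 : 0 ≤ t - s := by linarith
      rw [expKer, if_pos h0, le_div_iff₀ hα, exp_neg, ← div_eq_mul_inv, div_mul_eq_mul_div,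
        div_le_one (exp_pos _)]
      linarith [add_one_le_exp (α * (t - s))]
    · have : ¬ 0 ≤ t - s := by linarith
      simp [hs, expKer, this]

theorem SizeBiased.mul_smoothed_le_sup (h : SizeBiased μ q L) {α : ℝ} (hα : 0 < α) {H : ℝ}
    (hH : ∀ t, smoothed α μ t ≤ H) (t : ℝ) :
    t * smoothed α μ t ≤ L * smoothed α (μ ∗ q) t
      + (∑' i : ℕ, ((i : ℝ) + 1) * exp (-(i : ℝ))) / α * H := by
  rw [h.mul_smoothed_eq hα.le]
  gcongr
  have hs : Summable fun i : ℕ => (((i : ℝ) + 1) * exp (-(i : ℝ))) / α :=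
    summable_exp_neg_nat_mul.div_const α
  have := integral_le_of_le_tsum (ν := μ) (κ := fun s => (t - s) * expKer α (t - s))
    (g₀ := fun _ => 0) (g := fun i s => expKer α ((t - i / α) - s))
    (a := fun i : ℕ => (((i : ℝ) + 1) * exp (-(i : ℝ))) / α)
    (B := H) (fun s => ?_) (integrable_zero _ _ _)
    (fun j => (measurable_expKer α).comp (by fun_prop))
    (fun _ _ => expKer_nonneg _ _) (fun _ _ => (expKer_le_one hα.le _).trans one_le_two)
    (fun _ => by positivity) hs (fun s => ?_) (fun j => hH _)
  · rw [← tsum_div_const]; simpa using this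
  · by_cases hs : 0 ≤ t - s
    · exact mul_nonneg hs (expKer_nonneg _ _)
    · simp [expKer, hs]
  · rw [zero_add]
    by_cases h : 0 ≤ t - s
    · set x := α * (t - s) with hx
      have hx0 : 0 ≤ x := by positivity
      have hts : t - s = x / α := by rw [hx]; field_simp
      refine le_trans ?_ (le_tsum_of_one (fun _ => by positivity) hs (fun _ => expKer_nonneg _ _)
        (fun _ => (expKer_le_one hα.le _).trans one_le_two) ⌊x⌋₊)
      have h1 := Nat.floor_le hx0
      have h2 := Nat.lt_floor_add_one x
      rw [expKer_scaled hα hts hx0, expKer_scaled (x := x - ⌊x⌋₊) hα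
        (by rw [sub_div, ← hts]; ring) (by linarith), hts]
      have h3 : exp (-x) = exp (-(⌊x⌋₊ : ℝ)) * exp (-(x - ⌊x⌋₊)) := by rw [← exp_add]; ring_nf
      have h4 : x * (exp (-(⌊x⌋₊ : ℝ)) * exp (-(x - ⌊x⌋₊)) / α) ≤
          (⌊x⌋₊ + 1) * (exp (-(⌊x⌋₊ : ℝ)) * exp (-(x - ⌊x⌋₊)) / α) :=
        mul_le_mul_of_nonneg_right h2.le (by positivity)
      rw [h3]
      calc _ = _ := by ring
        _ ≤ _ := h4
        _ = _ := by ring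
    · rw [expKer, if_neg h, mul_zero]
      exact tsum_nonneg fun j => mul_nonneg (by positivity) (expKer_nonneg _ _)

/-- The supremum of the smoothed mass is controlled by that of its two-step average. -/
theorem SizeBiased.smoothed_le (h : SizeBiased μ q L) {α : ℝ} (hα : 0 < α) {B D : ℝ}
    (hL : 12 * (∑' i : ℕ, ((i : ℝ) + 1) * exp (-(i : ℝ))) ≤ α * L)
    (hB0 : 0 ≤ B) (hB : ∀ t ≤ L / 2, smoothed α μ t ≤ B)
    (hD : ∀ t, smoothed α ((μ ∗ q) ∗ q) t ≤ D) (t : ℝ) :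
    smoothed α μ t ≤ 8 * D + 6 * B := by
  set c := ∑' i : ℕ, ((i : ℝ) + 1) * exp (-(i : ℝ)) with hc
  have hbdd : BddAbove (range (smoothed α μ)) :=
    ⟨μ.real univ, by rintro _ ⟨t, rfl⟩; exact smoothed_le_univ hα.le μ t⟩
  set H := ⨆ t, smoothed α μ t with hHdef
  have hH : ∀ t, smoothed α μ t ≤ H := fun t => le_ciSup hbdd t
  have hH0 : 0 ≤ H := (smoothed_nonneg α μ 0).trans (hH 0)
  have hL0 := h.L_pos
  have step : ∀ t, smoothed α μ t ≤ 2 * smoothed α (μ ∗ q) t + B + H / 6 := by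
    intro t
    have hP := smoothed_nonneg α (μ ∗ q) t
    rcases le_or_gt t (L / 2) with ht | ht
    · linarith [hB t ht]
    · have h1 := h.mul_smoothed_le_sup hα hH t
      rw [← hc] at h1
      have h2 : c / α * H ≤ L / 12 * H := by
        refine mul_le_mul_of_nonneg_right ?_ hH0
        rw [div_le_iff₀ hα]; linarith
      have h3 : L / 2 * smoothed α μ t ≤ t * smoothed α μ t :=
        mul_le_mul_of_nonneg_right ht.le (smoothed_nonneg _ _ _)
      have h4 : L / 2 * smoothed α μ t ≤ L / 2 * (2 * smoothed α (μ ∗ q) t + H / 6) := by linarith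
      linarith [le_of_mul_le_mul_left h4 (by positivity)]
  have step2 : ∀ t, smoothed α (μ ∗ q) t ≤ 2 * D + B + H / 6 := by
    intro t
    have h1 : smoothed α (μ ∗ q) t ≤ ∫ v, (2 * smoothed α (μ ∗ q) (t - v) + B + H / 6) ∂q := by
      rw [smoothed_conv hα.le]
      exact integral_mono (integrable_smoothed hα.le _ _)
        ((((integrable_smoothed hα.le _ _).const_mul _).add (integrable_const _)).add
          (integrable_const _)) fun v => step _
    have h2 : ∫ v, (2 * smoothed α (μ ∗ q) (t - v) + B + H / 6) ∂q
        = 2 * smoothed α ((μ ∗ q) ∗ q) t + (B + H / 6) := by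
      simp only [add_assoc]
      rw [integral_add ((integrable_smoothed hα.le _ _).const_mul _) (integrable_const _),
        integral_const_mul, ← smoothed_conv hα.le]
      simp
    linarith [hD t]
  have : H ≤ 4 * D + 3 * B + H / 2 := ciSup_le fun t => by linarith [step t, step2 t]
  linarith [hH t]

end

theorem norm_exp_ofReal_mul_I_sub_one_le (x : ℝ) : ‖Complex.exp (x * Complex.I) - 1‖ ≤ |x| := by
  have := Real.norm_exp_I_mul_ofReal_sub_one_le (x := x)
  rwa [mul_comm, Real.norm_eq_abs] at this

theorem norm_exp_ofReal_mul_I_taylor_le (x : ℝ) :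
    ‖Complex.exp (x * Complex.I) - 1 - x * Complex.I + x ^ 2 / 2‖ ≤ 4 * |x| ^ 3 := by
  rcases le_or_gt |x| 1 with h | h
  · have := Complex.exp_bound (x := x * Complex.I) (by simpa using h) (n := 3) (by norm_num)
    simp [Finset.sum_range_succ] at this
    have h3 : Complex.exp (x * Complex.I) - (1 + x * Complex.I + (x * Complex.I) ^ 2 / 2)
        = Complex.exp (x * Complex.I) - 1 - x * Complex.I + x ^ 2 / 2 := by
      rw [mul_pow, Complex.I_sq]; ring
    rw [h3] at this
    refine this.trans ?_
    rw [mul_comm]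
    gcongr
    norm_num [Nat.factorial]
  · have h1 := norm_exp_ofReal_mul_I_sub_one_le x
    have h2 : ‖(x * Complex.I : ℂ)‖ = |x| := by simp
    have h3 : ‖((x : ℂ) ^ 2 / 2)‖ = |x| ^ 2 / 2 := by simp
    have h4 : |x| ≤ |x| ^ 3 := le_self_pow₀ h.le (by norm_num)
    have h5 : |x| ^ 2 ≤ |x| ^ 3 := pow_le_pow_right₀ h.le (by norm_num)
    calc _ ≤ ‖Complex.exp (x * Complex.I) - 1‖ + ‖(x * Complex.I : ℂ)‖ + ‖((x : ℂ) ^ 2 / 2)‖ :=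
          (norm_add_le _ _).trans (by gcongr; exact norm_sub_le _ _)
      _ ≤ _ := by rw [h2, h3]; linarith

theorem hasDerivAt_exp_mul_I (s τ : ℝ) : HasDerivAt (fun t : ℝ => Complex.exp (t * s * Complex.I))
    (s * Complex.I * Complex.exp (τ * s * Complex.I)) τ := by
  have h : HasDerivAt (fun t : ℝ => (t : ℂ) * s * Complex.I) (s * Complex.I) τ := by
    simpa [mul_assoc] using (Complex.ofRealCLM.hasDerivAt (x := τ)).mul_const (s * Complex.I : ℂ)
  exact h.cexp.congr_deriv (by ring)

theorem norm_exp_mul_mul_I (t s : ℝ) : ‖Complex.exp (t * s * Complex.I)‖ = 1 := by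
  have := Complex.norm_exp_ofReal_mul_I (t * s)
  simpa using this

/-- The integrated characteristic exponent of a measure on `(0, ∞)`. -/
def charExponent (q : Measure ℝ) (τ : ℝ) : ℂ :=
  ∫ s, (Complex.exp (τ * s * Complex.I) - 1) / s ∂q

section
variable {μ q : Measure ℝ} [IsProbabilityMeasure q] {L : ℝ}

theorem SizeBiased.hasDerivAt_charExponent (h : SizeBiased μ q L) (τ : ℝ) :
    HasDerivAt (charExponent q) (Complex.I * charFun q τ) τ := by
  have h1 : HasDerivAt (charExponent q) (∫ s, Complex.I * Complex.exp (τ * s * Complex.I) ∂q) τ :=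
    (hasDerivAt_integral_of_dominated_loc_of_deriv_le (s := univ) (bound := fun s => 1)
      (μ := q) (F := fun (t : ℝ) (s : ℝ) => (Complex.exp (t * s * Complex.I) - 1) / s)
      (F' := fun (t : ℝ) (s : ℝ) => Complex.I * Complex.exp (t * s * Complex.I)) (x₀ := τ)
      Filter.univ_mem (Filter.Eventually.of_forall fun t => by
        exact Measurable.aestronglyMeasurable (by fun_prop))
      (Integrable.of_bound (Measurable.aestronglyMeasurable (by fun_prop)) |τ| (by
        filter_upwards [h.pos] with s hs
        rw [norm_div, Complex.norm_real, div_le_iff₀ (by simpa using hs.ne'), norm_eq_abs, ← abs_mul]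
        have := norm_exp_ofReal_mul_I_sub_one_le (τ * s)
        simpa using this))
      (by fun_prop) (Filter.Eventually.of_forall fun s t _ => by
        simp [norm_exp_mul_mul_I]) (integrable_const _)
      (by
        filter_upwards [h.pos] with s hs t _
        have hs' : (s : ℂ) ≠ 0 := by exact_mod_cast hs.ne'
        exact (((hasDerivAt_exp_mul_I s t).sub_const 1).div_const (s : ℂ)).congr_deriv
          (by field_simp))).2
  refine h1.congr_deriv ?_
  rw [integral_const_mul, charFun_apply_real]

theorem SizeBiased.integrable_charExponent (h : SizeBiased μ q L) (τ : ℝ) :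
    Integrable (fun s : ℝ => (Complex.exp (τ * s * Complex.I) - 1) / s) q :=
  Integrable.of_bound (Measurable.aestronglyMeasurable (by fun_prop)) |τ| (by
    filter_upwards [h.pos] with s hs
    rw [norm_div, Complex.norm_real, div_le_iff₀ (by simpa using hs.ne'), norm_eq_abs, ← abs_mul]
    have := norm_exp_ofReal_mul_I_sub_one_le (τ * s)
    simpa using this)

theorem re_charExponent_integrand (τ s : ℝ) :
    ((Complex.exp (τ * s * Complex.I) - 1) / s).re = -((1 - cos (τ * s)) / s) := by
  rw [Complex.div_ofReal_re]
  have := Complex.exp_ofReal_mul_I_re (τ * s)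
  push_cast at this
  simp [this]
  ring

theorem SizeBiased.integrable_one_sub_cos (h : SizeBiased μ q L) (τ : ℝ) :
    Integrable (fun s : ℝ => (1 - cos (τ * s)) / s) q := by
  have := (h.integrable_charExponent τ).re.neg
  refine this.congr (Filter.Eventually.of_forall fun s => ?_)
  simp only [Pi.neg_apply, RCLike.re_eq_complex_re, re_charExponent_integrand, neg_neg]

variable [IsFiniteMeasure μ]

theorem SizeBiased.hasDerivAt_charFun (h : SizeBiased μ q L) (τ : ℝ) :
    HasDerivAt (charFun μ) (L * Complex.I * charFun q τ * charFun μ τ) τ := by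
  have h1 : HasDerivAt (fun t : ℝ => ∫ s, Complex.exp (t * s * Complex.I) ∂μ)
      (∫ s, s * Complex.I * Complex.exp (τ * s * Complex.I) ∂μ) τ :=
    (hasDerivAt_integral_of_dominated_loc_of_deriv_le (s := univ) (bound := fun s => |s|)
      Filter.univ_mem (Filter.Eventually.of_forall fun t => by fun_prop)
      (Integrable.of_bound (by fun_prop) 1 (Filter.Eventually.of_forall fun s => by
        rw [norm_exp_mul_mul_I]))
      (by fun_prop) (Filter.Eventually.of_forall fun s t _ => by
        simp [norm_exp_mul_mul_I]) h.integrable_id.abs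
      (Filter.Eventually.of_forall fun s t _ => hasDerivAt_exp_mul_I s t)).2
  have h2 : charFun μ = fun t : ℝ => ∫ s, Complex.exp (t * s * Complex.I) ∂μ := by
    ext t; exact charFun_apply_real t
  rw [← h2] at h1
  refine h1.congr_deriv ?_
  have h3 := h.integral_smul (fun s => Complex.exp (τ * s * Complex.I))
  rw [← charFun_apply_real, charFun_conv] at h3
  have h4 : (fun s : ℝ => s * Complex.I * Complex.exp (τ * s * Complex.I))
      = fun s : ℝ => Complex.I * (s • Complex.exp (τ * s * Complex.I)) := by
    ext s; rw [Complex.real_smul]; ring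
  rw [h4, integral_const_mul, h3, Complex.real_smul]
  ring

theorem SizeBiased.charFun_eq (h : SizeBiased μ q L) (τ : ℝ) :
    charFun μ τ = μ.real univ * Complex.exp (L * charExponent q τ) := by
  have h1 : ∀ t, HasDerivAt (fun t => charFun μ t * Complex.exp (-(L * charExponent q t))) 0 t := by
    intro t
    refine ((h.hasDerivAt_charFun t).mul
      (((h.hasDerivAt_charExponent t).const_mul (L : ℂ)).neg.cexp)).congr_deriv ?_
    ring
  have h2 := is_const_of_deriv_eq_zero (fun t => (h1 t).differentiableAt) (fun t => (h1 t).deriv)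
    τ 0
  have h3 : charExponent q 0 = 0 := by simp [charExponent]
  simp only [h3, charFun_zero, mul_zero, neg_zero, Complex.exp_zero, mul_one] at h2
  rw [← h2, mul_assoc, ← Complex.exp_add]
  simp

theorem SizeBiased.norm_charFun_eq (h : SizeBiased μ q L) (τ : ℝ) :
    ‖charFun μ τ‖ = μ.real univ * exp (-(L * ∫ s, (1 - cos (τ * s)) / s ∂q)) := by
  rw [h.charFun_eq, norm_mul, Complex.norm_exp, Complex.norm_real, norm_of_nonneg measureReal_nonneg]
  have : (charExponent q τ).re = -∫ s, (1 - cos (τ * s)) / s ∂q := by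
    have h1 := integral_re (h.integrable_charExponent τ)
    simp only [RCLike.re_eq_complex_re, re_charExponent_integrand, integral_neg] at h1
    exact h1.symm
  rw [Complex.re_ofReal_mul, this, mul_neg]

/-- Gaussian decay of the characteristic function near the origin. -/
theorem SizeBiased.norm_charFun_le_gaussian (h : SizeBiased μ q L)
    (hq2 : Integrable (fun s : ℝ => s ^ 2) q) (hq1 : Integrable (fun s : ℝ => s) q) {M : ℝ}
    (hM0 : 0 < M) (hM : ∫ s, s ^ 2 ∂q ≤ 2 * M * ∫ s, s ∂q) {τ : ℝ} (hτ : |τ| ≤ π / (4 * M)) :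
    ‖charFun μ τ‖ ≤ μ.real univ * exp (-(τ ^ 2 * (L * ∫ s, s ∂q) / π ^ 2)) := by
  rw [h.norm_charFun_eq]
  gcongr
  set m := ∫ s, s ∂q with hm
  have hm0 : 0 ≤ m := integral_nonneg_of_ae (by filter_upwards [h.pos] with s hs using hs.le)
  have key : ∫ s, 2 / π ^ 2 * τ ^ 2 * (s - |τ| / π * s ^ 2) ∂q
      ≤ ∫ s, (1 - cos (τ * s)) / s ∂q := by
    refine integral_mono_ae ((hq1.sub (hq2.const_mul _)).const_mul _) (h.integrable_one_sub_cos τ) ?_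
    filter_upwards [h.pos] with s hs
    rcases le_or_gt |τ * s| π with h1 | h1
    · have := cos_le_one_sub_mul_cos_sq h1
      rw [le_div_iff₀ hs]
      have h2 : 0 ≤ 2 / π ^ 2 * τ ^ 2 * (|τ| / π * s ^ 2) * s := by positivity
      nlinarith
    · have h3 : 0 ≤ (1 - cos (τ * s)) / s := div_nonneg (by linarith [cos_le_one (τ * s)]) hs.le
      refine le_trans (mul_nonpos_of_nonneg_of_nonpos (by positivity) ?_) h3
      rw [abs_mul, abs_of_pos hs] at h1
      have : s * 1 ≤ s * (|τ| * s / π) := by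
        gcongr
        rw [le_div_iff₀ pi_pos]; linarith
      have e : |τ| / π * s ^ 2 = s * (|τ| * s / π) := by ring
      linarith
  rw [integral_const_mul, integral_sub hq1 (hq2.const_mul _), integral_const_mul, ← hm] at key
  have h5 : |τ| / π * ∫ s, s ^ 2 ∂q ≤ 1 / 2 * m := by
    calc |τ| / π * ∫ s, s ^ 2 ∂q ≤ (π / (4 * M)) / π * (2 * M * m) := by
          gcongr
      _ = 1 / 2 * m := by field_simp; norm_num
  have h6 : τ ^ 2 * m / π ^ 2 ≤ 2 / π ^ 2 * τ ^ 2 * (m - |τ| / π * ∫ s, s ^ 2 ∂q) := by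
    calc τ ^ 2 * m / π ^ 2 = 2 / π ^ 2 * τ ^ 2 * (m - 1 / 2 * m) := by ring
      _ ≤ _ := by gcongr
  have h7 := mul_le_mul_of_nonneg_left (h6.trans key) h.L_pos.le
  calc _ = L * (τ ^ 2 * m / π ^ 2) := by ring
    _ ≤ _ := h7

/-- Gaussian approximation of the characteristic function near the origin. -/
theorem SizeBiased.norm_charFun_sub_gaussian_le (h : SizeBiased μ q L)
    (hq2 : Integrable (fun s : ℝ => s ^ 2) q) (hq1 : Integrable (fun s : ℝ => s) q) {τ : ℝ}
    (hτ : 4 * (L * ∫ s, s ^ 2 ∂q) * |τ| ^ 3 ≤ 1) :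
    ‖charFun μ τ * Complex.exp (-(L * τ * Complex.I))
        - μ.real univ * exp (-(L * (∫ s, s ∂q) * τ ^ 2 / 2))‖
      ≤ μ.real univ * (8 * (L * ∫ s, s ^ 2 ∂q) * |τ| ^ 3) := by
  set m := ∫ s, s ∂q with hm
  have hL0 := h.L_pos
  have hm0 : 0 ≤ m := integral_nonneg_of_ae (by filter_upwards [h.pos] with s hs using hs.le)
  have hi2 : Integrable (fun s : ℝ => ((τ : ℂ) ^ 2 / 2) * (s : ℂ)) q := (hq1.ofReal).const_mul _
  have e1 : charExponent q τ - τ * Complex.I + τ ^ 2 / 2 * m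
      = ∫ s : ℝ, ((Complex.exp (τ * s * Complex.I) - 1) / s - τ * Complex.I
        + τ ^ 2 / 2 * (s : ℂ)) ∂q := by
    have hi1 : Integrable (fun s : ℝ => (Complex.exp (τ * s * Complex.I) - 1) / s
        - τ * Complex.I) q := (h.integrable_charExponent τ).sub (integrable_const _)
    rw [integral_add hi1 hi2,
      integral_sub (h.integrable_charExponent τ) (integrable_const _), integral_const_mul ((τ : ℂ) ^ 2 / 2),
      integral_complex_ofReal]
    simp [charExponent, hm]
  have e2 : ‖charExponent q τ - τ * Complex.I + τ ^ 2 / 2 * m‖ ≤ 4 * |τ| ^ 3 * ∫ s, s ^ 2 ∂q := by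
    rw [e1, ← integral_const_mul]
    refine norm_integral_le_of_norm_le (hq2.const_mul _) ?_
    filter_upwards [h.pos] with s hs
    have h1 := norm_exp_ofReal_mul_I_taylor_le (τ * s)
    have hs' : (s : ℂ) ≠ 0 := by exact_mod_cast hs.ne'
    have : (Complex.exp (τ * s * Complex.I) - 1) / s - τ * Complex.I + τ ^ 2 / 2 * (s : ℂ)
        = (Complex.exp ((τ * s : ℝ) * Complex.I) - 1 - (τ * s : ℝ) * Complex.I
          + (τ * s : ℝ) ^ 2 / 2) / s := by
      push_cast; field_simp
    rw [this, norm_div, Complex.norm_real, norm_of_nonneg hs.le, div_le_iff₀ hs]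
    refine h1.trans (le_of_eq ?_)
    rw [abs_mul, abs_of_pos hs]; ring
  set z : ℂ := L * (charExponent q τ - τ * Complex.I + τ ^ 2 / 2 * m) with hz
  have hzn : ‖z‖ ≤ 4 * (L * ∫ s, s ^ 2 ∂q) * |τ| ^ 3 := by
    rw [hz, norm_mul, Complex.norm_real, norm_of_nonneg hL0.le]
    calc _ ≤ L * (4 * |τ| ^ 3 * ∫ s, s ^ 2 ∂q) := by gcongr
      _ = _ := by ring
  have h8 := Complex.norm_exp_sub_one_le (hzn.trans hτ)
  have e3 : charFun μ τ * Complex.exp (-(L * τ * Complex.I))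
        - μ.real univ * exp (-(L * m * τ ^ 2 / 2))
      = μ.real univ * ((exp (-(L * m * τ ^ 2 / 2)) : ℝ) * (Complex.exp z - 1)) := by
    have e4 : Complex.exp (L * charExponent q τ) * Complex.exp (-(L * τ * Complex.I))
        = Complex.exp (-(L * m * τ ^ 2 / 2)) * Complex.exp z := by
      rw [← Complex.exp_add, ← Complex.exp_add]
      congr 1
      rw [hz]; ring
    rw [h.charFun_eq]
    push_cast
    linear_combination (μ.real univ : ℂ) * e4
  rw [e3, norm_mul, norm_mul, Complex.norm_real, Complex.norm_real,
    norm_of_nonneg measureReal_nonneg, norm_of_nonneg (exp_pos _).le]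
  refine mul_le_mul_of_nonneg_left ?_ measureReal_nonneg
  have : exp (-(L * m * τ ^ 2 / 2)) ≤ 1 := exp_le_one_iff.2 (by
    have : 0 ≤ L * m * τ ^ 2 / 2 := by positivity
    linarith)
  calc _ ≤ 1 * ‖Complex.exp z - 1‖ := by gcongr
    _ ≤ _ := by linarith

end

theorem re_charFun_mul_exp (ρ : Measure ℝ) [IsFiniteMeasure ρ] (τ t : ℝ) :
    (charFun ρ τ * Complex.exp (-(τ * t * Complex.I))).re = ∫ s, cos (τ * (t - s)) ∂ρ := by
  have hi : Integrable (fun s : ℝ => Complex.exp (τ * s * Complex.I)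
      * Complex.exp (-(τ * t * Complex.I))) ρ :=
    (Integrable.of_bound (C := 1) (by fun_prop) (Filter.Eventually.of_forall fun s => by
        rw [norm_exp_mul_mul_I])).mul_const _
  rw [charFun_apply_real, ← integral_mul_const]
  have h := integral_re hi
  simp only [RCLike.re_eq_complex_re] at h
  rw [← h]
  congr 1; ext s
  rw [← Complex.exp_add]
  have : (τ * s * Complex.I + -(τ * t * Complex.I) : ℂ) = (τ * (s - t) : ℝ) * Complex.I := by
    push_cast; ring
  rw [this, Complex.exp_ofReal_mul_I_re, ← cos_neg]
  congr 1; ring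

theorem integral_fejer_eq (ρ : Measure ℝ) [IsFiniteMeasure ρ] (b t : ℝ) :
    ∫ s, fejer (b * (t - s)) ∂ρ = ∫ v in (-1 : ℝ)..1, (1 - |v|) *
      (charFun ρ (b * v) * Complex.exp (-((b * v : ℝ) * t * Complex.I))).re := by
  simp only [re_charFun_mul_exp, fejer]
  simp only [intervalIntegral.integral_of_le (show (-1 : ℝ) ≤ 1 by norm_num)]
  rw [integral_integral_swap]
  · congr 1; ext v
    rw [integral_const_mul]
    congr 2; ext s
    congr 1; ring
  · refine Integrable.of_bound (C := 2) (Measurable.aestronglyMeasurable ?_) ?_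
    · simp only [Function.uncurry_def]; fun_prop
    · have h : ∀ᵐ p ∂(ρ.prod (volume.restrict (Ioc (-1 : ℝ) 1))), p.2 ∈ Ioc (-1 : ℝ) 1 :=
        Measure.quasiMeasurePreserving_snd.ae (ae_restrict_mem measurableSet_Ioc)
      filter_upwards [h] with p hp
      have h1 : |p.2| ≤ 1 := abs_le.2 ⟨hp.1.le, hp.2⟩
      simp only [Function.uncurry_def, norm_mul, norm_eq_abs]
      have h2 : abs (1 - abs p.2) ≤ 2 := by
        rw [abs_of_nonneg (by linarith)]; linarith [abs_nonneg p.2]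
      calc _ ≤ 2 * 1 := mul_le_mul h2 (abs_cos_le_one _) (abs_nonneg _) (by norm_num)
        _ = 2 := by norm_num

theorem integral_cos_charFun (q : Measure ℝ) [IsFiniteMeasure q] (τ : ℝ) :
    ∫ t, ∫ s, cos (τ * (t - s)) ∂q ∂q = ‖charFun q τ‖ ^ 2 := by
  simp only [← re_charFun_mul_exp]
  have hi : Integrable (fun t : ℝ => charFun q τ * Complex.exp (-(τ * t * Complex.I))) q :=
    (Integrable.of_bound (C := 1) (by fun_prop) (Filter.Eventually.of_forall fun s => by
        have := norm_exp_mul_mul_I (-τ) s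
        push_cast at this
        rw [← this]; apply le_of_eq; congr 2; ring)).const_mul _
  have h := integral_re hi
  simp only [RCLike.re_eq_complex_re] at h
  rw [h, integral_const_mul]
  have : ∫ t : ℝ, Complex.exp (-(τ * t * Complex.I)) ∂q = (starRingEnd ℂ) (charFun q τ) := by
    rw [charFun_apply_real, ← integral_conj]
    congr 1; ext t
    rw [← Complex.exp_conj]
    simp
  rw [this, Complex.mul_conj, Complex.normSq_eq_norm_sq]
  norm_cast

theorem continuous_charFun' (ρ : Measure ℝ) [IsFiniteMeasure ρ] : Continuous (charFun ρ) := by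
  fun_prop

theorem integral_tent_norm_sq_charFun {α ε : ℝ} (hα : 0 < α) (hε : 0 < ε) (q : Measure ℝ)
    [IsProbabilityMeasure q] {S : ℝ} (hS : ∀ t, smoothed α q t ≤ S) :
    ∫ v in (-1 : ℝ)..1, (1 - |v|) * ‖charFun q (ε * α * v)‖ ^ 2
      ≤ (exp 2 + 2 * ∑' j : ℕ, (4 * exp 1 / ε ^ 2) / ((j + 1 : ℕ) : ℝ) ^ 2) * S := by
  have h1 : ∀ t, ∫ s, fejer (ε * α * (t - s)) ∂q
      ≤ (exp 2 + 2 * ∑' j : ℕ, (4 * exp 1 / ε ^ 2) / ((j + 1 : ℕ) : ℝ) ^ 2) * S := fun t => by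
    refine (fejer_le_smoothed hα hε q hS le_rfl t).trans ?_
    have := mul_le_mul_of_nonneg_left (hS (t + (1 : ℕ) / α)) (exp_pos 2).le
    simp only [Nat.cast_one, mul_one] at this ⊢
    linarith
  have h2 : ∫ v in (-1 : ℝ)..1, (1 - |v|) * ‖charFun q (ε * α * v)‖ ^ 2
      = ∫ t, ∫ s, fejer (ε * α * (t - s)) ∂q ∂q := by
    simp only [integral_fejer_eq, re_charFun_mul_exp, ← integral_cos_charFun]
    simp only [intervalIntegral.integral_of_le (show (-1 : ℝ) ≤ 1 by norm_num)]
    rw [integral_integral_swap]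
    · simp only [integral_const_mul]
    · refine Integrable.of_bound (C := 2) (Measurable.aestronglyMeasurable ?_) ?_
      · simp only [Function.uncurry_def]
        refine Measurable.mul (by fun_prop) ?_
        simp only [← re_charFun_mul_exp]
        have := continuous_charFun' q
        fun_prop
      · have h : ∀ᵐ p ∂(q.prod (volume.restrict (Ioc (-1 : ℝ) 1))), p.2 ∈ Ioc (-1 : ℝ) 1 :=
          Measure.quasiMeasurePreserving_snd.ae (ae_restrict_mem measurableSet_Ioc)
        filter_upwards [h] with p hp
        have h1 : |p.2| ≤ 1 := abs_le.2 ⟨hp.1.le, hp.2⟩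
        simp only [Function.uncurry_def, norm_mul, norm_eq_abs]
        have h2 : abs (1 - abs p.2) ≤ 2 := by
          rw [abs_of_nonneg (by linarith)]; linarith [abs_nonneg p.2]
        have h3 : |∫ s, cos (ε * α * p.2 * (p.1 - s)) ∂q| ≤ 1 := by
          have := norm_integral_le_of_norm_le_const (μ := q)
            (f := fun s => cos (ε * α * p.2 * (p.1 - s))) (C := 1)
            (Filter.Eventually.of_forall fun s => abs_cos_le_one _)
          simpa using this
        calc _ ≤ 2 * 1 := mul_le_mul h2 h3 (abs_nonneg _) (by norm_num)
          _ = 2 := by norm_num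
  rw [h2]
  calc _ ≤ ∫ t, (exp 2 + 2 * ∑' j : ℕ, (4 * exp 1 / ε ^ 2) / ((j + 1 : ℕ) : ℝ) ^ 2) * S ∂q := by
        refine integral_mono_of_nonneg (Filter.Eventually.of_forall fun t =>
          integral_nonneg fun s => fejer_nonneg _) (integrable_const _)
          (Filter.Eventually.of_forall h1)
    _ = _ := by simp

theorem integral_gaussian_Icc_le {b : ℝ} (hb : 0 < b) :
    ∫ v in (-1 : ℝ)..1, exp (-b * v ^ 2) ≤ √(π / b) := by
  rw [intervalIntegral.integral_of_le (by norm_num), ← integral_gaussian]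
  exact setIntegral_le_integral (integrable_exp_neg_mul_sq hb)
    (Filter.Eventually.of_forall fun _ => (exp_pos _).le)

/-- The variance scale turns Gaussian integrals into multiples of `1 / (b √V)`. -/
theorem integral_gaussian_scaled_le {b V c : ℝ} (hb : 0 < b) (hV : 0 < V) (hc : 0 < c) :
    ∫ v in (-1 : ℝ)..1, exp (-((b * v) ^ 2 * V / c)) ≤ √(π * c) / (b * √V) := by
  have h := integral_gaussian_Icc_le (b := b ^ 2 * V / c) (by positivity)
  have e : √(π / (b ^ 2 * V / c)) = √(π * c) / (b * √V) := by
    rw [show π / (b ^ 2 * V / c) = (π * c) / (b ^ 2 * V) by field_simp,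
      sqrt_div (by positivity), sqrt_mul (by positivity : (0:ℝ) ≤ b ^ 2), sqrt_sq hb.le]
  rw [e] at h
  refine le_trans (le_of_eq ?_) h
  congr 1; ext v; congr 1; ring

theorem norm_mul_sq_mul_exp_sub_one_le (q : Measure ℝ) [IsProbabilityMeasure q]
    (hq : ∀ᵐ s ∂q, 0 < s) (hq1 : Integrable (fun s : ℝ => s) q) (θ a : ℝ) :
    ‖charFun q θ * charFun q θ * Complex.exp (θ * a * Complex.I) - 1‖
      ≤ |θ| * (2 * (∫ s, s ∂q) + |a|) := by
  have h1 : ‖charFun q θ - 1‖ ≤ |θ| * ∫ s, s ∂q := by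
    have hi : Integrable (fun s : ℝ => Complex.exp (θ * s * Complex.I)) q :=
      Integrable.of_bound (C := 1) (by fun_prop) (Filter.Eventually.of_forall fun s => by
        rw [norm_exp_mul_mul_I])
    have : charFun q θ - 1 = ∫ s : ℝ, (Complex.exp (θ * s * Complex.I) - 1) ∂q := by
      rw [integral_sub hi (integrable_const _), charFun_apply_real]; simp
    rw [this, ← integral_const_mul]
    refine norm_integral_le_of_norm_le (hq1.const_mul _) ?_
    filter_upwards [hq] with s hs
    have := norm_exp_ofReal_mul_I_sub_one_le (θ * s)
    rw [abs_mul, abs_of_pos hs] at this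
    simpa using this
  have h2 : ‖Complex.exp (θ * a * Complex.I) - 1‖ ≤ |θ| * |a| := by
    have := norm_exp_ofReal_mul_I_sub_one_le (θ * a)
    rw [abs_mul] at this
    simpa using this
  have h3 : ‖charFun q θ‖ ≤ 1 := norm_charFun_le_one θ
  have e : charFun q θ * charFun q θ * Complex.exp (θ * a * Complex.I) - 1
      = (charFun q θ - 1) * (charFun q θ * Complex.exp (θ * a * Complex.I))
        + (charFun q θ - 1) * Complex.exp (θ * a * Complex.I)
        + (Complex.exp (θ * a * Complex.I) - 1) := by ring
  rw [e]
  refine (norm_add_le _ _).trans ?_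
  have h4 := norm_exp_mul_mul_I θ a
  have h5 : ‖(charFun q θ - 1) * (charFun q θ * Complex.exp (θ * a * Complex.I))‖
      ≤ |θ| * ∫ s, s ∂q := by
    rw [norm_mul, norm_mul, h4, mul_one]
    calc _ ≤ ‖charFun q θ - 1‖ * 1 := by gcongr
      _ ≤ _ := by linarith
  have h6 : ‖(charFun q θ - 1) * Complex.exp (θ * a * Complex.I)‖ ≤ |θ| * ∫ s, s ∂q := by
    rw [norm_mul, h4, mul_one]; exact h1
  linarith [norm_add_le ((charFun q θ - 1) * (charFun q θ * Complex.exp (θ * a * Complex.I)))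
    ((charFun q θ - 1) * Complex.exp (θ * a * Complex.I))]


section
variable {μ q : Measure ℝ} {L : ℝ} [IsFiniteMeasure μ] [IsProbabilityMeasure q]

theorem charFun_conv_conv (μ q : Measure ℝ) [IsFiniteMeasure μ] [IsProbabilityMeasure q] (τ : ℝ) :
    charFun ((μ ∗ q) ∗ q) τ = charFun μ τ * (charFun q τ * charFun q τ) := by
  rw [charFun_conv, charFun_conv]; ring

theorem SizeBiased.norm_charFun_le_add (h : SizeBiased μ q L)
    (hq2 : Integrable (fun s : ℝ => s ^ 2) q) (hq1 : Integrable (fun s : ℝ => s) q) {M b E : ℝ}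
    (hM0 : 0 < M) (hM : ∫ s, s ^ 2 ∂q ≤ 2 * M * ∫ s, s ∂q) (hE0 : 0 ≤ E)
    (hE : ∀ τ : ℝ, |τ| ≤ b → π / (4 * M) ≤ |τ| → ‖charFun μ τ‖ ≤ μ.real univ * E) {τ : ℝ}
    (hτ : |τ| ≤ b) :
    ‖charFun μ τ‖ ≤ μ.real univ * (exp (-(τ ^ 2 * (L * ∫ s, s ∂q) / π ^ 2)) + E) := by
  rcases le_total |τ| (π / (4 * M)) with h1 | h1
  · refine (h.norm_charFun_le_gaussian hq2 hq1 hM0 hM h1).trans ?_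
    gcongr; linarith
  · refine (hE τ hτ h1).trans ?_
    gcongr; linarith [exp_pos (-(τ ^ 2 * (L * ∫ s, s ∂q) / π ^ 2))]

theorem SizeBiased.integral_fejer_le (h : SizeBiased μ q L)
    (hq2 : Integrable (fun s : ℝ => s ^ 2) q) (hq1 : Integrable (fun s : ℝ => s) q) {M b E : ℝ}
    (hM0 : 0 < M) (hM : ∫ s, s ^ 2 ∂q ≤ 2 * M * ∫ s, s ∂q) (hE0 : 0 ≤ E) (hb : 0 < b)
    (hV : 0 < L * ∫ s, s ∂q)
    (hE : ∀ τ : ℝ, |τ| ≤ b → π / (4 * M) ≤ |τ| → ‖charFun μ τ‖ ≤ μ.real univ * E) (t : ℝ) :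
    ∫ s, fejer (b * (t - s)) ∂((μ ∗ q) ∗ q) ≤ μ.real univ * (6 / (b * √(L * ∫ s, s ∂q))
      + E * ∫ v in (-1 : ℝ)..1, (1 - |v|) * ‖charFun q (b * v)‖ ^ 2) := by
  set V := L * ∫ s, s ∂q with hVd
  set Z := μ.real univ with hZ
  have hZ0 : 0 ≤ Z := measureReal_nonneg
  rw [integral_fejer_eq]
  have hcq := continuous_charFun' q
  have hcr := continuous_charFun' ((μ ∗ q) ∗ q)
  have h1 : ∫ v in (-1 : ℝ)..1, (1 - |v|) *
      (charFun ((μ ∗ q) ∗ q) (b * v) * Complex.exp (-((b * v : ℝ) * t * Complex.I))).re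
      ≤ ∫ v in (-1 : ℝ)..1, Z * (exp (-((b * v) ^ 2 * V / π ^ 2))
        + E * ((1 - |v|) * ‖charFun q (b * v)‖ ^ 2)) := by
    refine intervalIntegral.integral_mono_on (by norm_num)
      (Continuous.intervalIntegrable (by fun_prop) _ _)
      (Continuous.intervalIntegrable (by fun_prop) _ _) fun v hv => ?_
    have hv1 : |v| ≤ 1 := abs_le.2 hv
    have hv0 := abs_nonneg v
    have hbv : |b * v| ≤ b := by
      rw [abs_mul, abs_of_pos hb]; nlinarith
    have h2 : (charFun ((μ ∗ q) ∗ q) (b * v)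
        * Complex.exp (-((b * v : ℝ) * t * Complex.I))).re
        ≤ ‖charFun μ (b * v)‖ * ‖charFun q (b * v)‖ ^ 2 := by
      refine (Complex.re_le_norm _).trans (le_of_eq ?_)
      rw [charFun_conv_conv, norm_mul, norm_mul, norm_mul]
      have := norm_exp_mul_mul_I (-(b * v)) t
      push_cast at this ⊢
      rw [show -((b : ℂ) * v * t * Complex.I) = -(b * v) * t * Complex.I by ring, this]
      ring
    have h3 := h.norm_charFun_le_add hq2 hq1 hM0 hM hE0 hE hbv
    rw [← hVd, ← hZ] at h3
    have hq' : ‖charFun q (b * v)‖ ≤ 1 := norm_charFun_le_one _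
    have hq0 := norm_nonneg (charFun q (b * v))
    set Q := ‖charFun q (b * v)‖ ^ 2 with hQ
    have hQ0 : 0 ≤ Q := by positivity
    have hQ1 : Q ≤ 1 := by nlinarith
    set e := exp (-((b * v) ^ 2 * V / π ^ 2)) with he
    have he0 : 0 < e := exp_pos _
    have h4 : ‖charFun μ (b * v)‖ * Q ≤ Z * (e + E) * Q := by gcongr
    have h5 : (1 - |v|) * Q ≤ 1 := by nlinarith
    calc _ ≤ (1 - |v|) * (Z * (e + E) * Q) := by
          apply mul_le_mul_of_nonneg_left (h2.trans h4); linarith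
      _ = Z * (e * ((1 - |v|) * Q) + E * ((1 - |v|) * Q)) := by ring
      _ ≤ Z * (e * 1 + E * ((1 - |v|) * Q)) := by gcongr
      _ = _ := by ring
  refine h1.trans ?_
  rw [intervalIntegral.integral_const_mul, intervalIntegral.integral_add
    (Continuous.intervalIntegrable (by fun_prop) _ _)
    (Continuous.intervalIntegrable (by fun_prop) _ _), intervalIntegral.integral_const_mul]
  gcongr
  refine (integral_gaussian_scaled_le hb hV (by positivity)).trans ?_
  gcongr
  rw [sqrt_le_left (by norm_num)]
  have := pi_lt_d2
  have := pi_pos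
  nlinarith [mul_pos pi_pos pi_pos]

set_option maxHeartbeats 800000 in
/-- Pointwise lower bound for the real part of the transform of `(μ ∗ q) ∗ q` recentred at
`L - a`, combining the Gaussian range with the tail bound. -/
theorem SizeBiased.le_re_charFun (h : SizeBiased μ q L)
    (hq2 : Integrable (fun s : ℝ => s ^ 2) q) (hq1 : Integrable (fun s : ℝ => s) q)
    {M b E N δ : ℝ}
    (hM0 : 0 < M) (hM : ∫ s, s ^ 2 ∂q ≤ 2 * M * ∫ s, s ∂q) (hE0 : 0 ≤ E)
    (hV : 0 < L * ∫ s, s ∂q) (hmM : ∫ s, s ∂q ≤ M) (hMδ : M ≤ δ * √(L * ∫ s, s ∂q))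
    (hN : 0 ≤ N) (hδ1 : 8 * 12 ^ 3 * δ ≤ 1)
    (hδ2 : (16 * 12 ^ 3 + 12 * (2 + N)) * δ ≤ exp (-8) / 64)
    (hE : ∀ τ : ℝ, |τ| ≤ b → π / (4 * M) ≤ |τ| → ‖charFun μ τ‖ ≤ μ.real univ * E) {a : ℝ}
    (ha0 : 0 ≤ a) (ha : a ≤ N * M) {τ : ℝ} (hτ : |τ| ≤ b) :
    μ.real univ * (exp (-(τ ^ 2 * (L * ∫ s, s ∂q) / 2))
      - exp (-(τ ^ 2 * (L * ∫ s, s ∂q) / (2 * π ^ 2))) / 64 - E * ‖charFun q τ‖ ^ 2)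
    ≤ (charFun ((μ ∗ q) ∗ q) τ * Complex.exp (-(τ * (L - a : ℝ) * Complex.I))).re := by
  set m := ∫ s, s ∂q with hm
  set V := L * m with hVd
  set Z := μ.real univ with hZ
  have hZ0 : 0 ≤ Z := measureReal_nonneg
  have hm0 : 0 ≤ m := integral_nonneg_of_ae (by filter_upwards [h.pos] with s hs using hs.le)
  have hsV : 0 < √V := sqrt_pos.2 hV
  have hsq : √V ^ 2 = V := sq_sqrt hV.le
  set x := |τ| * √V with hx
  have hx0 : 0 ≤ x := by positivity
  have hx2 : τ ^ 2 * V = x ^ 2 := by rw [hx, mul_pow, sq_abs, hsq]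
  have hδ0 : 0 < δ := by
    by_contra hcon
    nlinarith
  rw [hx2]
  have hpi := pi_lt_d2
  have hpi0 := pi_pos
  have hpi3 := pi_gt_three
  have hpp : π ^ 2 ≤ 10 := by nlinarith
  rcases le_total x 12 with hx12 | hx12
  · have hτV : |τ| = x / √V := by rw [hx]; field_simp
    have hLq : L * ∫ s, s ^ 2 ∂q ≤ 2 * M * V := by
      have := mul_le_mul_of_nonneg_left hM h.L_pos.le
      rw [hVd]; linarith
    have hLq0 : 0 ≤ L * ∫ s, s ^ 2 ∂q :=
      mul_nonneg h.L_pos.le (integral_nonneg fun s => by positivity)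
    have hc : (L * ∫ s, s ^ 2 ∂q) * |τ| ^ 3 ≤ 2 * 12 ^ 3 * δ := by
      calc _ ≤ 2 * M * V * |τ| ^ 3 := by gcongr
        _ ≤ 2 * (δ * √V) * V * |τ| ^ 3 := by gcongr
        _ = 2 * δ * x ^ 3 := by
          rw [hx]
          calc _ = 2 * δ * (√V * V * |τ| ^ 3) := by ring
            _ = 2 * δ * (√V * √V ^ 2 * |τ| ^ 3) := by rw [hsq]
            _ = _ := by ring
        _ ≤ 2 * δ * 12 ^ 3 := by gcongr
        _ = _ := by ring
    have hA := h.norm_charFun_sub_gaussian_le hq2 hq1 (τ := τ) (by linarith)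
    have hB := norm_mul_sq_mul_exp_sub_one_le q h.pos hq1 τ a
    rw [← hm, ← hZ] at hA
    rw [← hm, abs_of_nonneg ha0] at hB
    set G : ℝ := exp (-(L * m * τ ^ 2 / 2)) with hG
    have hG1 : G ≤ 1 := exp_le_one_iff.2 (by
      have : 0 ≤ L * m * τ ^ 2 / 2 := by rw [← hVd]; positivity
      linarith)
    have hGx : G = exp (-(x ^ 2 / 2)) := by rw [hG, ← hx2, hVd]; ring_nf
    set A := charFun μ τ * Complex.exp (-(L * τ * Complex.I)) with hAd
    set B := charFun q τ * charFun q τ * Complex.exp (τ * a * Complex.I) with hBd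
    have e : charFun ((μ ∗ q) ∗ q) τ * Complex.exp (-(τ * (L - a : ℝ) * Complex.I)) = A * B := by
      rw [charFun_conv_conv, hAd, hBd]
      have : Complex.exp (-(τ * (L - a : ℝ) * Complex.I))
          = Complex.exp (-(L * τ * Complex.I)) * Complex.exp (τ * a * Complex.I) := by
        rw [← Complex.exp_add]; congr 1; push_cast; ring
      rw [this]; ring
    have hBn : ‖B‖ ≤ 1 := by
      rw [hBd, norm_mul, norm_mul, norm_exp_mul_mul_I, mul_one]
      have : ‖charFun q τ‖ ≤ 1 := norm_charFun_le_one τ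
      nlinarith [norm_nonneg (charFun q τ)]
    have e2 : A * B = ((Z * G : ℝ) : ℂ) + ((A - (Z * G : ℝ)) * B + (Z * G : ℝ) * (B - 1)) := by
      ring
    have hA' : ‖A - (Z * G : ℝ)‖ ≤ Z * (16 * 12 ^ 3 * δ) := by
      have e3 : A - (Z * G : ℝ) = charFun μ τ * Complex.exp (-(L * τ * Complex.I))
          - Z * Complex.ofReal G := by rw [hAd]; push_cast; ring
      rw [e3]
      have : Z * (8 * (L * ∫ s, s ^ 2 ∂q) * |τ| ^ 3) ≤ Z * (16 * 12 ^ 3 * δ) := by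
        apply mul_le_mul_of_nonneg_left _ hZ0
        linarith
      exact hA.trans this
    have hB' : ‖B - 1‖ ≤ 12 * (2 + N) * δ := by
      refine hB.trans ?_
      calc |τ| * (2 * m + a) ≤ |τ| * (2 * M + N * M) := by gcongr
        _ = |τ| * M * (2 + N) := by ring
        _ ≤ |τ| * (δ * √V) * (2 + N) := by gcongr
        _ = x * δ * (2 + N) := by rw [hx]; ring
        _ ≤ 12 * δ * (2 + N) := by gcongr
        _ = _ := by ring
    clear_value A B
    have hrem : ‖(A - (Z * G : ℝ)) * B + (Z * G : ℝ) * (B - 1)‖ ≤ Z * (exp (-8) / 64) := by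
      refine (norm_add_le _ _).trans ?_
      rw [norm_mul, norm_mul, Complex.norm_real, norm_of_nonneg (by positivity)]
      calc _ ≤ Z * (16 * 12 ^ 3 * δ) * 1 + Z * 1 * (12 * (2 + N) * δ) := by gcongr
        _ = Z * ((16 * 12 ^ 3 + 12 * (2 + N)) * δ) := by ring
        _ ≤ _ := by gcongr
    have hre := (Complex.abs_re_le_norm
      ((A - (Z * G : ℝ)) * B + (Z * G : ℝ) * (B - 1))).trans hrem
    rw [e, e2, Complex.add_re, Complex.ofReal_re]
    have h1 := neg_le_of_abs_le hre
    have h8 : exp (-8) ≤ exp (-(x ^ 2 / (2 * π ^ 2))) := by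
      apply exp_le_exp.2
      rw [neg_le_neg_iff, div_le_iff₀ (by positivity)]
      have h3 : x ^ 2 ≤ 12 ^ 2 := by gcongr
      have h4 : 3 ^ 2 ≤ π ^ 2 := by gcongr
      linarith
    have h9 : Z * (exp (-8) / 64) ≤ Z * (exp (-(x ^ 2 / (2 * π ^ 2))) / 64) := by gcongr
    have h10 : 0 ≤ Z * (E * ‖charFun q τ‖ ^ 2) := by positivity
    rw [← hGx]
    linarith
  · have hn := h.norm_charFun_le_add hq2 hq1 hM0 hM hE0 hE hτ
    rw [← hm, ← hVd, ← hZ, hx2] at hn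
    have h2 : ‖charFun ((μ ∗ q) ∗ q) τ * Complex.exp (-(τ * (L - a : ℝ) * Complex.I))‖
        = ‖charFun μ τ‖ * ‖charFun q τ‖ ^ 2 := by
      rw [charFun_conv_conv, norm_mul, norm_mul, norm_mul]
      have := norm_exp_mul_mul_I (-τ) (L - a : ℝ)
      rw [show (-(τ * (L - a : ℝ) * Complex.I) : ℂ) = ((-τ : ℝ) : ℂ) * (L - a : ℝ) * Complex.I by
        push_cast; ring, this]
      ring
    have h3 := neg_le_of_abs_le ((Complex.abs_re_le_norm
      (charFun ((μ ∗ q) ∗ q) τ * Complex.exp (-(τ * (L - a : ℝ) * Complex.I)))).trans h2.le)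
    refine le_trans ?_ h3
    set e := exp (-(x ^ 2 / (2 * π ^ 2))) with he
    have hee : exp (-(x ^ 2 / π ^ 2)) = e * e := by
      rw [he, ← exp_add]; congr 1; field_simp; ring
    have h4 : e ≤ 1 / 128 := by
      have : e ≤ exp (-(7 : ℝ)) := by
        apply exp_le_exp.2
        rw [neg_le_neg_iff, le_div_iff₀ (by positivity)]
        have : 12 ^ 2 ≤ x ^ 2 := by gcongr
        linarith
      refine this.trans ?_
      rw [exp_neg, inv_le_comm₀ (exp_pos _) (by norm_num)]
      have h5 : exp 1 ^ 7 = exp 7 := by rw [← exp_nat_mul]; norm_num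
      have h6 := exp_one_gt_d9
      rw [← h5]
      calc (1 / 128 : ℝ)⁻¹ ≤ 2.1 ^ 7 := by norm_num
        _ ≤ _ := by gcongr; linarith
    have he0 : 0 < e := exp_pos _
    have h5 : exp (-(x ^ 2 / 2)) ≤ e * e := by
      rw [← hee]
      apply exp_le_exp.2
      rw [neg_le_neg_iff]
      gcongr
      have h4 : 3 ^ 2 ≤ π ^ 2 := by gcongr
      linarith
    have hq' : ‖charFun q τ‖ ≤ 1 := norm_charFun_le_one _
    have hq0 := norm_nonneg (charFun q τ)
    set Q := ‖charFun q τ‖ ^ 2 with hQ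
    have hQ0 : 0 ≤ Q := by positivity
    have hQ1 : Q ≤ 1 := by nlinarith
    rw [hee] at hn
    have h6 : ‖charFun μ τ‖ * Q ≤ Z * (e * e + E) * Q := by gcongr
    have h7 : Z * (e * e + E) * Q ≤ Z * (e * e + E * Q) := by
      have : e * e * Q ≤ e * e * 1 := by gcongr
      calc _ = Z * (e * e * Q + E * Q) := by ring
        _ ≤ _ := mul_le_mul_of_nonneg_left (by linarith) hZ0
    have h8 : e * e ≤ e / 128 := by nlinarith
    have h9 : Z * (exp (-(x ^ 2 / 2)) - e / 64 - E * Q) ≤ -(Z * (e * e + E * Q)) := by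
      rw [← mul_neg]
      exact mul_le_mul_of_nonneg_left (by linarith) hZ0
    linarith

end

theorem le_integral_tent_gaussian {b V : ℝ} (hb : 0 < b) (hV : 0 < V) (hbV : 2 ≤ b * √V) :
    1 / (2 * (b * √V)) ≤ ∫ v in (-1 : ℝ)..1, (1 - |v|) * exp (-((b * v) ^ 2 * V / 2)) := by
  set w := 1 / (b * √V) with hw
  have hsV : 0 < √V := sqrt_pos.2 hV
  have hw0 : 0 < w := by positivity
  have hw1 : w ≤ 1 / 2 := by rw [hw]; gcongr
  have h1 : ∫ v in (-w)..w, (1 - |v|) * exp (-((b * v) ^ 2 * V / 2))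
      ≤ ∫ v in (-1 : ℝ)..1, (1 - |v|) * exp (-((b * v) ^ 2 * V / 2)) := by
    refine intervalIntegral.integral_mono_interval (by linarith) (by linarith) (by linarith) ?_
      (Continuous.intervalIntegrable (by fun_prop) _ _)
    filter_upwards [ae_restrict_mem measurableSet_Ioc] with v hv
    have hv1 : |v| ≤ 1 := abs_le.2 ⟨hv.1.le, hv.2⟩
    exact mul_nonneg (by linarith) (exp_pos _).le
  refine le_trans ?_ h1
  have h2 : ∫ v in (-w)..w, (1 / 4 : ℝ) ≤ ∫ v in (-w)..w, (1 - |v|) * exp (-((b * v) ^ 2 * V / 2)) := by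
    refine intervalIntegral.integral_mono_on (by linarith) (by simp)
      (Continuous.intervalIntegrable (by fun_prop) _ _) fun v hv => ?_
    have hv1 : |v| ≤ w := abs_le.2 hv
    have hx : (b * v) ^ 2 * V ≤ 1 := by
      have : (b * v) ^ 2 * V = (b * √V * |v|) ^ 2 := by
        rw [mul_pow, mul_pow, mul_pow, sq_abs, sq_sqrt hV.le]; ring
      rw [this]
      have h3 : b * √V * |v| ≤ 1 := by
        calc _ ≤ b * √V * w := by gcongr
          _ = 1 := by rw [hw]; field_simp
      have h4 : 0 ≤ b * √V * |v| := by positivity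
      nlinarith
    have h5 : 1 / 2 ≤ exp (-((b * v) ^ 2 * V / 2)) := by
      have := add_one_le_exp (-((b * v) ^ 2 * V / 2))
      linarith
    calc (1 / 4 : ℝ) = 1 / 2 * (1 / 2) := by norm_num
      _ ≤ _ := by
        apply mul_le_mul (by linarith) h5 (by norm_num) (by linarith)
  refine le_trans (le_of_eq ?_) h2
  rw [intervalIntegral.integral_const, hw, smul_eq_mul]
  field_simp
  norm_num

section
variable {μ q : Measure ℝ} {L : ℝ} [IsFiniteMeasure μ] [IsProbabilityMeasure q]

theorem SizeBiased.le_integral_fejer (h : SizeBiased μ q L)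
    (hq2 : Integrable (fun s : ℝ => s ^ 2) q) (hq1 : Integrable (fun s : ℝ => s) q)
    {M b E N δ : ℝ}
    (hM0 : 0 < M) (hM : ∫ s, s ^ 2 ∂q ≤ 2 * M * ∫ s, s ∂q) (hE0 : 0 ≤ E) (hb : 0 < b)
    (hV : 0 < L * ∫ s, s ∂q) (hmM : ∫ s, s ∂q ≤ M) (hMδ : M ≤ δ * √(L * ∫ s, s ∂q))
    (hbV : 2 ≤ b * √(L * ∫ s, s ∂q))
    (hN : 0 ≤ N) (hδ1 : 8 * 12 ^ 3 * δ ≤ 1)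
    (hδ2 : (16 * 12 ^ 3 + 12 * (2 + N)) * δ ≤ exp (-8) / 64)
    (hE : ∀ τ : ℝ, |τ| ≤ b → π / (4 * M) ≤ |τ| → ‖charFun μ τ‖ ≤ μ.real univ * E) {a : ℝ}
    (ha0 : 0 ≤ a) (ha : a ≤ N * M) :
    μ.real univ * (3 / (8 * (b * √(L * ∫ s, s ∂q)))
      - E * ∫ v in (-1 : ℝ)..1, (1 - |v|) * ‖charFun q (b * v)‖ ^ 2)
    ≤ ∫ s, fejer (b * (L - a - s)) ∂((μ ∗ q) ∗ q) := by
  have key := fun τ hτ => h.le_re_charFun hq2 hq1 hM0 hM hE0 hV hmM hMδ hN hδ1 hδ2 hE ha0 ha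
    (τ := τ) hτ
  set V := L * ∫ s, s ∂q with hVd
  set Z := μ.real univ with hZ
  have hZ0 : 0 ≤ Z := measureReal_nonneg
  rw [integral_fejer_eq]
  have hcq := continuous_charFun' q
  have hcr := continuous_charFun' ((μ ∗ q) ∗ q)
  have h1 : ∫ v in (-1 : ℝ)..1, Z * ((1 - |v|) * exp (-((b * v) ^ 2 * V / 2))
        - exp (-((b * v) ^ 2 * V / (2 * π ^ 2))) / 64 - E * ((1 - |v|) * ‖charFun q (b * v)‖ ^ 2))
      ≤ ∫ v in (-1 : ℝ)..1, (1 - |v|) *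
      (charFun ((μ ∗ q) ∗ q) (b * v) * Complex.exp (-((b * v : ℝ) * (L - a : ℝ) * Complex.I))).re := by
    refine intervalIntegral.integral_mono_on (by norm_num)
      (Continuous.intervalIntegrable (by fun_prop) _ _)
      (Continuous.intervalIntegrable (by fun_prop) _ _) fun v hv => ?_
    have hv1 : |v| ≤ 1 := abs_le.2 hv
    have hv0 := abs_nonneg v
    have hbv : |b * v| ≤ b := by
      rw [abs_mul, abs_of_pos hb]; nlinarith
    have h2 := mul_le_mul_of_nonneg_left (key _ hbv) (sub_nonneg.2 hv1)
    refine le_trans ?_ h2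
    clear_value V
    set e := exp (-((b * v) ^ 2 * V / (2 * π ^ 2)))
    have he0 : 0 < e := exp_pos _
    rw [mul_left_comm (1 - |v|) Z]
    refine mul_le_mul_of_nonneg_left ?_ hZ0
    nlinarith
  refine le_trans ?_ h1
  rw [intervalIntegral.integral_const_mul, intervalIntegral.integral_sub
    (Continuous.intervalIntegrable (by fun_prop) _ _)
    (Continuous.intervalIntegrable (by fun_prop) _ _), intervalIntegral.integral_sub
    (Continuous.intervalIntegrable (by fun_prop) _ _)
    (Continuous.intervalIntegrable (by fun_prop) _ _), intervalIntegral.integral_const_mul,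
    intervalIntegral.integral_div]
  refine mul_le_mul_of_nonneg_left ?_ hZ0
  have h2 := le_integral_tent_gaussian hb hV hbV
  have h3 := integral_gaussian_scaled_le (c := 2 * π ^ 2) hb hV (by positivity)
  have h4 : √(π * (2 * π ^ 2)) ≤ 8 := by
    rw [sqrt_le_left (by norm_num)]
    have h5 := pi_lt_d2
    have h6 := pi_pos
    have h7 : π ^ 3 ≤ 3.15 ^ 3 := by gcongr
    have : π * (2 * π ^ 2) = 2 * π ^ 3 := by ring
    rw [this]; norm_num at h7 ⊢; linarith
  have h5 : √(π * (2 * π ^ 2)) / (b * √V) ≤ 8 / (b * √V) := by gcongr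
  have e1 : 3 / (8 * (b * √V)) = 1 / (2 * (b * √V)) - (8 / (b * √V)) / 64 := by
    have : 0 < √V := sqrt_pos.2 hV
    field_simp; norm_num
  rw [e1]
  linarith

end

theorem exists_tail_le (c : ℝ) {η : ℝ} (hη : 0 < η) :
    ∃ N : ℕ, 1 ≤ N ∧ ∑' j : ℕ, c / ((j + N : ℕ) : ℝ) ^ 2 ≤ η := by
  have := tendsto_sum_nat_add (fun j : ℕ => c / (j : ℝ) ^ 2)
  obtain ⟨N, hN⟩ := ((this.eventually (ge_mem_nhds hη)).and (Filter.eventually_ge_atTop 1)).exists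
  exact ⟨N, hN.2, hN.1⟩

/-- Saddle-point comparison: under spectral and a priori bounds, the smoothed measure at any point
is dominated by its value at `L`. -/
theorem exists_smoothed_le_smoothed {ε : ℝ} (hε : 0 < ε) (hε1 : ε ≤ 1) :
    ∃ δ > 0, ∃ C > 0, ∀ (μ q : Measure ℝ) [IsFiniteMeasure μ] [IsProbabilityMeasure q]
      (L α M E S : ℝ), SizeBiased μ q L → 0 < α →
      Integrable (fun s : ℝ => s) q → Integrable (fun s : ℝ => s ^ 2) q →
      ∫ s, s ^ 2 ∂q ≤ 2 * M * ∫ s, s ∂q → ∫ s, s ∂q ≤ M → 1 / α ≤ M → 0 < ∫ s, s ∂q →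
      M ≤ δ * √(L * ∫ s, s ∂q) → 1 / δ ≤ α * L → 0 ≤ E →
      (∀ τ : ℝ, |τ| ≤ ε * α → π / (4 * M) ≤ |τ| → ‖charFun μ τ‖ ≤ μ.real univ * E) →
      (∀ t, smoothed α q t ≤ S) → E * S * (α * √(L * ∫ s, s ∂q)) ≤ δ →
      (∀ t ≤ L / 2, smoothed α μ t ≤ μ.real univ / (α * √(L * ∫ s, s ∂q))) →
      ∀ t, smoothed α μ t ≤ C * smoothed α μ L := by
  set c1 := ∑' i : ℕ, 3 * exp (-(i : ℝ)) with hc1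
  have hc1p : 0 < c1 := by
    refine (summable_exp_neg_nat.mul_left 3).tsum_pos (fun i => by positivity) 0 (by positivity)
  set K := exp 2 + 2 * ∑' j : ℕ, (4 * exp 1 / ε ^ 2) / ((j + 1 : ℕ) : ℝ) ^ 2 with hK
  have hK0 : 0 < K := by
    have : 0 ≤ ∑' j : ℕ, (4 * exp 1 / ε ^ 2) / ((j + 1 : ℕ) : ℝ) ^ 2 :=
      tsum_nonneg fun j => by positivity
    have := exp_pos 2
    rw [hK]; linarith
  obtain ⟨N, hN1, hN⟩ := exists_tail_le (4 * exp 1 / ε ^ 2) (η := 1 / (112 * c1)) (by positivity)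
  set c2 := ∑' i : ℕ, ((i : ℝ) + 1) * exp (-(i : ℝ)) with hc2
  have hc2p : 0 < c2 := by
    refine summable_exp_neg_nat_mul.tsum_pos (fun i => by positivity) 0 (by positivity)
  set δ := min (min (1 / (8 * 12 ^ 3)) (exp (-8) / 64 / (16 * 12 ^ 3 + 12 * (2 + N))))
    (min (1 / (8 * ε * K)) (min (ε / 2) (1 / (12 * c2)))) with hδ
  have hδ0 : 0 < δ := by
    simp only [hδ, lt_min_iff]
    refine ⟨⟨?_, ?_⟩, ?_, ?_, ?_⟩ <;> positivity
  have d1 : 8 * 12 ^ 3 * δ ≤ 1 := by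
    have : δ ≤ 1 / (8 * 12 ^ 3) := (min_le_left _ _).trans (min_le_left _ _)
    rw [le_div_iff₀ (by positivity)] at this; linarith
  have d2 : (16 * 12 ^ 3 + 12 * (2 + N)) * δ ≤ exp (-8) / 64 := by
    have : δ ≤ exp (-8) / 64 / (16 * 12 ^ 3 + 12 * (2 + N)) :=
      (min_le_left _ _).trans (min_le_right _ _)
    rw [le_div_iff₀ (by positivity)] at this; linarith
  have d3 : K * δ ≤ 1 / (8 * ε) := by
    have : δ ≤ 1 / (8 * ε * K) := (min_le_right _ _).trans (min_le_left _ _)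
    rw [le_div_iff₀ (by positivity)] at this ⊢; linarith
  have d4 : 2 ≤ ε / δ := by
    have : δ ≤ ε / 2 := (min_le_right _ _).trans ((min_le_right _ _).trans (min_le_left _ _))
    rw [le_div_iff₀ hδ0]; linarith
  have d5 : 12 * c2 ≤ 1 / δ := by
    have : δ ≤ 1 / (12 * c2) := (min_le_right _ _).trans ((min_le_right _ _).trans (min_le_right _ _))
    rw [le_div_iff₀ (by positivity)] at this ⊢; linarith
  clear_value δ
  refine ⟨δ, hδ0, (56 * c1 / ε + 6) * (8 * ε * exp (2 * N)), by positivity, ?_⟩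
  intro μ q _ _ L α M E S h hα hq1 hq2 hM hmM hαM hm0 hMδ hαL hE0 hE hS hES hlow t
  have hM0 : 0 < M := hm0.trans_le hmM
  have hV : 0 < L * ∫ s, s ∂q := mul_pos h.L_pos hm0
  set V := L * ∫ s, s ∂q with hVd
  have hsV : 0 < √V := sqrt_pos.2 hV
  set Z := μ.real univ with hZ
  have hZ0 : 0 ≤ Z := measureReal_nonneg
  set W := Z / (α * √V) with hW
  have hW0 : 0 ≤ W := by positivity
  have hb : 0 < ε * α := by positivity
  have hαV : 1 / δ ≤ α * √V := by
    have h1 : 1 / α ≤ δ * √V := hαM.trans hMδ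
    rw [div_le_iff₀ hα] at h1
    rw [div_le_iff₀ hδ0]; linarith
  have hbV : 2 ≤ ε * α * √V := by
    calc 2 ≤ ε * (1 / δ) := by rw [mul_one_div]; exact d4
      _ ≤ ε * (α * √V) := by gcongr
      _ = _ := by ring
  set J := ∫ v in (-1 : ℝ)..1, (1 - |v|) * ‖charFun q (ε * α * v)‖ ^ 2 with hJ
  have hJK : J ≤ K * S := integral_tent_norm_sq_charFun hα hε q hS
  have hEJ : E * J ≤ 1 / (8 * (ε * α * √V)) := by
    calc E * J ≤ E * (K * S) := by gcongr
      _ = K * (E * S * (α * √V)) / (α * √V) := by field_simp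
      _ ≤ K * δ / (α * √V) := by gcongr
      _ ≤ 1 / (8 * ε) / (α * √V) := by gcongr
      _ = _ := by field_simp
  have hup : ∀ t, ∫ s, fejer (ε * α * (t - s)) ∂((μ ∗ q) ∗ q) ≤ 7 / ε * W := fun t => by
    refine (h.integral_fejer_le hq2 hq1 hM0 hM hE0 hb hV hE t).trans ?_
    rw [← hVd, ← hZ, ← hJ]
    calc _ ≤ Z * (6 / (ε * α * √V) + 1 / (8 * (ε * α * √V))) := by gcongr
      _ = (6 + 1 / 8) / ε * W := by rw [hW]; field_simp
      _ ≤ _ := by gcongr; norm_num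
  have hD : ∀ t, smoothed α ((μ ∗ q) ∗ q) t ≤ c1 * (7 / ε * W) :=
    smoothed_le_of_fejer hα hε hε1 _ hup
  have hall := h.smoothed_le hα (d5.trans hαL) hW0 hlow hD t
  have hfl := h.le_integral_fejer hq2 hq1 hM0 hM hE0 hb hV hmM hMδ hbV (N := N) (by positivity)
    d1 d2 hE (a := N / α) (by positivity) (by
      rw [div_eq_mul_one_div]; gcongr)
  rw [← hVd, ← hZ, ← hJ] at hfl
  have hf2 := fejer_le_smoothed hα hε ((μ ∗ q) ∗ q) hD hN1 (L - N / α)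
  rw [sub_add_cancel] at hf2
  have h1 : W / (4 * ε) ≤ ∫ s, fejer (ε * α * (L - N / α - s)) ∂((μ ∗ q) ∗ q) := by
    refine le_trans ?_ hfl
    calc W / (4 * ε) = Z * (3 / (8 * (ε * α * √V)) - 1 / (8 * (ε * α * √V))) := by
          rw [hW]; field_simp; ring
      _ ≤ _ := by gcongr
  have h2 : (∑' j : ℕ, (4 * exp 1 / ε ^ 2) / ((j + N : ℕ) : ℝ) ^ 2) * (2 * (c1 * (7 / ε * W)))
      ≤ W / (8 * ε) := by
    calc _ ≤ 1 / (112 * c1) * (2 * (c1 * (7 / ε * W))) := by gcongr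
      _ = _ := by field_simp; ring
  have h3 := h.smoothed_conv_conv_le hα.le
  have h4 : W / (8 * ε) ≤ exp (2 * N) * smoothed α μ L := by
    have h5 : exp (2 * N) * smoothed α ((μ ∗ q) ∗ q) L ≤ exp (2 * N) * smoothed α μ L := by gcongr
    have h6 : W / (4 * ε) = W / (8 * ε) + W / (8 * ε) := by field_simp; ring
    linarith
  calc smoothed α μ t ≤ 8 * (c1 * (7 / ε * W)) + 6 * W := hall
    _ = (56 * c1 / ε + 6) * (8 * ε * (W / (8 * ε))) := by field_simp; ring
    _ ≤ (56 * c1 / ε + 6) * (8 * ε * (exp (2 * N) * smoothed α μ L)) := by gcongr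
    _ = _ := by ring


/-- Laplace transform of the restriction to nonnegative reals. -/
def laplace (μ : Measure ℝ) (κ : ℝ) : ℝ := ∫ s, exp (-(κ * max s 0)) ∂μ

theorem exp_neg_mul_max_le_one {κ : ℝ} (hκ : 0 ≤ κ) (s : ℝ) : exp (-(κ * max s 0)) ≤ 1 :=
  exp_le_one_iff.2 (neg_nonpos.2 (mul_nonneg hκ (le_max_right _ _)))

theorem integrable_exp_neg_mul_max {κ : ℝ} (hκ : 0 ≤ κ) (μ : Measure ℝ) [IsFiniteMeasure μ] :
    Integrable (fun s : ℝ => exp (-(κ * max s 0))) μ :=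
  Integrable.of_bound (C := 1) (by fun_prop) (Filter.Eventually.of_forall fun s => by
    rw [norm_eq_abs, abs_of_pos (exp_pos _)]; exact exp_neg_mul_max_le_one hκ s)

theorem laplace_nonneg (μ : Measure ℝ) (κ : ℝ) : 0 ≤ laplace μ κ :=
  integral_nonneg fun _ => (exp_pos _).le

section
variable {μ q : Measure ℝ} {L : ℝ} [IsFiniteMeasure μ] [IsProbabilityMeasure q]

theorem SizeBiased.laplace_conv (h : SizeBiased μ q L) {κ : ℝ} (hκ : 0 ≤ κ) :
    laplace (μ ∗ q) κ = laplace μ κ * laplace q κ := by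
  unfold laplace
  rw [integral_conv (integrable_exp_neg_mul_max hκ _), ← integral_mul_const]
  apply integral_congr_ae
  filter_upwards [h.nonneg] with s hs
  rw [← integral_const_mul]
  apply integral_congr_ae
  filter_upwards [h.pos] with t ht
  rw [← exp_add, max_eq_left hs, max_eq_left ht.le, max_eq_left (by linarith)]
  congr 1; ring

theorem SizeBiased.hasDerivAt_laplace (h : SizeBiased μ q L) {κ : ℝ} (hκ : 0 < κ) :
    HasDerivAt (laplace μ) (-(L * (laplace μ κ * laplace q κ))) κ := by
  have h1 : HasDerivAt (fun k : ℝ => ∫ s, exp (-(k * max s 0)) ∂μ)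
      (∫ s, -(max s 0) * exp (-(κ * max s 0)) ∂μ) κ :=
    (hasDerivAt_integral_of_dominated_loc_of_deriv_le (s := Ioi 0) (bound := fun s => |s|)
      (μ := μ) (F := fun (k : ℝ) (s : ℝ) => exp (-(k * max s 0)))
      (F' := fun (k : ℝ) (s : ℝ) => -(max s 0) * exp (-(k * max s 0))) (x₀ := κ)
      (Ioi_mem_nhds hκ) (Filter.Eventually.of_forall fun t => by fun_prop)
      (integrable_exp_neg_mul_max hκ.le μ) (by fun_prop)
      (Filter.Eventually.of_forall fun s k hk => by
        rw [norm_mul, norm_neg, norm_eq_abs, norm_eq_abs, abs_of_pos (exp_pos _)]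
        have h2 := exp_neg_mul_max_le_one (le_of_lt hk) s
        have h3 : |max s 0| ≤ |s| := by
          rw [abs_of_nonneg (le_max_right _ _)]
          exact max_le (le_abs_self s) (abs_nonneg s)
        calc _ ≤ |s| * 1 := by gcongr
          _ = _ := mul_one _) h.integrable_id.abs
      (Filter.Eventually.of_forall fun s k _ => by
        have h2 : HasDerivAt (fun k : ℝ => -(k * max s 0)) (-(max s 0)) k := by
          exact ((hasDerivAt_id k).mul_const (max s 0)).neg.congr_deriv (by simp)
        exact h2.exp.congr_deriv (by ring))).2
  refine h1.congr_deriv ?_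
  rw [← h.laplace_conv hκ.le, laplace, ← smul_eq_mul L, ← h.integral_smul, ← integral_neg]
  apply integral_congr_ae
  filter_upwards [h.nonneg] with s hs
  rw [max_eq_left hs]; simp

theorem continuousOn_laplace (μ : Measure ℝ) [IsFiniteMeasure μ] :
    ContinuousOn (laplace μ) (Ici 0) := by
  refine continuousOn_of_dominated (bound := fun _ => 1) (fun k _ => by fun_prop)
    (fun k hk => Filter.Eventually.of_forall fun s => ?_) (integrable_const _)
    (Filter.Eventually.of_forall fun s => by fun_prop)
  rw [norm_eq_abs, abs_of_pos (exp_pos _)]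
  exact exp_neg_mul_max_le_one hk s

theorem SizeBiased.laplace_le (h : SizeBiased μ q L) (hq1 : Integrable (fun s : ℝ => s) q)
    {κ : ℝ} (hκ : 0 ≤ κ) :
    laplace μ κ ≤ μ.real univ * exp (-(κ * L - κ ^ 2 * (L * ∫ s, s ∂q) / 2)) := by
  set m := ∫ s, s ∂q with hm
  have hder : ∀ k, 0 < k → HasDerivAt (fun k => laplace μ k * exp (k * L - k ^ 2 * (L * m) / 2))
      ((L - k * (L * m) - L * laplace q k) * (laplace μ k * exp (k * L - k ^ 2 * (L * m) / 2))) k := by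
    intro k hk
    have h2 : HasDerivAt (fun k : ℝ => k * L - k ^ 2 * (L * m) / 2) (L - k * (L * m)) k := by
      have := ((hasDerivAt_id k).mul_const L).sub
        (((hasDerivAt_pow 2 k).mul_const (L * m)).div_const 2)
      refine this.congr_deriv ?_
      simp; ring
    exact ((h.hasDerivAt_laplace hk).mul h2.exp).congr_deriv (by ring)
  have hq : ∀ k, 0 ≤ k → 1 - k * m ≤ laplace q k := by
    intro k hk
    rw [hm, ← integral_const_mul]
    have : ∫ s, (1 - k * s) ∂q = 1 - ∫ s, k * s ∂q := by
      rw [integral_sub (integrable_const _) (hq1.const_mul k)]; simp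
    rw [← this]
    refine integral_mono_ae ((integrable_const _).sub (hq1.const_mul k))
      (integrable_exp_neg_mul_max hk q) ?_
    filter_upwards [h.pos] with s hs
    rw [max_eq_left hs.le]
    linarith [add_one_le_exp (-(k * s))]
  have hanti : AntitoneOn (fun k => laplace μ k * exp (k * L - k ^ 2 * (L * m) / 2)) (Ici 0) := by
    refine antitoneOn_of_deriv_nonpos (convex_Ici 0)
      ((continuousOn_laplace μ).mul (by fun_prop)) ?_ ?_
    · intro k hk
      rw [interior_Ici] at hk
      exact (hder k hk).differentiableAt.differentiableWithinAt
    · intro k hk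
      rw [interior_Ici] at hk
      have hk' : 0 < k := hk
      rw [(hder k hk).deriv]
      refine mul_nonpos_of_nonpos_of_nonneg ?_
        (mul_nonneg (laplace_nonneg _ _) (exp_pos _).le)
      have := mul_le_mul_of_nonneg_left (hq k hk'.le) h.L_pos.le
      linarith
  have h0 := hanti (show (0 : ℝ) ∈ Ici 0 from self_mem_Ici) (show κ ∈ Ici 0 from hκ) hκ
  have e0 : laplace μ 0 = μ.real univ := by simp [laplace]
  simp only [e0] at h0
  rw [exp_neg, ← div_eq_mul_inv, le_div_iff₀ (exp_pos _)]
  simpa using h0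

omit [IsProbabilityMeasure q] in
theorem SizeBiased.measureReal_Iic_le (h : SizeBiased μ q L) {κ : ℝ} (hκ : 0 ≤ κ) (t : ℝ) :
    μ.real (Iic t) ≤ exp (κ * t) * laplace μ κ := by
  rw [← integral_indicator_one measurableSet_Iic, laplace, ← integral_const_mul]
  refine integral_mono_ae ((integrable_const 1).indicator measurableSet_Iic)
    ((integrable_exp_neg_mul_max hκ μ).const_mul _) ?_
  filter_upwards [h.nonneg] with s hs
  rw [← exp_add, max_eq_left hs]
  by_cases hst : s ≤ t
  · simp only [indicator, mem_Iic, hst, if_true, Pi.one_apply]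
    rw [one_le_exp_iff]
    nlinarith
  · simp [hst]; positivity

theorem SizeBiased.laplace_mul_exp_le (h : SizeBiased μ q L)
    (hq1 : Integrable (fun s : ℝ => s) q) {M : ℝ} (hM0 : 0 < M) (hM : ∫ s, s ∂q ≤ M) :
    laplace μ (1 / (2 * M)) * exp (3 * L / (8 * M)) ≤ μ.real univ := by
  have h1 := h.laplace_le hq1 (κ := 1 / (2 * M)) (by positivity)
  have hL := h.L_pos
  have h2 : (1 / (2 * M)) ^ 2 * (L * ∫ s, s ∂q) / 2 ≤ (1 / (2 * M)) ^ 2 * (L * M) / 2 := by gcongr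
  have h3 : 3 * L / (8 * M) ≤ 1 / (2 * M) * L - (1 / (2 * M)) ^ 2 * (L * ∫ s, s ∂q) / 2 := by
    refine le_trans (le_of_eq ?_) (sub_le_sub_left h2 _)
    field_simp; ring
  calc _ ≤ μ.real univ * exp (-(3 * L / (8 * M))) * exp (3 * L / (8 * M)) := by
        gcongr
        refine h1.trans ?_
        gcongr
    _ = _ := by rw [mul_assoc, ← exp_add]; simp

theorem SizeBiased.measureReal_Iic_half_le (h : SizeBiased μ q L)
    (hq1 : Integrable (fun s : ℝ => s) q) {M : ℝ} (hM0 : 0 < M) (hM : ∫ s, s ∂q ≤ M) {t : ℝ}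
    (ht : t ≤ L / 2) : μ.real (Iic t) ≤ μ.real univ * exp (-(L / (8 * M))) := by
  have h1 := h.laplace_mul_exp_le hq1 hM0 hM
  refine (h.measureReal_Iic_le (κ := 1 / (2 * M)) (by positivity) t).trans ?_
  have h2 : exp (1 / (2 * M) * t) ≤ exp (1 / (2 * M) * (L / 2)) := by gcongr
  have e : exp (1 / (2 * M) * (L / 2)) = exp (3 * L / (8 * M)) * exp (-(L / (8 * M))) := by
    rw [← exp_add]; congr 1; field_simp; ring
  calc _ ≤ exp (1 / (2 * M) * (L / 2)) * laplace μ (1 / (2 * M)) := by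
        gcongr; exact laplace_nonneg _ _
    _ = laplace μ (1 / (2 * M)) * exp (3 * L / (8 * M)) * exp (-(L / (8 * M))) := by rw [e]; ring
    _ ≤ _ := by gcongr

end

theorem hasSum_prod_of_fintype {ι : Type*} [Fintype ι] {f : ι × ℕ → ℝ} {g : ι → ℝ}
    (h0 : ∀ i, 0 ≤ f i) (h : ∀ i, HasSum (fun k => f (i, k)) (g i)) : HasSum f (∑ i, g i) := by
  have hs : Summable f := (summable_prod_of_nonneg h0).2
    ⟨fun i => (h i).summable, (hasSum_fintype _).summable⟩
  have := hs.hasSum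
  rw [hs.tsum_prod' fun i => (h i).summable, tsum_fintype] at this
  simpa only [(h _).tsum_eq] using this

/-- The coefficient `n ^ (-α)` on smooth numbers. -/
def smoothCoeff (Y : ℕ) (α : ℝ) (n : ℕ) : ℝ :=
  if n ∈ Nat.smoothNumbers (Y + 1) then (n : ℝ) ^ (-α) else 0

theorem smoothCoeff_nonneg (Y : ℕ) (α : ℝ) (n : ℕ) : 0 ≤ smoothCoeff Y α n := by
  unfold smoothCoeff; split_ifs <;> positivity

theorem smoothCoeff_zero (Y : ℕ) (α : ℝ) : smoothCoeff Y α 0 = 0 := by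
  unfold smoothCoeff
  rw [if_neg fun h => Nat.ne_zero_of_mem_smoothNumbers h rfl]

/-- The Dirichlet measure on logarithms of smooth numbers. -/
def smoothMeasure (Y : ℕ) (α : ℝ) : Measure ℝ :=
  Measure.sum fun n : ℕ => ENNReal.ofReal (smoothCoeff Y α n) • Measure.dirac (log n)

/-- The weight of the prime power `p ^ (k + 1)`. -/
def primeWeight (α L : ℝ) (p k : ℕ) : ℝ := log p * ((p : ℝ) ^ (-α)) ^ (k + 1) / L

theorem primeWeight_nonneg (α : ℝ) {L : ℝ} (hL : 0 < L) (p k : ℕ) : 0 ≤ primeWeight α L p k := by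
  unfold primeWeight
  have := log_natCast_nonneg p
  positivity

/-- The normalized von Mangoldt measure on logarithms of prime powers. -/
def primeMeasure (Y : ℕ) (α L : ℝ) : Measure ℝ :=
  Measure.sum fun i : (Nat.primesBelow (Y + 1)) × ℕ =>
    ENNReal.ofReal (primeWeight α L i.1 i.2) • Measure.dirac ((i.2 + 1 : ℝ) * log (i.1 : ℕ))

/-- The completely multiplicative function `n ↦ n ^ (-α)`. -/
def rpowHom (α : ℝ) : ℕ →* ℝ where
  toFun n := (n : ℝ) ^ (-α)
  map_one' := by simp
  map_mul' m n := by push_cast; rw [mul_rpow (by positivity) (by positivity)]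

theorem rpowHom_apply (α : ℝ) (n : ℕ) : rpowHom α n = (n : ℝ) ^ (-α) := rfl

theorem norm_rpowHom_lt_one {α : ℝ} (hα : 0 < α) {p : ℕ} (hp : p.Prime) : ‖rpowHom α p‖ < 1 := by
  rw [rpowHom_apply, norm_of_nonneg (by positivity)]
  exact rpow_lt_one_of_one_lt_of_neg (by exact_mod_cast hp.one_lt) (by linarith)

theorem summable_smoothCoeff (Y : ℕ) {α : ℝ} (hα : 0 < α) : Summable (smoothCoeff Y α) := by
  have h := (EulerProduct.summable_and_hasSum_smoothNumbers_prod_primesBelow_geometric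
    (f := rpowHom α) (fun hp => norm_rpowHom_lt_one hα hp) (Y + 1)).1
  have h2 := (summable_subtype_iff_indicator (f := fun n : ℕ => ‖rpowHom α n‖)).1 h
  refine h2.congr fun n => ?_
  by_cases hn : n ∈ Nat.smoothNumbers (Y + 1)
  · rw [indicator_of_mem hn, smoothCoeff, if_pos hn, rpowHom_apply,
      norm_of_nonneg (by positivity)]
  · rw [indicator_of_notMem hn, smoothCoeff, if_neg hn]

theorem isFiniteMeasure_smoothMeasure (Y : ℕ) {α : ℝ} (hα : 0 < α) :
    IsFiniteMeasure (smoothMeasure Y α) := by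
  constructor
  rw [smoothMeasure, Measure.sum_apply _ MeasurableSet.univ]
  simpa using (summable_smoothCoeff Y hα).tsum_ofReal_lt_top

theorem lintegral_smoothMeasure (Y : ℕ) (α : ℝ) (f : ℝ → ENNReal) :
    ∫⁻ s, f s ∂(smoothMeasure Y α) = ∑' n : ℕ, ENNReal.ofReal (smoothCoeff Y α n) * f (log n) := by
  simp [smoothMeasure, lintegral_sum_measure, lintegral_smul_measure, lintegral_dirac]

theorem lintegral_primeMeasure (Y : ℕ) (α L : ℝ) (f : ℝ → ENNReal) :
    ∫⁻ s, f s ∂(primeMeasure Y α L) = ∑' i : (Nat.primesBelow (Y + 1)) × ℕ,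
      ENNReal.ofReal (primeWeight α L i.1 i.2) * f ((i.2 + 1 : ℝ) * log (i.1 : ℕ)) := by
  simp [primeMeasure, lintegral_sum_measure, lintegral_smul_measure, lintegral_dirac]

theorem integral_smoothMeasure (Y : ℕ) (α : ℝ) (f : ℝ → ℝ) :
    ∫ s, f s ∂(smoothMeasure Y α) = ∑' n : ℕ, smoothCoeff Y α n * f (log n) := by
  rw [smoothMeasure, integral_sum_dirac (fun _ => ENNReal.ofReal_ne_top)]
  simp [ENNReal.toReal_ofReal (smoothCoeff_nonneg Y α _)]

theorem integral_primeMeasure (Y : ℕ) (α : ℝ) {L : ℝ} (hL : 0 < L) (f : ℝ → ℝ) :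
    ∫ s, f s ∂(primeMeasure Y α L) = ∑' i : (Nat.primesBelow (Y + 1)) × ℕ,
      primeWeight α L i.1 i.2 * f ((i.2 + 1 : ℝ) * log (i.1 : ℕ)) := by
  rw [primeMeasure, integral_sum_dirac (fun _ => ENNReal.ofReal_ne_top)]
  simp [ENNReal.toReal_ofReal (primeWeight_nonneg α hL _ _)]

theorem integrable_primeMeasure {Y : ℕ} {α : ℝ} {L : ℝ} (hL : 0 < L) {f : ℝ → ℝ}
    (h : Summable fun i : (Nat.primesBelow (Y + 1)) × ℕ =>
      primeWeight α L i.1 i.2 * |f ((i.2 + 1 : ℝ) * log (i.1 : ℕ))|) :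
    Integrable f (primeMeasure Y α L) := by
  refine integrable_sum_dirac (fun _ => ENNReal.ofReal_ne_top) ?_
  simpa [ENNReal.toReal_ofReal (primeWeight_nonneg α hL _ _)] using h

theorem pow_mul_mem_smoothNumbers_iff {Y p m k : ℕ} (hp : p ∈ Nat.primesBelow (Y + 1)) :
    p ^ k * m ∈ Nat.smoothNumbers (Y + 1) ↔ m ∈ Nat.smoothNumbers (Y + 1) := by
  have hpp := Nat.prime_of_mem_primesBelow hp
  refine ⟨fun h => Nat.mem_smoothNumbers_of_dvd h (Dvd.intro_left _ rfl), fun h =>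
    Nat.mul_mem_smoothNumbers ?_ h⟩
  rw [Nat.mem_smoothNumbers']
  intro r hr hd
  rw [(Nat.prime_dvd_prime_iff_eq hr hpp).1 (hr.dvd_of_dvd_pow hd)]
  exact Nat.lt_of_mem_primesBelow hp

theorem smoothCoeff_pow_mul {Y p : ℕ} (hp : p ∈ Nat.primesBelow (Y + 1)) (α : ℝ) (k m : ℕ) :
    smoothCoeff Y α (p ^ k * m) = ((p : ℝ) ^ (-α)) ^ k * smoothCoeff Y α m := by
  unfold smoothCoeff
  simp only [pow_mul_mem_smoothNumbers_iff hp]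
  split_ifs
  · push_cast
    rw [mul_rpow (by positivity) (by positivity), ← rpow_natCast, ← rpow_natCast,
      ← rpow_mul (by positivity), ← rpow_mul (by positivity)]
    congr 2; ring
  · simp

theorem tsum_prime_pow_dvd_log {Y n : ℕ} (hn : n ∈ Nat.smoothNumbers (Y + 1)) :
    ∑' i : (Nat.primesBelow (Y + 1)) × ℕ,
      (if (i.1 : ℕ) ^ (i.2 + 1) ∣ n then ENNReal.ofReal (log (i.1 : ℕ)) else 0)
      = ENNReal.ofReal (log n) := by
  have hn0 := Nat.ne_zero_of_mem_smoothNumbers hn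
  rw [ENNReal.tsum_prod', tsum_fintype]
  have h1 : ∀ p : Nat.primesBelow (Y + 1), ∑' k : ℕ,
      (if (p : ℕ) ^ (k + 1) ∣ n then ENNReal.ofReal (log (p : ℕ)) else 0)
      = ENNReal.ofReal (n.factorization p * log (p : ℕ)) := by
    intro p
    have hp := Nat.prime_of_mem_primesBelow p.2
    rw [tsum_eq_sum (s := Finset.range (n.factorization p))]
    · rw [Finset.sum_congr rfl (g := fun _ => ENNReal.ofReal (log (p : ℕ)))]
      · rw [Finset.sum_const, Finset.card_range, nsmul_eq_mul, ENNReal.ofReal_mul (by positivity),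
          ENNReal.ofReal_natCast]
      · intro k hk
        rw [if_pos]
        rw [hp.pow_dvd_iff_le_factorization hn0]
        exact Finset.mem_range.1 hk
    · intro k hk
      rw [if_neg]
      rw [hp.pow_dvd_iff_le_factorization hn0]
      rw [Finset.mem_range] at hk
      exact fun h => hk h
  simp only [h1]
  rw [← ENNReal.ofReal_sum_of_nonneg fun i _ => by
    have := log_natCast_nonneg (i : ℕ); positivity]
  congr 1
  rw [log_nat_eq_sum_factorization, Finsupp.sum, Nat.support_factorization,
    Finset.sum_coe_sort (Nat.primesBelow (Y + 1)) (fun p : ℕ => (n.factorization p : ℝ) * log p)]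
  symm
  refine Finset.sum_subset (Nat.primeFactors_subset_of_mem_smoothNumbers hn) fun p _ hp => ?_
  rw [← Nat.support_factorization, Finsupp.notMem_support_iff] at hp
  simp [hp]

theorem sizeBiased_smooth {Y : ℕ} {α L : ℝ} (hL : 0 < L)
    [IsFiniteMeasure (smoothMeasure Y α)] [IsFiniteMeasure (primeMeasure Y α L)] :
    SizeBiased (smoothMeasure Y α) (primeMeasure Y α L) L where
  nonneg := by
    rw [smoothMeasure, Measure.ae_sum_iff]
    intro n
    refine Measure.ae_smul_measure ?_ _
    exact (ae_dirac_iff (p := fun x : ℝ => 0 ≤ x) measurableSet_Ici).2 (log_natCast_nonneg n)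
  pos := by
    rw [primeMeasure, Measure.ae_sum_iff]
    intro i
    refine Measure.ae_smul_measure ?_ _
    refine (ae_dirac_iff (p := fun x : ℝ => 0 < x) measurableSet_Ioi).2 ?_
    have := Nat.prime_of_mem_primesBelow i.1.2
    have : 0 < log (i.1 : ℕ) := log_pos (by exact_mod_cast this.one_lt)
    positivity
  L_pos := hL
  bias := by
    refine Measure.ext_of_lintegral _ fun f hf => ?_
    rw [lintegral_withDensity_eq_lintegral_mul _ (by fun_prop) hf, lintegral_smoothMeasure,
      lintegral_smul_measure, Measure.lintegral_conv hf, lintegral_smoothMeasure]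
    simp only [lintegral_primeMeasure, Pi.mul_apply, smul_eq_mul]
    calc ∑' n : ℕ, ENNReal.ofReal (smoothCoeff Y α n) * (ENNReal.ofReal (log n) * f (log n))
        = ∑' n : ℕ, ∑' i : (Nat.primesBelow (Y + 1)) × ℕ,
            ENNReal.ofReal (smoothCoeff Y α n) * f (log n) *
            (if (i.1 : ℕ) ^ (i.2 + 1) ∣ n then ENNReal.ofReal (log (i.1 : ℕ)) else 0) := by
          congr 1; ext n
          rw [ENNReal.tsum_mul_left]
          by_cases hn : n ∈ Nat.smoothNumbers (Y + 1)
          · rw [tsum_prime_pow_dvd_log hn]; ring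
          · simp [smoothCoeff, hn]
      _ = ∑' i : (Nat.primesBelow (Y + 1)) × ℕ, ∑' n : ℕ,
            ENNReal.ofReal (smoothCoeff Y α n) * f (log n) *
            (if (i.1 : ℕ) ^ (i.2 + 1) ∣ n then ENNReal.ofReal (log (i.1 : ℕ)) else 0) :=
          ENNReal.tsum_comm
      _ = ∑' i : (Nat.primesBelow (Y + 1)) × ℕ, ∑' m : ℕ, ENNReal.ofReal L *
            (ENNReal.ofReal (smoothCoeff Y α m) * (ENNReal.ofReal (primeWeight α L i.1 i.2)
              * f (log m + (i.2 + 1 : ℝ) * log (i.1 : ℕ)))) := by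
          congr 1; ext i
          have hp := Nat.prime_of_mem_primesBelow i.1.2
          have hpk : 0 < (i.1 : ℕ) ^ (i.2 + 1) := pow_pos hp.pos _
          have hinj : Function.Injective fun m : ℕ => (i.1 : ℕ) ^ (i.2 + 1) * m :=
            fun a b h => Nat.eq_of_mul_eq_mul_left hpk h
          rw [← hinj.tsum_eq]
          · congr 1; ext m
            rw [if_pos (Dvd.intro _ rfl), smoothCoeff_pow_mul i.1.2]
            rcases Nat.eq_zero_or_pos m with rfl | hm
            · simp [smoothCoeff_zero]
            have e : log (((i.1 : ℕ) ^ (i.2 + 1) * m : ℕ) : ℝ)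
                = log m + (i.2 + 1 : ℝ) * log (i.1 : ℕ) := by
              push_cast
              rw [log_mul (by have := hp.pos; positivity) (by positivity), log_pow]
              push_cast; ring
            have e2 : ENNReal.ofReal (((i.1 : ℕ) : ℝ) ^ (-α)) ^ (i.2 + 1)
                * ENNReal.ofReal (log (i.1 : ℕ))
                = ENNReal.ofReal L * ENNReal.ofReal (primeWeight α L i.1 i.2) := by
              rw [← ENNReal.ofReal_mul hL.le, ← ENNReal.ofReal_pow (by positivity),
                ← ENNReal.ofReal_mul (by positivity)]
              congr 1; unfold primeWeight; field_simp
            rw [e, ENNReal.ofReal_mul (by positivity), ENNReal.ofReal_pow (by positivity)]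
            calc _ = ENNReal.ofReal (smoothCoeff Y α m)
                    * f (log m + (i.2 + 1 : ℝ) * log (i.1 : ℕ))
                    * (ENNReal.ofReal (((i.1 : ℕ) : ℝ) ^ (-α)) ^ (i.2 + 1)
                      * ENNReal.ofReal (log (i.1 : ℕ))) := by ring
              _ = _ := by rw [e2]; ring
          · intro n hn
            by_cases hd : (i.1 : ℕ) ^ (i.2 + 1) ∣ n
            · obtain ⟨m, rfl⟩ := hd; exact ⟨m, rfl⟩
            · simp [hd] at hn
      _ = _ := by
          rw [ENNReal.tsum_comm]
          simp only [ENNReal.tsum_mul_left]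


theorem hasSum_of_eq {f g : ℕ → ℝ} {a b : ℝ} (h : HasSum f a) (hf : ∀ k, g k = f k) (hb : b = a) :
    HasSum g b := by
  rw [hb, show g = f from funext hf]; exact h

theorem hasSum_geometric_succ {a : ℝ} (h0 : 0 ≤ a) (h1 : a < 1) :
    HasSum (fun k : ℕ => a ^ (k + 1)) (a / (1 - a)) := by
  have := (hasSum_geometric_of_lt_one h0 h1).mul_left a
  simpa only [pow_succ', div_eq_mul_inv] using this

theorem hasSum_mul_geometric_succ {a : ℝ} (h0 : 0 ≤ a) (h1 : a < 1) :
    HasSum (fun k : ℕ => ((k : ℝ) + 1) * a ^ (k + 1)) (a / (1 - a) ^ 2) := by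
  have := (hasSum_choose_mul_geometric_of_norm_lt_one 1
    (r := a) (by rwa [norm_of_nonneg h0])).mul_left a
  refine hasSum_of_eq this (fun k => ?_) (by ring)
  rw [Nat.choose_one_right]; push_cast; ring

theorem hasSum_sq_mul_geometric_succ {a : ℝ} (h0 : 0 ≤ a) (h1 : a < 1) :
    HasSum (fun k : ℕ => ((k : ℝ) + 1) ^ 2 * a ^ (k + 1)) (a * (1 + a) / (1 - a) ^ 3) := by
  have := ((hasSum_choose_mul_geometric_of_norm_lt_one 2
    (r := a) (by rwa [norm_of_nonneg h0])).mul_left (2 * a)).sub (hasSum_mul_geometric_succ h0 h1)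
  refine hasSum_of_eq this (fun k => ?_) ?_
  · have : ((Nat.choose (k + 2) 2 : ℕ) : ℝ) = ((k : ℝ) + 1) * (k + 2) / 2 := by
      rw [Nat.cast_choose_two]; push_cast; ring
    rw [this]; ring
  · have : 1 - a ≠ 0 := by linarith
    field_simp; ring

section

variable {Y : ℕ} {α L : ℝ}

/-- Integration against `primeMeasure` prime by prime. -/
theorem integral_primeMeasure_of_hasSum (hL : 0 < L) {f : ℝ → ℝ} (hf : ∀ s, 0 ≤ s → 0 ≤ f s)
    {g : ℕ → ℝ} (h : ∀ p ∈ Nat.primesBelow (Y + 1),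
      HasSum (fun k : ℕ => primeWeight α L p k * f ((k + 1 : ℝ) * log p)) (g p)) :
    Integrable f (primeMeasure Y α L) ∧
      ∫ s, f s ∂(primeMeasure Y α L) = ∑ p ∈ Nat.primesBelow (Y + 1), g p := by
  have hpos : ∀ i : (Nat.primesBelow (Y + 1)) × ℕ, 0 ≤ f ((i.2 + 1 : ℝ) * log (i.1 : ℕ)) :=
    fun i => hf _ (by have := log_natCast_nonneg (i.1 : ℕ); positivity)
  have hs := hasSum_prod_of_fintype
    (f := fun i : (Nat.primesBelow (Y + 1)) × ℕ =>
      primeWeight α L i.1 i.2 * f ((i.2 + 1 : ℝ) * log (i.1 : ℕ)))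
    (g := fun p => g p)
    (fun i => mul_nonneg (primeWeight_nonneg α hL _ _) (hpos i)) (fun p => h p p.2)
  constructor
  · refine integrable_primeMeasure hL ?_
    simpa only [abs_of_nonneg (hpos _)] using hs.summable
  · rw [integral_primeMeasure Y α hL, hs.tsum_eq]
    exact Finset.sum_coe_sort (Nat.primesBelow (Y + 1)) g

theorem rpow_neg_pos_of_prime {p : ℕ} (hp : p.Prime) (α : ℝ) : 0 < (p : ℝ) ^ (-α) := by
  have := hp.pos; positivity

theorem rpow_neg_lt_one_of_prime {p : ℕ} (hp : p.Prime) (hα : 0 < α) : (p : ℝ) ^ (-α) < 1 :=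
  rpow_lt_one_of_one_lt_of_neg (by exact_mod_cast hp.one_lt) (by linarith)

theorem inv_le_log_div {p : ℕ} (hp : p.Prime) (hα : 0 < α) :
    1 / α ≤ log p / (1 - (p : ℝ) ^ (-α)) := by
  have h1 := rpow_neg_lt_one_of_prime hp hα
  have hp0 : (0 : ℝ) < p := by exact_mod_cast hp.pos
  rw [div_le_div_iff₀ hα (by linarith), rpow_def_of_pos hp0]
  have := add_one_le_exp (log p * -α)
  linarith

theorem log_div_le {p : ℕ} (hp : p.Prime) (hα : 0 < α) :
    log p / (1 - (p : ℝ) ^ (-α)) ≤ log p + 1 / α := by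
  have h1 := rpow_neg_lt_one_of_prime hp hα
  have hp0 : (0 : ℝ) < p := by exact_mod_cast hp.pos
  rw [div_le_iff₀ (by linarith)]
  have hl : 0 ≤ log p := log_natCast_nonneg p
  have h2 : (1 + α * log p) * (p : ℝ) ^ (-α) ≤ 1 := by
    rw [rpow_def_of_pos hp0, show log p * -α = -(α * log p) by ring, exp_neg, ← div_eq_mul_inv,
      div_le_one (exp_pos _)]
    linarith [add_one_le_exp (α * log p)]
  have h3 : (log p + 1 / α) * (p : ℝ) ^ (-α) ≤ 1 / α := by
    rw [le_div_iff₀ hα]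
    calc _ = (1 + α * log p) * (p : ℝ) ^ (-α) := by field_simp; ring
      _ ≤ 1 := h2
  linarith

theorem rpow_neg_div_one_sub {p : ℕ} (hp : p.Prime) (α : ℝ) :
    (p : ℝ) ^ (-α) / (1 - (p : ℝ) ^ (-α)) = 1 / ((p : ℝ) ^ α - 1) := by
  have hp0 : (0 : ℝ) < p := by exact_mod_cast hp.pos
  have h : (p : ℝ) ^ α ≠ 0 := (rpow_pos_of_pos hp0 _).ne'
  rw [rpow_neg hp0.le]
  rw [show 1 - ((p : ℝ) ^ α)⁻¹ = ((p : ℝ) ^ α - 1) * ((p : ℝ) ^ α)⁻¹ by field_simp]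
  rw [← div_div, div_right_comm, div_self (inv_ne_zero h)]

theorem isProbabilityMeasure_primeMeasure (hα : 0 < α) (hL : 0 < L)
    (h : ∑ p ∈ Nat.primesBelow (Y + 1), log p / ((p : ℝ) ^ α - 1) = L) :
    IsProbabilityMeasure (primeMeasure Y α L) := by
  refine HasSum.isProbabilityMeasure_sum_dirac (c := fun i : (Nat.primesBelow (Y + 1)) × ℕ =>
    primeWeight α L i.1 i.2) (fun i => primeWeight_nonneg α hL _ _) ?_
  have := hasSum_prod_of_fintype (f := fun i : (Nat.primesBelow (Y + 1)) × ℕ =>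
    primeWeight α L i.1 i.2) (g := fun p => log (p : ℕ) / (((p : ℕ) : ℝ) ^ α - 1) / L)
    (fun i => primeWeight_nonneg α hL _ _) (fun p => by
      have hp := Nat.prime_of_mem_primesBelow p.2
      have := ((hasSum_geometric_succ (rpow_neg_pos_of_prime hp α).le
        (rpow_neg_lt_one_of_prime hp hα)).mul_left (log (p : ℕ))).div_const L
      rw [rpow_neg_div_one_sub hp, mul_one_div] at this
      exact this)
  convert this
  rw [Finset.sum_coe_sort (Nat.primesBelow (Y + 1))
    (fun p : ℕ => log p / ((p : ℝ) ^ α - 1) / L), ← Finset.sum_div, h, div_self hL.ne']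

theorem primeMeasure_moment_one (hα : 0 < α) (hL : 0 < L) :
    Integrable (fun s => s) (primeMeasure Y α L) ∧ ∫ s, s ∂(primeMeasure Y α L) =
      ∑ p ∈ Nat.primesBelow (Y + 1),
        log p ^ 2 * ((p : ℝ) ^ (-α) / (1 - (p : ℝ) ^ (-α)) ^ 2) / L := by
  refine integral_primeMeasure_of_hasSum hL (f := fun s => s) (fun s hs => hs) fun p hp => ?_
  have hp := Nat.prime_of_mem_primesBelow hp
  have := ((hasSum_mul_geometric_succ (rpow_neg_pos_of_prime hp α).le
        (rpow_neg_lt_one_of_prime hp hα)).mul_left (log p ^ 2)).div_const L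
  refine hasSum_of_eq this (fun k => ?_) (by ring)
  unfold primeWeight; ring

theorem primeMeasure_moment_two (hα : 0 < α) (hL : 0 < L) :
    Integrable (fun s => s ^ 2) (primeMeasure Y α L) ∧ ∫ s, s ^ 2 ∂(primeMeasure Y α L) =
      ∑ p ∈ Nat.primesBelow (Y + 1), log p ^ 3 *
        ((p : ℝ) ^ (-α) * (1 + (p : ℝ) ^ (-α)) / (1 - (p : ℝ) ^ (-α)) ^ 3) / L := by
  refine integral_primeMeasure_of_hasSum hL (f := fun s => s ^ 2) (fun s hs => by positivity)
    fun p hp => ?_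
  have hp := Nat.prime_of_mem_primesBelow hp
  have := ((hasSum_sq_mul_geometric_succ (rpow_neg_pos_of_prime hp α).le
        (rpow_neg_lt_one_of_prime hp hα)).mul_left (log p ^ 3)).div_const L
  refine hasSum_of_eq this (fun k => ?_) (by ring)
  unfold primeWeight; ring

theorem primeMeasure_moment_zero (hL : 0 < L)
    (h : ∑ p ∈ Nat.primesBelow (Y + 1), log p / ((p : ℝ) ^ α - 1) = L) :
    ∑ p ∈ Nat.primesBelow (Y + 1), log p * ((p : ℝ) ^ (-α) / (1 - (p : ℝ) ^ (-α))) / L = 1 := by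
  rw [← Finset.sum_div, div_eq_one_iff_eq hL.ne', ← h]
  refine Finset.sum_congr rfl fun p hp => ?_
  rw [rpow_neg_div_one_sub (Nat.prime_of_mem_primesBelow hp), mul_one_div]

theorem primeMeasure_mean_le (hα : 0 < α) (hL : 0 < L) {M : ℝ}
    (h : ∑ p ∈ Nat.primesBelow (Y + 1), log p / ((p : ℝ) ^ α - 1) = L)
    (hM : ∀ p ∈ Nat.primesBelow (Y + 1), log p / (1 - (p : ℝ) ^ (-α)) ≤ M) :
    ∫ s, s ∂(primeMeasure Y α L) ≤ M := by
  have e : ∑ p ∈ Nat.primesBelow (Y + 1),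
      M * (log p * ((p : ℝ) ^ (-α) / (1 - (p : ℝ) ^ (-α))) / L) = M := by
    rw [← Finset.mul_sum, primeMeasure_moment_zero hL h, mul_one]
  rw [(primeMeasure_moment_one hα hL).2]
  refine le_trans ?_ e.le
  refine Finset.sum_le_sum fun p hp => ?_
  have hpp := Nat.prime_of_mem_primesBelow hp
  have h1 := rpow_neg_lt_one_of_prime hpp hα
  have h0 := rpow_neg_pos_of_prime hpp α
  have hl : 0 ≤ log p := log_natCast_nonneg p
  have hw : 0 ≤ log p * ((p : ℝ) ^ (-α) / (1 - (p : ℝ) ^ (-α))) / L := by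
    have : 0 < 1 - (p : ℝ) ^ (-α) := by linarith
    positivity
  refine le_trans (le_of_eq ?_) (mul_le_mul_of_nonneg_right (hM p hp) hw)
  have : 1 - (p : ℝ) ^ (-α) ≠ 0 := by linarith
  field_simp

theorem inv_le_primeMeasure_mean (hα : 0 < α) (hL : 0 < L)
    (h : ∑ p ∈ Nat.primesBelow (Y + 1), log p / ((p : ℝ) ^ α - 1) = L) :
    1 / α ≤ ∫ s, s ∂(primeMeasure Y α L) := by
  have e : ∑ p ∈ Nat.primesBelow (Y + 1),
      1 / α * (log p * ((p : ℝ) ^ (-α) / (1 - (p : ℝ) ^ (-α))) / L) = 1 / α := by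
    rw [← Finset.mul_sum, primeMeasure_moment_zero hL h, mul_one]
  rw [(primeMeasure_moment_one hα hL).2]
  refine le_trans e.ge ?_
  refine Finset.sum_le_sum fun p hp => ?_
  have hpp := Nat.prime_of_mem_primesBelow hp
  have h1 := rpow_neg_lt_one_of_prime hpp hα
  have h0 := rpow_neg_pos_of_prime hpp α
  have hl : 0 ≤ log p := log_natCast_nonneg p
  have hw : 0 ≤ log p * ((p : ℝ) ^ (-α) / (1 - (p : ℝ) ^ (-α))) / L := by
    have : 0 < 1 - (p : ℝ) ^ (-α) := by linarith
    positivity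
  refine le_trans (mul_le_mul_of_nonneg_right (inv_le_log_div hpp hα) hw) (le_of_eq ?_)
  have : 1 - (p : ℝ) ^ (-α) ≠ 0 := by linarith
  field_simp

theorem primeMeasure_second_moment_le (hα : 0 < α) (hL : 0 < L) {M : ℝ}
    (hM : ∀ p ∈ Nat.primesBelow (Y + 1), log p / (1 - (p : ℝ) ^ (-α)) ≤ M) :
    ∫ s, s ^ 2 ∂(primeMeasure Y α L) ≤ 2 * M * ∫ s, s ∂(primeMeasure Y α L) := by
  rw [(primeMeasure_moment_one hα hL).2, (primeMeasure_moment_two hα hL).2, Finset.mul_sum]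
  refine Finset.sum_le_sum fun p hp => ?_
  have hpp := Nat.prime_of_mem_primesBelow hp
  have h1 := rpow_neg_lt_one_of_prime hpp hα
  have h0 := rpow_neg_pos_of_prime hpp α
  have hl : 0 ≤ log p := log_natCast_nonneg p
  have hd : 0 < 1 - (p : ℝ) ^ (-α) := by linarith
  have hw : 0 ≤ log p ^ 2 * ((p : ℝ) ^ (-α) / (1 - (p : ℝ) ^ (-α)) ^ 2) / L := by positivity
  refine le_trans ?_ (mul_le_mul_of_nonneg_right
    (mul_le_mul_of_nonneg_left (hM p hp) zero_le_two) hw)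
  have e : log p ^ 3 * ((p : ℝ) ^ (-α) * (1 + (p : ℝ) ^ (-α)) / (1 - (p : ℝ) ^ (-α)) ^ 3) / L
      = (1 + (p : ℝ) ^ (-α)) * (log p / (1 - (p : ℝ) ^ (-α)))
        * (log p ^ 2 * ((p : ℝ) ^ (-α) / (1 - (p : ℝ) ^ (-α)) ^ 2) / L) := by
    field_simp
  rw [e]
  refine mul_le_mul_of_nonneg_right (mul_le_mul_of_nonneg_right (by linarith) (by positivity)) hw

theorem sum_log_sq_le_primeMeasure_mean (hα : 0 < α) (hL : 0 < L) :
    ∑ p ∈ Nat.primesBelow (Y + 1), log p ^ 2 * (p : ℝ) ^ (-α)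
      ≤ L * ∫ s, s ∂(primeMeasure Y α L) := by
  rw [(primeMeasure_moment_one hα hL).2, Finset.mul_sum]
  refine Finset.sum_le_sum fun p hp => ?_
  have hpp := Nat.prime_of_mem_primesBelow hp
  have h1 := rpow_neg_lt_one_of_prime hpp hα
  have h0 := rpow_neg_pos_of_prime hpp α
  have hd : 0 < 1 - (p : ℝ) ^ (-α) := by linarith
  rw [mul_div_cancel₀ _ hL.ne']
  refine mul_le_mul_of_nonneg_left ?_ (sq_nonneg _)
  rw [le_div_iff₀ (by positivity)]
  have : (1 - (p : ℝ) ^ (-α)) ^ 2 ≤ 1 := by nlinarith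
  exact mul_le_of_le_one_right h0.le this

/-- Decay of the characteristic function from the primes alone. -/
theorem norm_charFun_smoothMeasure_le (hα : 0 < α) (hL : 0 < L)
    (h : ∑ p ∈ Nat.primesBelow (Y + 1), log p / ((p : ℝ) ^ α - 1) = L) (τ : ℝ) :
    ‖charFun (smoothMeasure Y α) τ‖ ≤ (smoothMeasure Y α).real univ *
      exp (-∑ p ∈ Nat.primesBelow (Y + 1), (p : ℝ) ^ (-α) * (1 - cos (τ * log p))) := by
  have := isFiniteMeasure_smoothMeasure Y hα
  have := isProbabilityMeasure_primeMeasure hα hL h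
  have hS : SizeBiased (smoothMeasure Y α) (primeMeasure Y α L) L := sizeBiased_smooth hL
  rw [hS.norm_charFun_eq]
  refine mul_le_mul_of_nonneg_left (exp_le_exp.2 (neg_le_neg ?_)) measureReal_nonneg
  rw [integral_primeMeasure Y α hL, ← tsum_mul_left]
  set F : (Nat.primesBelow (Y + 1)) × ℕ → ℝ := fun i => L * (primeWeight α L i.1 i.2 *
    ((1 - cos (τ * ((i.2 + 1 : ℝ) * log (i.1 : ℕ)))) / ((i.2 + 1 : ℝ) * log (i.1 : ℕ)))) with hF
  have hl : ∀ i : (Nat.primesBelow (Y + 1)) × ℕ, 0 < log (i.1 : ℕ) := fun i =>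
    log_pos (by exact_mod_cast (Nat.prime_of_mem_primesBelow i.1.2).one_lt)
  have hnn : ∀ i, 0 ≤ F i := fun i => by
    have h1 := primeWeight_nonneg α hL i.1 i.2
    have h2 := hl i
    have h3 : 0 ≤ 1 - cos (τ * ((i.2 + 1 : ℝ) * log (i.1 : ℕ))) := by
      linarith [cos_le_one (τ * ((i.2 + 1 : ℝ) * log (i.1 : ℕ)))]
    rw [hF]; positivity
  have hb : ∀ i, F i ≤ (2 / log 2 * ((((i.1 : ℕ) : ℝ) ^ (-α)) ^ (i.2 + 1) * log (i.1 : ℕ))) := by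
    intro i
    have h2 := hl i
    have h3 : 1 - cos (τ * ((i.2 + 1 : ℝ) * log (i.1 : ℕ))) ≤ 2 := by
      linarith [neg_one_le_cos (τ * ((i.2 + 1 : ℝ) * log (i.1 : ℕ)))]
    have hlog2 : log 2 ≤ (i.2 + 1 : ℝ) * log (i.1 : ℕ) := by
      have : log 2 ≤ log (i.1 : ℕ) := log_le_log (by norm_num)
        (by exact_mod_cast (Nat.prime_of_mem_primesBelow i.1.2).two_le)
      nlinarith [Nat.cast_nonneg (α := ℝ) i.2]
    have h4 : (1 - cos (τ * ((i.2 + 1 : ℝ) * log (i.1 : ℕ)))) / ((i.2 + 1 : ℝ) * log (i.1 : ℕ))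
        ≤ 2 / log 2 := div_le_div₀ zero_le_two h3 (log_pos one_lt_two) hlog2
    have e : F i = (((1 - cos (τ * ((i.2 + 1 : ℝ) * log (i.1 : ℕ)))) / ((i.2 + 1 : ℝ)
      * log (i.1 : ℕ)))) * ((((i.1 : ℕ) : ℝ) ^ (-α)) ^ (i.2 + 1) * log (i.1 : ℕ)) := by
      rw [hF]; simp only [primeWeight]; field_simp
    rw [e]
    exact mul_le_mul_of_nonneg_right h4 (by positivity)
  have hs : Summable F := by
    refine Summable.of_nonneg_of_le hnn hb (Summable.mul_left _ ?_)
    refine (hasSum_prod_of_fintype (f := fun i : (Nat.primesBelow (Y + 1)) × ℕ =>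
      (((i.1 : ℕ) : ℝ) ^ (-α)) ^ (i.2 + 1) * log (i.1 : ℕ))
      (g := fun p => ((p : ℕ) : ℝ) ^ (-α) / (1 - ((p : ℕ) : ℝ) ^ (-α)) * log (p : ℕ))
      (fun i => by have := hl i; positivity) fun p => ?_).summable
    have hp := Nat.prime_of_mem_primesBelow p.2
    exact (hasSum_geometric_succ (rpow_neg_pos_of_prime hp α).le
        (rpow_neg_lt_one_of_prime hp hα)).mul_right _
  have h5 := hs.sum_le_tsum (Finset.univ.map
    (⟨fun p => (p, 0), fun a b hab => (Prod.mk.inj hab).1⟩ :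
      (Nat.primesBelow (Y + 1)) ↪ (Nat.primesBelow (Y + 1)) × ℕ)) (fun i _ => hnn i)
  refine le_trans (le_of_eq ?_) h5
  rw [Finset.sum_map, ← Finset.sum_coe_sort (Nat.primesBelow (Y + 1))]
  refine Finset.sum_congr rfl fun p _ => ?_
  have h6 := hl (p, 0)
  change _ = F (p, 0)
  simp only at h6
  simp only [hF, primeWeight, Nat.cast_zero, zero_add, one_mul, pow_one]
  field_simp

end


theorem isSmooth_iff {y : ℝ} (hy : 0 ≤ y) (n : ℕ) :
    IsSmooth y n ↔ n ∈ Nat.smoothNumbers (⌊y⌋₊ + 1) := by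
  rw [Nat.mem_smoothNumbers']
  refine forall_congr' fun p => forall_congr' fun _ => forall_congr' fun _ => ?_
  rw [Nat.lt_succ_iff, Nat.le_floor_iff hy]

theorem Psi_eq_card {y : ℝ} (hy : 0 ≤ y) (z : ℝ) : Psi z y =
    ((Finset.Icc 1 ⌊z⌋₊).filter fun n => n ∈ Nat.smoothNumbers (⌊y⌋₊ + 1)).card := by
  rw [Psi, Nat.card_coe_set_eq, ← Set.ncard_coe_finset]
  congr 1
  ext n
  simp only [mem_ofPred_eq, Finset.coe_filter, Finset.mem_Icc, isSmooth_iff hy]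
  constructor
  · rintro ⟨h1, h2, h3⟩; exact ⟨⟨h1, Nat.le_floor h2⟩, h3⟩
  · rintro ⟨⟨h1, h2⟩, h3⟩
    exact ⟨h1, (Nat.le_floor_iff' (by omega)).1 h2, h3⟩

theorem Psi_floor {y : ℝ} (hy : 0 ≤ y) (z : ℝ) : Psi z (⌊y⌋₊ : ℝ) = Psi z y := by
  rw [Psi_eq_card hy, Psi_eq_card (Nat.cast_nonneg _), Nat.floor_natCast]

theorem Psi_le {y : ℝ} (hy : 0 ≤ y) {z : ℝ} (hz : 0 ≤ z) : (Psi z y : ℝ) ≤ z := by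
  rw [Psi_eq_card hy]
  refine le_trans ?_ (Nat.floor_le hz)
  have := (Finset.Icc 1 ⌊z⌋₊).card_filter_le fun n => n ∈ Nat.smoothNumbers (⌊y⌋₊ + 1)
  rw [Nat.card_Icc, Nat.add_sub_cancel] at this
  exact_mod_cast this

theorem Psi_mono {y : ℝ} (hy : 0 ≤ y) {z w : ℝ} (h : z ≤ w) : Psi z y ≤ Psi w y := by
  rw [Psi_eq_card hy, Psi_eq_card hy]
  exact Finset.card_le_card
    (Finset.filter_subset_filter _ (Finset.Icc_subset_Icc le_rfl (Nat.floor_mono h)))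

theorem Psi_eq_zero {y : ℝ} (hy : 0 ≤ y) {z : ℝ} (h : z < 1) : Psi z y = 0 := by
  rw [Psi_eq_card hy, Nat.floor_eq_zero.2 h]; simp

theorem Psi_eq_floor {y : ℝ} (hy : 0 ≤ y) {z : ℝ} (h : z ≤ y) : Psi z y = ⌊z⌋₊ := by
  rw [Psi_eq_card hy, Finset.filter_true_of_mem, Nat.card_Icc, Nat.add_sub_cancel]
  intro n hn
  rw [Finset.mem_Icc] at hn
  refine Nat.mem_smoothNumbers_of_lt hn.1 ?_
  exact Nat.lt_succ_of_le (hn.2.trans (Nat.floor_mono h))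

theorem smoothed_smoothMeasure (Y : ℕ) (α : ℝ) {z : ℝ} (hz : 0 < z) :
    smoothed α (smoothMeasure Y α) (log z) = z ^ (-α) * Psi z Y := by
  rw [smoothed, integral_smoothMeasure, Psi_eq_card (Nat.cast_nonneg _), Nat.floor_natCast]
  have hn : ∀ n : ℕ, smoothCoeff Y α n * expKer α (log z - log n) =
      if n ∈ (Finset.Icc 1 ⌊z⌋₊).filter fun n => n ∈ Nat.smoothNumbers (Y + 1)
        then z ^ (-α) else 0 := by
    intro n
    simp only [Finset.mem_filter, Finset.mem_Icc, smoothCoeff, expKer]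
    by_cases hn : n ∈ Nat.smoothNumbers (Y + 1)
    · have h0 : n ≠ 0 := Nat.ne_zero_of_mem_smoothNumbers hn
      have h0' : (0 : ℝ) < n := by positivity
      have e : 0 ≤ log z - log n ↔ n ≤ ⌊z⌋₊ := by
        rw [sub_nonneg, log_le_log_iff h0' hz, Nat.le_floor_iff hz.le]
      simp only [hn, e, and_true, if_true, Nat.one_le_iff_ne_zero.2 h0, true_and]
      split_ifs
      · rw [rpow_def_of_pos h0', rpow_def_of_pos hz, ← exp_add]; congr 1; ring
      · simp
    · simp [hn]
  simp only [hn]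
  rw [tsum_eq_sum (s := (Finset.Icc 1 ⌊z⌋₊).filter fun n => n ∈ Nat.smoothNumbers (Y + 1))
    (fun n hn => if_neg hn), Finset.sum_ite_mem, Finset.inter_self, Finset.sum_const,
    nsmul_eq_mul, mul_comm]

theorem laplace_smoothMeasure_ge (Y : ℕ) {α κ : ℝ} (hα : 0 < α) (hκ : 0 ≤ κ) :
    ∑ n ∈ Finset.Icc 1 Y, (n : ℝ) ^ (-(α + κ)) ≤ laplace (smoothMeasure Y α) κ := by
  rw [laplace, integral_smoothMeasure]
  have hnn : ∀ n : ℕ, 0 ≤ smoothCoeff Y α n * exp (-(κ * max (log n) 0)) := fun n =>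
    mul_nonneg (smoothCoeff_nonneg _ _ _) (exp_pos _).le
  have hs : Summable fun n : ℕ => smoothCoeff Y α n * exp (-(κ * max (log n) 0)) :=
    Summable.of_nonneg_of_le hnn (fun n => mul_le_of_le_one_right (smoothCoeff_nonneg _ _ _)
      (exp_neg_mul_max_le_one hκ _)) (summable_smoothCoeff Y hα)
  refine le_trans (le_of_eq ?_) (hs.sum_le_tsum (Finset.Icc 1 Y) fun n _ => hnn n)
  refine Finset.sum_congr rfl fun n hn => ?_
  rw [Finset.mem_Icc] at hn
  have h0 : (0 : ℝ) < n := by exact_mod_cast hn.1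
  rw [smoothCoeff, if_pos (Nat.mem_smoothNumbers_of_lt hn.1 (by omega)),
    max_eq_left (log_natCast_nonneg n), rpow_def_of_pos h0, rpow_def_of_pos h0, ← exp_add]
  congr 1; ring

theorem primeCounting_le {z : ℝ} (hz : 2 ≤ z) : (⌊z⌋₊.primeCounting : ℝ) ≤ 5 * z / log z := by
  have h1 := Chebyshev.pi_le_log4_mul_div (x := z) (by linarith)
  have hl : 0 < log z := log_pos (by linarith)
  refine h1.trans ?_
  rw [log_sqrt (by linarith)]
  have h4 : log 4 < 1.4 := by
    rw [show (4 : ℝ) = 2 ^ 2 by norm_num, log_pow]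
    have := log_two_lt_d9; push_cast; linarith
  have hs : √z ≤ 2 * z / log z := by
    rw [le_div_iff₀ hl]
    have h5 := log_le_sub_one_of_pos (x := √z) (by positivity)
    rw [log_sqrt (by linarith)] at h5
    have h6 := mul_self_sqrt (show 0 ≤ z by linarith)
    nlinarith [sqrt_nonneg z]
  have : log 4 * z / (log z / 2) ≤ 3 * z / log z := by
    rw [div_le_div_iff₀ (by positivity) hl]
    nlinarith [mul_pos (show 0 < z by linarith) hl]
  calc _ ≤ 3 * z / log z + 2 * z / log z := add_le_add this hs
    _ = _ := by ring

theorem card_primes_le {Y : ℕ} {z : ℝ} (hz : 0 ≤ z) :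
    (((Nat.primesBelow (Y + 1)).filter fun p : ℕ => (p : ℝ) ≤ z).card : ℝ)
      ≤ ⌊z⌋₊.primeCounting := by
  rw [Nat.primeCounting, Nat.primeCounting', Nat.count_eq_card_filter_range]
  refine Nat.cast_le.2 (Finset.card_le_card fun p hp => ?_)
  rw [Finset.mem_filter] at hp ⊢
  rw [Finset.mem_range, Nat.lt_succ_iff, Nat.le_floor_iff hz]
  exact ⟨hp.2, Nat.prime_of_mem_primesBelow hp.1⟩

theorem mul_exp_neg_le {α s t : ℝ} (hs : 0 < s) (hα : 1 ≤ α * s) (h : s ≤ t) :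
    t * exp (-(α * t)) ≤ s * exp (-(α * s)) := by
  have h1 : exp (-(α * s)) = exp (-(α * t)) * exp (α * (t - s)) := by
    rw [← exp_add]; congr 1; ring
  rw [h1, mul_left_comm, mul_comm t]
  refine mul_le_mul_of_nonneg_left ?_ (exp_pos _).le
  have h2 := add_one_le_exp (α * (t - s))
  nlinarith

theorem smoothed_primeMeasure_eq {Y : ℕ} {α L : ℝ} (hL : 0 < L) (t : ℝ) :
    smoothed α (primeMeasure Y α L) t = ∑ p ∈ Nat.primesBelow (Y + 1),
      exp (-(α * t)) / L * (log p * ⌊t / log p⌋₊) := by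
  refine (integral_primeMeasure_of_hasSum hL (f := fun s => expKer α (t - s))
    (fun s _ => expKer_nonneg _ _) fun p hp => ?_).2
  have hpp := Nat.prime_of_mem_primesBelow hp
  have hl : 0 < log p := log_pos (by exact_mod_cast hpp.one_lt)
  have hp0 : (0 : ℝ) < p := by exact_mod_cast hpp.pos
  have h1 : ∀ k : ℕ, primeWeight α L p k * expKer α (t - (k + 1 : ℝ) * log p) =
      if k ∈ Finset.range ⌊t / log p⌋₊ then exp (-(α * t)) / L * log p else 0 := by
    intro k
    have e : k ∈ Finset.range ⌊t / log p⌋₊ ↔ 0 ≤ t - (k + 1 : ℝ) * log p := by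
      rw [Finset.mem_range, ← Nat.succ_le_iff, Nat.le_floor_iff' (by omega), le_div_iff₀ hl,
        sub_nonneg]
      push_cast; rfl
    rw [expKer, primeWeight]
    simp only [e]
    split_ifs
    · have : ((p : ℝ) ^ (-α)) ^ (k + 1) * exp (-(α * (t - (k + 1 : ℝ) * log p)))
          = exp (-(α * t)) := by
        rw [rpow_def_of_pos hp0, ← exp_nat_mul, ← exp_add]; congr 1; push_cast; ring
      rw [← this]; ring
    · simp
  simp only [h1]
  have h2 : HasSum
      (fun k => if k ∈ Finset.range ⌊t / log p⌋₊ then exp (-(α * t)) / L * log p else 0)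
      (∑ k ∈ Finset.range ⌊t / log p⌋₊,
        if k ∈ Finset.range ⌊t / log p⌋₊ then exp (-(α * t)) / L * log p else 0) :=
    hasSum_sum_of_ne_finset_zero fun k hk => if_neg hk
  refine hasSum_of_eq h2 (fun _ => rfl) ?_
  rw [Finset.sum_ite_mem, Finset.inter_self, Finset.sum_const, Finset.card_range, nsmul_eq_mul]
  ring

theorem smoothed_primeMeasure_le {Y : ℕ} (hY : 2 ≤ Y) {α L : ℝ} (hα1 : α ≤ 1) (hL : 0 < L)
    (hαY : 1 ≤ α * log Y) (t : ℝ) :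
    smoothed α (primeMeasure Y α L) t ≤ 5 * (Y : ℝ) ^ (1 - α) / L := by
  have hY2 : (2 : ℝ) ≤ Y := by exact_mod_cast hY
  have hlY : 0 < log Y := log_pos (by linarith)
  have hY0 : (0 : ℝ) < Y := by linarith
  rw [smoothed_primeMeasure_eq hL, ← Finset.mul_sum, div_mul_eq_mul_div]
  refine div_le_div_of_nonneg_right ?_ hL.le
  rcases lt_or_ge t 0 with ht | ht
  · rw [Finset.sum_eq_zero, mul_zero]
    · positivity
    intro p hp
    rw [Nat.floor_of_nonpos (div_nonpos_of_nonpos_of_nonneg ht.le (log_natCast_nonneg p))]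
    simp
  set z : ℝ := min Y (exp t) with hz
  have hz0 : 0 < z := lt_min hY0 (exp_pos t)
  have h1 : ∑ p ∈ Nat.primesBelow (Y + 1), log p * (⌊t / log p⌋₊ : ℝ)
      ≤ t * ((Nat.primesBelow (Y + 1)).filter fun p : ℕ => (p : ℝ) ≤ z).card := by
    rw [mul_comm, ← nsmul_eq_mul, ← Finset.sum_const, Finset.sum_filter]
    refine Finset.sum_le_sum fun p hp => ?_
    have hpp := Nat.prime_of_mem_primesBelow hp
    have hl : 0 < log p := log_pos (by exact_mod_cast hpp.one_lt)
    have hp0 : (0 : ℝ) < p := by exact_mod_cast hpp.pos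
    have hpY : (p : ℝ) ≤ Y := by
      exact_mod_cast Nat.lt_succ_iff.1 (Nat.lt_of_mem_primesBelow hp)
    split_ifs with h
    · have := Nat.floor_le (show 0 ≤ t / log p by positivity)
      rw [le_div_iff₀ hl] at this
      linarith
    · have : t < log p := by
        rw [lt_log_iff_exp_lt hp0]
        by_contra hc
        exact h (le_min hpY (not_lt.1 hc))
      rw [Nat.floor_eq_zero.2 ((div_lt_one hl).2 this)]; simp
  have h2 : ((Nat.primesBelow (Y + 1)).filter fun p : ℕ => (p : ℝ) ≤ z).card ≤ 5 * z / log z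
      ∨ z < 2 := by
    rcases lt_or_ge z 2 with h | h
    · exact Or.inr h
    · exact Or.inl ((card_primes_le hz0.le).trans (primeCounting_le h))
  rcases h2 with h2 | h2
  swap
  · have : ((Nat.primesBelow (Y + 1)).filter fun p : ℕ => (p : ℝ) ≤ z) = ∅ := by
      refine Finset.filter_eq_empty_iff.2 fun p hp => ?_
      have := (Nat.prime_of_mem_primesBelow hp).two_le
      have : (2 : ℝ) ≤ p := by exact_mod_cast this
      linarith
    rw [this] at h1
    simp only [Finset.card_empty, Nat.cast_zero, mul_zero] at h1
    exact (mul_nonpos_of_nonneg_of_nonpos (exp_pos _).le h1).trans (by positivity)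
  have h3 : exp (-(α * t)) * ∑ p ∈ Nat.primesBelow (Y + 1), log p * (⌊t / log p⌋₊ : ℝ)
      ≤ exp (-(α * t)) * (t * (5 * z / log z)) :=
    mul_le_mul_of_nonneg_left (h1.trans (mul_le_mul_of_nonneg_left h2 ht)) (exp_pos _).le
  refine h3.trans ?_
  rw [rpow_def_of_pos hY0]
  rcases le_total (exp t) Y with h | h
  · have e : z = exp t := min_eq_right h
    have htY : t ≤ log Y := (le_log_iff_exp_le hY0).2 h
    rw [e, log_exp]
    have h4 : t * (5 * exp t / t) ≤ 5 * exp t := by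
      rcases ht.eq_or_lt with rfl | ht'
      · simp
      · rw [mul_div_cancel₀ _ ht'.ne']
    calc exp (-(α * t)) * (t * (5 * exp t / t)) ≤ exp (-(α * t)) * (5 * exp t) :=
          mul_le_mul_of_nonneg_left h4 (exp_pos _).le
      _ = 5 * exp ((1 - α) * t) := by
          rw [show (1 - α) * t = -(α * t) + t by ring, exp_add]; ring
      _ ≤ _ := by
          refine mul_le_mul_of_nonneg_left (exp_le_exp.2 ?_) (by norm_num)
          nlinarith
  · have e : z = Y := min_eq_left h
    have htY : log Y ≤ t := (log_le_iff_le_exp hY0).2 h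
    rw [e]
    have h4 := mul_exp_neg_le hlY hαY htY
    calc exp (-(α * t)) * (t * (5 * Y / log Y)) = t * exp (-(α * t)) * (5 * Y / log Y) := by ring
      _ ≤ log Y * exp (-(α * log Y)) * (5 * Y / log Y) :=
          mul_le_mul_of_nonneg_right h4 (by positivity)
      _ = 5 * (exp (-(α * log Y)) * Y) := by field_simp
      _ = 5 * exp (log Y * (1 - α)) := by
          rw [show log Y * (1 - α) = -(α * log Y) + log Y by ring, exp_add, exp_log hY0]
      _ ≤ _ := le_rfl


theorem log_factorial_eq (N : ℕ) : log (N.factorial : ℕ) =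
    ∑ p ∈ Nat.primesBelow (N + 1), (N.factorial.factorization p : ℝ) * log p := by
  rw [log_nat_eq_sum_factorization, Finsupp.sum, Nat.support_factorization]
  refine Finset.sum_subset (fun p hp => ?_) fun p _ hp => ?_
  · have hpp := Nat.prime_of_mem_primeFactors hp
    rw [Nat.mem_primesBelow]
    exact ⟨Nat.lt_succ_of_le (hpp.dvd_factorial.1 (Nat.dvd_of_mem_primeFactors hp)), hpp⟩
  · rw [← Nat.support_factorization, Finsupp.notMem_support_iff] at hp
    simp [hp]

theorem factorization_factorial_ge {N p : ℕ} (hp : p ∈ Nat.primesBelow (N + 1)) :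
    (N : ℝ) / p - 1 ≤ (N.factorial.factorization p : ℝ) := by
  have hpp := Nat.prime_of_mem_primesBelow hp
  have hpN : p ≤ N := Nat.lt_succ_iff.1 (Nat.lt_of_mem_primesBelow hp)
  have h1 : N / p ≤ N.factorial.factorization p := by
    rw [Nat.factorization_factorial hpp (Nat.lt_succ_self _)]
    have := Finset.single_le_sum (f := fun i => N / p ^ i) (fun i _ => Nat.zero_le _)
      (s := Finset.Ico 1 (Nat.log p N).succ) (a := 1) (by
        rw [Finset.mem_Ico]
        exact ⟨le_rfl, Nat.succ_lt_succ (Nat.log_pos hpp.one_lt hpN)⟩)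
    simpa using this
  have h2 : (N : ℝ) / p < (N / p : ℕ) + 1 := by
    rw [div_lt_iff₀ (by exact_mod_cast hpp.pos)]
    have := Nat.lt_mul_div_succ N hpp.pos
    rw [mul_comm]; exact_mod_cast this
  have h3 : ((N / p : ℕ) : ℝ) ≤ N.factorial.factorization p := by exact_mod_cast h1
  linarith

theorem factorization_factorial_le {N p : ℕ} (hpp : p.Prime) :
    (N.factorial.factorization p : ℝ) ≤ N / ((p : ℝ) - 1) := by
  have : Fact p.Prime := ⟨hpp⟩
  have h1 := sub_one_mul_padicValNat_factorial (p := p) N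
  rw [← Nat.factorization_def _ hpp] at h1
  have h2 : (p - 1) * N.factorial.factorization p ≤ N := by omega
  have h3 : (1 : ℝ) < p := by exact_mod_cast hpp.one_lt
  rw [le_div_iff₀ (by linarith)]
  have h4 : (((p - 1 : ℕ) * N.factorial.factorization p : ℕ) : ℝ) ≤ N := by exact_mod_cast h2
  rw [Nat.cast_mul, Nat.cast_sub hpp.one_le, Nat.cast_one] at h4
  linarith

/-- The sum of `log p / (p (p - 1))` is bounded. -/
theorem exists_sum_log_div_mul_le : ∃ C : ℝ, 0 < C ∧ ∀ N : ℕ,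
    ∑ p ∈ Nat.primesBelow (N + 1), log p / (p * ((p : ℝ) - 1)) ≤ C := by
  have hs : Summable fun n : ℕ => 4 * (1 / (n : ℝ) ^ (3 / 2 : ℝ)) :=
    (summable_one_div_nat_rpow.2 (by norm_num)).mul_left 4
  refine ⟨∑' n : ℕ, 4 * (1 / (n : ℝ) ^ (3 / 2 : ℝ)) + 1, ?_, fun N => ?_⟩
  · have : 0 ≤ ∑' n : ℕ, 4 * (1 / (n : ℝ) ^ (3 / 2 : ℝ)) := tsum_nonneg fun n => by positivity
    linarith
  refine le_trans ?_ (le_add_of_nonneg_right zero_le_one)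
  refine le_trans (Finset.sum_le_sum fun p hp => ?_) (hs.sum_le_tsum _ fun n _ => by positivity)
  have hpp := Nat.prime_of_mem_primesBelow hp
  have h2 : (2 : ℝ) ≤ p := by exact_mod_cast hpp.two_le
  have h0 : (0 : ℝ) < p := by linarith
  have h3 : log p ≤ 2 * √p := by
    have := log_le_sub_one_of_pos (x := √p) (by positivity)
    rw [log_sqrt h0.le] at this
    linarith
  have h4 : (p : ℝ) ^ (3 / 2 : ℝ) = p * √p := by
    rw [show (3 / 2 : ℝ) = 1 + 1 / 2 by norm_num, rpow_add h0, rpow_one, ← sqrt_eq_rpow]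
  rw [h4, mul_one_div, div_le_div_iff₀ (by nlinarith) (by positivity)]
  have h5 := mul_self_sqrt h0.le
  have h6 : log p * √p ≤ 2 * p := by nlinarith [sqrt_nonneg (p : ℝ)]
  nlinarith

/-- Mertens' first theorem. -/
theorem exists_abs_sum_log_div_sub_log_le : ∃ C : ℝ, 0 < C ∧ ∀ N : ℕ, 1 ≤ N →
    |∑ p ∈ Nat.primesBelow (N + 1), log p / p - log N| ≤ C := by
  obtain ⟨C₁, hC₁, h₁⟩ := exists_sum_log_div_mul_le
  refine ⟨C₁ + 2, by linarith, fun N hN => ?_⟩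
  have hN0 : (0 : ℝ) < N := by exact_mod_cast hN
  have hlN : 0 ≤ log N := log_natCast_nonneg N
  have hup : log (N.factorial : ℕ) ≤ N * log N := by
    have : ((N.factorial : ℕ) : ℝ) ≤ (N : ℝ) ^ N := by exact_mod_cast Nat.factorial_le_pow N
    have h := log_le_log (by exact_mod_cast N.factorial_pos) this
    rwa [log_pow] at h
  have hlow : N * log N - N ≤ log (N.factorial : ℕ) := by
    have h := Stirling.le_log_factorial_stirling (n := N) (by omega)
    have : 0 ≤ log (2 * π) := log_nonneg (by linarith [pi_gt_three])
    linarith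
  have hθ : ∑ p ∈ Nat.primesBelow (N + 1), log p ≤ 2 * N := by
    have h := Chebyshev.theta_le_log4_mul_x (x := N) hN0.le
    rw [Chebyshev.theta, Nat.floor_natCast] at h
    have e : ∑ p ∈ Nat.primesBelow (N + 1), log p
        = ∑ p ∈ Finset.Ioc 0 N with Nat.Prime p, log p := by
      refine Finset.sum_congr ?_ fun _ _ => rfl
      ext p
      rw [Nat.mem_primesBelow, Finset.mem_filter, Finset.mem_Ioc, Nat.lt_succ_iff]
      exact ⟨fun h => ⟨⟨h.2.pos, h.1⟩, h.2⟩, fun h => ⟨h.1.2, h.2⟩⟩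
    rw [e]
    have h4 : log 4 < 2 := by
      rw [show (4 : ℝ) = 2 ^ 2 by norm_num, log_pow]
      have := log_two_lt_d9; push_cast; linarith
    nlinarith
  rw [log_factorial_eq] at hup hlow
  have e1 : N * ∑ p ∈ Nat.primesBelow (N + 1), log p / p - ∑ p ∈ Nat.primesBelow (N + 1), log p
      ≤ ∑ p ∈ Nat.primesBelow (N + 1), (N.factorial.factorization p : ℝ) * log p := by
    rw [Finset.mul_sum, ← Finset.sum_sub_distrib]
    refine Finset.sum_le_sum fun p hp => ?_
    have := mul_le_mul_of_nonneg_right (factorization_factorial_ge hp) (log_natCast_nonneg p)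
    refine le_trans (le_of_eq ?_) this
    ring
  have e2 : ∑ p ∈ Nat.primesBelow (N + 1), (N.factorial.factorization p : ℝ) * log p
      ≤ N * (∑ p ∈ Nat.primesBelow (N + 1), log p / p
        + ∑ p ∈ Nat.primesBelow (N + 1), log p / (p * ((p : ℝ) - 1))) := by
    rw [← Finset.sum_add_distrib, Finset.mul_sum]
    refine Finset.sum_le_sum fun p hp => ?_
    have hpp := Nat.prime_of_mem_primesBelow hp
    refine (mul_le_mul_of_nonneg_right (factorization_factorial_le hpp)
      (log_natCast_nonneg p)).trans (le_of_eq ?_)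
    have h2 : (2 : ℝ) ≤ p := by exact_mod_cast hpp.two_le
    have h3 : (p : ℝ) - 1 ≠ 0 := by linarith
    field_simp; ring
  have h1N := h₁ N
  rw [abs_le]
  constructor
  · have : N * log N - N ≤ N * (∑ p ∈ Nat.primesBelow (N + 1), log p / p + C₁) :=
      hlow.trans (e2.trans (mul_le_mul_of_nonneg_left (by linarith) hN0.le))
    have : N * (log N - 1 - (∑ p ∈ Nat.primesBelow (N + 1), log p / p + C₁)) ≤ 0 := by linarith
    have := nonpos_of_mul_nonpos_right this hN0
    linarith
  · have : N * (∑ p ∈ Nat.primesBelow (N + 1), log p / p - 2 - log N) ≤ 0 := by linarith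
    have := nonpos_of_mul_nonpos_right this hN0
    linarith


/-- The function equal to `log p / p` at primes and zero elsewhere. -/
def primeLog (n : ℕ) : ℝ := if n.Prime then log n / n else 0

theorem primeLog_nonneg (n : ℕ) : 0 ≤ primeLog n := by
  unfold primeLog
  have := log_natCast_nonneg n
  split_ifs <;> positivity

theorem sum_primeLog_eq (N : ℕ) :
    ∑ k ∈ Finset.Icc 0 N, primeLog k = ∑ p ∈ Nat.primesBelow (N + 1), log p / p := by
  unfold primeLog
  rw [← Finset.sum_filter]
  refine Finset.sum_congr ?_ fun _ _ => rfl
  ext p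
  rw [Nat.mem_primesBelow, Finset.mem_filter, Finset.mem_Icc, Nat.lt_succ_iff]
  simp

theorem exists_abs_sum_primeLog_le : ∃ C : ℝ, 0 < C ∧ ∀ z : ℝ, 1 ≤ z →
    |∑ k ∈ Finset.Icc 0 ⌊z⌋₊, primeLog k - log z| ≤ C := by
  obtain ⟨C, hC, h⟩ := exists_abs_sum_log_div_sub_log_le
  refine ⟨C + 1, by linarith, fun z hz => ?_⟩
  have h1 : 1 ≤ ⌊z⌋₊ := Nat.le_floor (by simpa using hz)
  have h2 := h _ h1
  have h3 : (1 : ℝ) ≤ ⌊z⌋₊ := by exact_mod_cast h1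
  have h4 : log z ≤ log 2 + log ⌊z⌋₊ := by
    rw [← log_mul (by norm_num) (by linarith)]
    exact log_le_log (by linarith) (by linarith [Nat.lt_floor_add_one z])
  have h5 : log ⌊z⌋₊ ≤ log z := log_le_log (by linarith) (Nat.floor_le (by linarith))
  have h6 := log_two_lt_d9
  rw [sum_primeLog_eq]
  rw [abs_le] at h2 ⊢
  constructor <;> linarith

theorem sum_Ioc_primeLog (a b : ℕ) (h : a ≤ b) : ∑ k ∈ Finset.Ioc a b, primeLog k =
    ∑ k ∈ Finset.Icc 0 b, primeLog k - ∑ k ∈ Finset.Icc 0 a, primeLog k := by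
  rw [eq_sub_iff_add_eq', ← Finset.sum_union]
  · congr 1; ext k; simp only [Finset.mem_union, Finset.mem_Icc, Finset.mem_Ioc]; omega
  · rw [Finset.disjoint_left]; intro k; simp only [Finset.mem_Icc, Finset.mem_Ioc]; omega

section

variable {C : ℝ} (hC : ∀ z : ℝ, 1 ≤ z → |∑ k ∈ Finset.Icc 0 ⌊z⌋₊, primeLog k - log z| ≤ C)
include hC

theorem sum_Ioc_primeLog_ge {a b : ℝ} (ha : 1 ≤ a) (hab : a ≤ b) :
    log b - log a - 2 * C ≤ ∑ k ∈ Finset.Ioc ⌊a⌋₊ ⌊b⌋₊, primeLog k := by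
  rw [sum_Ioc_primeLog _ _ (Nat.floor_mono hab)]
  have h1 := abs_le.1 (hC a ha)
  have h2 := abs_le.1 (hC b (ha.trans hab))
  linarith

theorem sum_Ioc_primeLog_le {a b : ℝ} (ha : 1 ≤ a) (hab : a ≤ b) :
    ∑ k ∈ Finset.Ioc ⌊a⌋₊ ⌊b⌋₊, primeLog k ≤ log b - log a + 2 * C := by
  rw [sum_Ioc_primeLog _ _ (Nat.floor_mono hab)]
  have h1 := abs_le.1 (hC a ha)
  have h2 := abs_le.1 (hC b (ha.trans hab))
  linarith

theorem sum_one_sub_cos_mul_primeLog_ge {a b τ : ℝ} (ha : 1 ≤ a) (hab : a ≤ b) (hτ : τ ≠ 0) :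
    log b - log a - 2 / |τ| - C * (4 + |τ| * (log b - log a)) ≤
      ∑ k ∈ Finset.Ioc ⌊a⌋₊ ⌊b⌋₊, (1 - cos (τ * log k)) * primeLog k := by
  have hC0 : 0 ≤ C := (abs_nonneg _).trans (hC 1 le_rfl)
  set S : ℝ → ℝ := fun z => ∑ k ∈ Finset.Icc 0 ⌊z⌋₊, primeLog k with hS
  have hpos : ∀ t ∈ Icc a b, 0 < t := fun t ht => by linarith [ht.1]
  have hg : ∀ t : ℝ, 0 < t →
      HasDerivAt (fun t => 1 - cos (τ * log t)) (sin (τ * log t) * (τ / t)) t := by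
    intro t ht
    refine (((hasDerivAt_log ht.ne').const_mul τ).cos.const_sub 1).congr_deriv ?_
    ring
  have hgc : ContinuousOn (fun t : ℝ => sin (τ * log t) * (τ / t)) (Icc a b) := by
    have : ∀ t ∈ Icc a b, t ≠ 0 := fun t ht => (hpos t ht).ne'
    fun_prop (disch := assumption)
  have hge : EqOn (deriv fun t : ℝ => 1 - cos (τ * log t))
      (fun t => sin (τ * log t) * (τ / t)) (Icc a b) := fun t ht => (hg t (hpos t ht)).deriv
  have hgi : IntegrableOn (fun t : ℝ => sin (τ * log t) * (τ / t)) (Icc a b) volume :=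
    hgc.integrableOn_Icc
  have hab' := sum_mul_eq_sub_sub_integral_mul primeLog
    (f := fun t : ℝ => 1 - cos (τ * log t)) (by linarith) hab
    (fun t ht => (hg t (hpos t ht)).differentiableAt)
    (hgi.congr_fun hge.symm measurableSet_Icc)
  have e0 : ∫ t in Ioc a b, deriv (fun t : ℝ => 1 - cos (τ * log t)) t * S t
      = ∫ t in Ioc a b, sin (τ * log t) * (τ / t) * S t :=
    setIntegral_congr_fun measurableSet_Ioc fun t ht => by
      simp only [hge (Ioc_subset_Icc_self ht)]
  rw [hab']
  simp only [hS] at e0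
  rw [e0]
  change _ ≤ (1 - cos (τ * log b)) * S b - (1 - cos (τ * log a)) * S a
    - ∫ t in Ioc a b, sin (τ * log t) * (τ / t) * S t
  have hSm : Measurable S := by
    refine Monotone.measurable fun x y hxy => ?_
    exact Finset.sum_le_sum_of_subset_of_nonneg
      (Finset.Icc_subset_Icc le_rfl (Nat.floor_mono hxy)) fun k _ _ => primeLog_nonneg k
  have hlogc : ContinuousOn (fun t : ℝ => sin (τ * log t) * (τ / t) * log t) (Icc a b) := by
    have : ∀ t ∈ Icc a b, t ≠ 0 := fun t ht => (hpos t ht).ne'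
    exact hgc.mul (continuousOn_log.mono fun t ht => this t ht)
  have hil : IntegrableOn (fun t : ℝ => sin (τ * log t) * (τ / t) * log t) (Ioc a b) volume :=
    hlogc.integrableOn_Icc.mono_set Ioc_subset_Icc_self
  have hinv : IntegrableOn (fun t : ℝ => C * |τ| * t⁻¹) (Ioc a b) volume := by
    have : ContinuousOn (fun t : ℝ => C * |τ| * t⁻¹) (Icc a b) :=
      continuousOn_const.mul (continuousOn_id.inv₀ fun t ht => (hpos t ht).ne')
    exact this.integrableOn_Icc.mono_set Ioc_subset_Icc_self
  have hbd : ∀ t ∈ Ioc a b, ‖sin (τ * log t) * (τ / t) * (S t - log t)‖ ≤ C * |τ| * t⁻¹ := by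
    intro t ht
    have ht0 := hpos t (Ioc_subset_Icc_self ht)
    rw [norm_mul, norm_mul, norm_div]
    simp only [norm_eq_abs]
    rw [abs_of_pos ht0]
    have h1 := abs_sin_le_one (τ * log t)
    have h2 := hC t (by linarith [ht.1])
    calc |sin (τ * log t)| * (|τ| / t) * |S t - log t| ≤ 1 * (|τ| / t) * C :=
          mul_le_mul (mul_le_mul_of_nonneg_right h1 (by positivity)) h2 (abs_nonneg _)
            (by positivity)
      _ = _ := by rw [div_eq_mul_inv]; ring
  have hiR : IntegrableOn (fun t : ℝ => sin (τ * log t) * (τ / t) * (S t - log t))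
      (Ioc a b) volume := by
    refine Integrable.mono' hinv ?_ ((ae_restrict_iff' measurableSet_Ioc).2
      (Filter.Eventually.of_forall hbd))
    refine AEStronglyMeasurable.mul
      (hgc.mono Ioc_subset_Icc_self |>.aestronglyMeasurable measurableSet_Ioc) ?_
    exact (hSm.sub measurable_log).aestronglyMeasurable
  have hsplit : ∫ t in Ioc a b, sin (τ * log t) * (τ / t) * S t
      = (∫ t in Ioc a b, sin (τ * log t) * (τ / t) * log t)
        + ∫ t in Ioc a b, sin (τ * log t) * (τ / t) * (S t - log t) := by
    rw [← integral_add hil hiR]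
    refine setIntegral_congr_fun measurableSet_Ioc fun t _ => ?_
    ring
  have hR : |∫ t in Ioc a b, sin (τ * log t) * (τ / t) * (S t - log t)|
      ≤ C * (|τ| * (log b - log a)) := by
    have h1 := norm_integral_le_of_norm_le hinv ((ae_restrict_iff' measurableSet_Ioc).2
      (Filter.Eventually.of_forall hbd))
    rw [norm_eq_abs] at h1
    refine h1.trans (le_of_eq ?_)
    rw [integral_const_mul, ← intervalIntegral.integral_of_le hab,
      integral_inv_of_pos (by linarith) (by linarith), log_div (by linarith) (by linarith)]
    ring
  have hF : ∫ t in Ioc a b, sin (τ * log t) * (τ / t) * log t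
      = ((1 - cos (τ * log b)) * log b - (log b - sin (τ * log b) / τ))
        - ((1 - cos (τ * log a)) * log a - (log a - sin (τ * log a) / τ)) := by
    rw [← intervalIntegral.integral_of_le hab]
    refine intervalIntegral.integral_eq_sub_of_hasDerivAt
      (f := fun t => (1 - cos (τ * log t)) * log t - (log t - sin (τ * log t) / τ))
      (fun t ht => ?_) ?_
    · rw [uIcc_of_le hab] at ht
      have ht0 := hpos t ht
      have hlg := hasDerivAt_log ht0.ne'
      refine (((hg t ht0).mul hlg).sub
        (hlg.sub ((hlg.const_mul τ).sin.div_const τ))).congr_deriv ?_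
      field_simp; ring
    · rw [intervalIntegrable_iff_integrableOn_Ioc_of_le hab]; exact hil
  rw [hsplit, hF]
  have hτ0 : 0 < |τ| := abs_pos.2 hτ
  have hsb : |sin (τ * log b) / τ| ≤ 1 / |τ| := by
    rw [abs_div]; exact div_le_div_of_nonneg_right (abs_sin_le_one _) hτ0.le
  have hsa : |sin (τ * log a) / τ| ≤ 1 / |τ| := by
    rw [abs_div]; exact div_le_div_of_nonneg_right (abs_sin_le_one _) hτ0.le
  have hcos : ∀ x, 0 ≤ 1 - cos x ∧ 1 - cos x ≤ 2 := fun x =>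
    ⟨by linarith [cos_le_one x], by linarith [neg_one_le_cos x]⟩
  have hb1 : -(2 * C) ≤ (1 - cos (τ * log b)) * (S b - log b) := by
    have h1 := (abs_le.1 (hC b (ha.trans hab))).1
    nlinarith [hcos (τ * log b)]
  have ha1 : (1 - cos (τ * log a)) * (S a - log a) ≤ 2 * C := by
    have h1 := (abs_le.1 (hC a ha)).2
    nlinarith [hcos (τ * log a)]
  have e2 : 2 / |τ| = 1 / |τ| + 1 / |τ| := by ring
  rw [e2]
  have := (abs_le.1 hR).2
  have := (abs_le.1 hsb).2
  have := (abs_le.1 hsa).1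
  linarith

end


theorem le_of_mem_primesBelow_succ {Y p : ℕ} (hp : p ∈ Nat.primesBelow (Y + 1)) :
    (p : ℝ) ≤ Y := by
  exact_mod_cast Nat.lt_succ_iff.1 (Nat.lt_of_mem_primesBelow hp)

theorem two_le_of_mem_primesBelow {Y p : ℕ} (hp : p ∈ Nat.primesBelow Y) : (2 : ℝ) ≤ p := by
  exact_mod_cast (Nat.prime_of_mem_primesBelow hp).two_le

/-- Restriction of a prime sum weighted by `p ^ (-α)` to a top range. -/
theorem rpow_mul_sum_primeLog_le {Y : ℕ} {α θ : ℝ} (hα : α ≤ 1) (hY : 1 ≤ Y)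
    {F : ℕ → ℝ} (hF : ∀ k, 0 ≤ F k) :
    (Y : ℝ) ^ (θ * (1 - α)) * ∑ k ∈ Finset.Ioc ⌊(Y : ℝ) ^ θ⌋₊ Y, F k * primeLog k
      ≤ ∑ p ∈ Nat.primesBelow (Y + 1), F p * (log p * (p : ℝ) ^ (-α)) := by
  have hY0 : (0 : ℝ) < Y := by exact_mod_cast hY
  have e : ∑ k ∈ Finset.Ioc ⌊(Y : ℝ) ^ θ⌋₊ Y, F k * primeLog k
      = ∑ k ∈ Finset.Ioc ⌊(Y : ℝ) ^ θ⌋₊ Y with Nat.Prime k, F k * (log k / k) := by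
    rw [Finset.sum_filter]
    refine Finset.sum_congr rfl fun k _ => ?_
    unfold primeLog
    split_ifs <;> simp
  rw [e, Finset.mul_sum]
  have hsub : (Finset.Ioc ⌊(Y : ℝ) ^ θ⌋₊ Y).filter Nat.Prime ⊆ Nat.primesBelow (Y + 1) := by
    intro p hp
    rw [Finset.mem_filter, Finset.mem_Ioc] at hp
    rw [Nat.mem_primesBelow]
    exact ⟨by omega, hp.2⟩
  refine le_trans (Finset.sum_le_sum fun k hk => ?_)
    (Finset.sum_le_sum_of_subset_of_nonneg hsub fun p _ _ =>
      mul_nonneg (hF p) (mul_nonneg (log_natCast_nonneg p) (by positivity)))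
  rw [Finset.mem_filter, Finset.mem_Ioc] at hk
  have hk0 : (0 : ℝ) < k := by exact_mod_cast hk.2.pos
  have h1 : (Y : ℝ) ^ θ ≤ k := ((Nat.floor_lt (by positivity)).1 hk.1.1).le
  have h2 : (Y : ℝ) ^ (θ * (1 - α)) ≤ (k : ℝ) ^ (1 - α) := by
    rw [rpow_mul hY0.le]
    exact rpow_le_rpow (by positivity) h1 (by linarith)
  have h3 : (k : ℝ) ^ (-α) = (k : ℝ) ^ (1 - α) / k := by
    rw [show -α = (1 - α) - 1 by ring, rpow_sub_one hk0.ne']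
  rw [h3]
  calc _ = F k * (log k / k) * (Y : ℝ) ^ (θ * (1 - α)) := by ring
    _ ≤ F k * (log k / k) * (k : ℝ) ^ (1 - α) :=
      mul_le_mul_of_nonneg_left h2 (mul_nonneg (hF k)
        (div_nonneg (log_natCast_nonneg k) hk0.le))
    _ = _ := by ring

theorem log_ge_of_mem_half {Y k : ℕ} (hY : 1 ≤ Y)
    (hk : k ∈ Finset.Ioc ⌊(Y : ℝ) ^ (1 / 2 : ℝ)⌋₊ Y) : log Y / 2 ≤ log k ∧ log k ≤ log Y := by
  have hY0 : (0 : ℝ) < Y := by exact_mod_cast hY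
  rw [Finset.mem_Ioc] at hk
  have h1 : (Y : ℝ) ^ (1 / 2 : ℝ) ≤ k := ((Nat.floor_lt (by positivity)).1 hk.1).le
  have h2 := log_le_log (by positivity) h1
  rw [log_rpow hY0] at h2
  have h3 : (k : ℝ) ≤ Y := by exact_mod_cast hk.2
  have h4 : (0 : ℝ) < k := lt_of_lt_of_le (by positivity) h1
  exact ⟨by linarith, log_le_log h4 h3⟩

section

variable {C : ℝ} (hC : ∀ z : ℝ, 1 ≤ z → |∑ k ∈ Finset.Icc 0 ⌊z⌋₊, primeLog k - log z| ≤ C)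
include hC

theorem sum_Ioc_rpow_primeLog_ge {Y : ℕ} (hY : 1 ≤ Y) {θ : ℝ} (hθ : 0 ≤ θ) (hθ1 : θ ≤ 1) :
    (1 - θ) * log Y - 2 * C ≤ ∑ k ∈ Finset.Ioc ⌊(Y : ℝ) ^ θ⌋₊ Y, primeLog k := by
  have hY1 : (1 : ℝ) ≤ Y := by exact_mod_cast hY
  have h := sum_Ioc_primeLog_ge hC (a := (Y : ℝ) ^ θ) (b := Y) (one_le_rpow hY1 hθ)
    (rpow_le_self_of_one_le hY1 hθ1)
  rw [Nat.floor_natCast, log_rpow (by linarith)] at h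
  linarith

theorem half_range_ge {Y : ℕ} (hY : 1 ≤ Y) (hW : 8 * C ≤ log Y) :
    log Y / 4 ≤ ∑ k ∈ Finset.Ioc ⌊(Y : ℝ) ^ (1 / 2 : ℝ)⌋₊ Y, primeLog k := by
  have := sum_Ioc_rpow_primeLog_ge hC hY (θ := 1 / 2) (by norm_num) (by norm_num)
  linarith

theorem sum_log_mul_rpow_ge {Y : ℕ} (hY : 1 ≤ Y) (hW : 8 * C ≤ log Y) {α : ℝ} (hα : α ≤ 1) :
    (Y : ℝ) ^ (1 / 2 * (1 - α)) * (log Y / 4)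
      ≤ ∑ p ∈ Nat.primesBelow (Y + 1), log p * (p : ℝ) ^ (-α) := by
  have h := rpow_mul_sum_primeLog_le (θ := 1 / 2) hα hY (F := fun _ => 1) (fun _ => zero_le_one)
  simp only [one_mul] at h
  exact (mul_le_mul_of_nonneg_left (half_range_ge hC hY hW) (by positivity)).trans h

theorem sum_log_sq_mul_rpow_ge {Y : ℕ} (hY : 1 ≤ Y) (hW : 8 * C ≤ log Y) {α : ℝ} (hα : α ≤ 1) :
    (Y : ℝ) ^ (1 / 2 * (1 - α)) * (log Y ^ 2 / 8)
      ≤ ∑ p ∈ Nat.primesBelow (Y + 1), log p ^ 2 * (p : ℝ) ^ (-α) := by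
  have h := rpow_mul_sum_primeLog_le (θ := 1 / 2) hα hY (F := fun k => log k)
    (fun k => log_natCast_nonneg k)
  refine le_trans (mul_le_mul_of_nonneg_left ?_ (by positivity)) (h.trans (le_of_eq ?_))
  · calc log Y ^ 2 / 8 = log Y / 2 * (log Y / 4) := by ring
      _ ≤ log Y / 2 * ∑ k ∈ Finset.Ioc ⌊(Y : ℝ) ^ (1 / 2 : ℝ)⌋₊ Y, primeLog k :=
        mul_le_mul_of_nonneg_left (half_range_ge hC hY hW)
          (by have := log_natCast_nonneg Y; positivity)
      _ ≤ _ := by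
        rw [Finset.mul_sum]
        exact Finset.sum_le_sum fun k hk => mul_le_mul_of_nonneg_right
          (log_ge_of_mem_half hY hk).1 (primeLog_nonneg k)
  · exact Finset.sum_congr rfl fun p _ => by ring

/-- Lower bound for the exponent in the characteristic function estimate. -/
theorem sum_rpow_mul_one_sub_cos_ge {Y : ℕ} (hY : 2 ≤ Y) (hW : 80 * C ≤ log Y)
    {α τ : ℝ} (hα : α ≤ 1) (hτ : π / (8 * log Y) ≤ |τ|) (hτC : |τ| * C ≤ 1 / 100) :
    (Y : ℝ) ^ (1 / 4 * (1 - α)) / 512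
      ≤ ∑ p ∈ Nat.primesBelow (Y + 1), (p : ℝ) ^ (-α) * (1 - cos (τ * log p)) := by
  have hY2 : (2 : ℝ) ≤ Y := by exact_mod_cast hY
  have hlY : 0 < log Y := log_pos (by linarith)
  have hcos : ∀ x, 0 ≤ 1 - cos x := fun x => by linarith [cos_le_one x]
  have hτ0 : 0 < |τ| := lt_of_lt_of_le (by positivity) hτ
  have main : ∀ θ : ℝ, 1 / 4 ≤ θ →
      log Y / 512 ≤ ∑ k ∈ Finset.Ioc ⌊(Y : ℝ) ^ θ⌋₊ Y, (1 - cos (τ * log k)) * primeLog k →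
      (Y : ℝ) ^ (1 / 4 * (1 - α)) / 512
        ≤ ∑ p ∈ Nat.primesBelow (Y + 1), (p : ℝ) ^ (-α) * (1 - cos (τ * log p)) := by
    intro θ hθ h
    have h1 := rpow_mul_sum_primeLog_le (θ := θ) hα (by omega : 1 ≤ Y)
      (F := fun k => (1 - cos (τ * log k)) / log k)
      (fun k => div_nonneg (hcos _) (log_natCast_nonneg k))
    have h2 : (1 : ℝ) / 512 ≤ ∑ k ∈ Finset.Ioc ⌊(Y : ℝ) ^ θ⌋₊ Y,
        (1 - cos (τ * log k)) / log k * primeLog k := by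
      have h3 : (∑ k ∈ Finset.Ioc ⌊(Y : ℝ) ^ θ⌋₊ Y, (1 - cos (τ * log k)) * primeLog k) / log Y
          ≤ ∑ k ∈ Finset.Ioc ⌊(Y : ℝ) ^ θ⌋₊ Y, (1 - cos (τ * log k)) / log k * primeLog k := by
        rw [Finset.sum_div]
        refine Finset.sum_le_sum fun k hk => ?_
        by_cases hp : k.Prime
        · have hk1 : (1 : ℝ) < k := by exact_mod_cast hp.one_lt
          have hkY : (k : ℝ) ≤ Y := by exact_mod_cast (Finset.mem_Ioc.1 hk).2
          rw [div_mul_eq_mul_div]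
          exact div_le_div_of_nonneg_left (mul_nonneg (hcos _) (primeLog_nonneg k))
            (log_pos hk1) (log_le_log (by linarith) hkY)
        · simp [primeLog, hp]
      refine le_trans ?_ h3
      rw [le_div_iff₀ hlY]; linarith
    calc (Y : ℝ) ^ (1 / 4 * (1 - α)) / 512 ≤ (Y : ℝ) ^ (θ * (1 - α)) * (1 / 512) := by
          rw [div_eq_mul_one_div]
          refine mul_le_mul_of_nonneg_right
            (rpow_le_rpow_of_exponent_le (by linarith) ?_) (by norm_num)
          exact mul_le_mul_of_nonneg_right hθ (by linarith)
      _ ≤ _ := mul_le_mul_of_nonneg_left h2 (by positivity)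
      _ ≤ _ := h1
      _ = _ := Finset.sum_congr rfl fun p hp => by
          have : log (p : ℝ) ≠ 0 :=
            (log_pos (by linarith [two_le_of_mem_primesBelow hp])).ne'
          field_simp
  rcases le_or_gt (|τ| * log Y) π with h | h
  · refine main (1 / 2) (by norm_num) ?_
    have h1 : ∀ k ∈ Finset.Ioc ⌊(Y : ℝ) ^ (1 / 2 : ℝ)⌋₊ Y,
        1 / 128 * primeLog k ≤ (1 - cos (τ * log k)) * primeLog k := by
      intro k hk
      refine mul_le_mul_of_nonneg_right ?_ (primeLog_nonneg k)
      obtain ⟨hk1, hk2⟩ := log_ge_of_mem_half (by omega) hk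
      have hk0 : 0 ≤ log k := log_natCast_nonneg k
      have h3 : |τ * log k| ≤ π := by
        rw [abs_mul, abs_of_nonneg hk0]
        exact (mul_le_mul_of_nonneg_left hk2 (abs_nonneg _)).trans h
      have h4 := cos_le_one_sub_mul_cos_sq h3
      have h5 : π / 16 ≤ |τ * log k| := by
        rw [abs_mul, abs_of_nonneg hk0]
        rw [div_le_iff₀ (by positivity)] at hτ
        nlinarith
      have h6 : (π / 16) ^ 2 ≤ (τ * log k) ^ 2 := by
        rw [← sq_abs (τ * log k)]
        exact pow_le_pow_left₀ (by positivity) h5 2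
      have h7 : 2 / π ^ 2 * (π / 16) ^ 2 ≤ 2 / π ^ 2 * (τ * log k) ^ 2 :=
        mul_le_mul_of_nonneg_left h6 (by positivity)
      have h8 : 2 / π ^ 2 * (π / 16) ^ 2 = 1 / 128 := by field_simp; norm_num
      linarith
    refine le_trans ?_ (Finset.sum_le_sum h1)
    rw [← Finset.mul_sum]
    have := half_range_ge hC (by omega : 1 ≤ Y) (by linarith)
    linarith
  · refine main (1 / 4) le_rfl ?_
    have hY1 : (1 : ℝ) ≤ Y := by linarith
    have h1 := sum_one_sub_cos_mul_primeLog_ge hC (a := (Y : ℝ) ^ (1 / 4 : ℝ)) (b := Y) (τ := τ)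
      (one_le_rpow hY1 (by norm_num)) (rpow_le_self_of_one_le hY1 (by norm_num)) (abs_pos.1 hτ0)
    rw [Nat.floor_natCast, log_rpow (by linarith)] at h1
    refine le_trans ?_ h1
    have h2 : 2 / |τ| ≤ 0.64 * log Y := by
      rw [div_le_iff₀ hτ0]
      nlinarith [pi_gt_d2]
    have h3 : |τ| * C * log Y ≤ 1 / 100 * log Y := mul_le_mul_of_nonneg_right hτC hlY.le
    nlinarith

end


theorem sum_log_mul_rpow_le {Y : ℕ} {α L : ℝ} (hα : 0 < α)
    (h : ∑ p ∈ Nat.primesBelow (Y + 1), log p / ((p : ℝ) ^ α - 1) = L) :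
    ∑ p ∈ Nat.primesBelow (Y + 1), log p * (p : ℝ) ^ (-α) ≤ L := by
  rw [← h]
  refine Finset.sum_le_sum fun p hp => ?_
  have hpp := Nat.prime_of_mem_primesBelow hp
  rw [← mul_one_div, ← rpow_neg_div_one_sub hpp α]
  have h0 := rpow_neg_pos_of_prime hpp α
  have h1 := rpow_neg_lt_one_of_prime hpp hα
  refine mul_le_mul_of_nonneg_left ?_ (log_natCast_nonneg p)
  rw [le_div_iff₀ (by linarith)]
  nlinarith

theorem mul_sum_log_div_le {Y : ℕ} {α L : ℝ} (hα : 0 < α)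
    (h : ∑ p ∈ Nat.primesBelow (Y + 1), log p / ((p : ℝ) ^ α - 1) = L) : α * L ≤ Y := by
  rw [← h, Finset.mul_sum]
  calc _ ≤ ∑ p ∈ Nat.primesBelow (Y + 1), (1 : ℝ) := by
        refine Finset.sum_le_sum fun p hp => ?_
        have hpp := Nat.prime_of_mem_primesBelow hp
        have hp0 : (0 : ℝ) < p := by exact_mod_cast hpp.pos
        have hl : 0 < log p := log_pos (by exact_mod_cast hpp.one_lt)
        have := add_one_le_exp (log p * α)
        have h2 : 0 < log p * α := by positivity
        rw [rpow_def_of_pos hp0, mul_div_assoc', div_le_one (by linarith)]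
        linarith
    _ ≤ Y := by
        rw [Finset.sum_const, nsmul_eq_mul, mul_one]
        have : (Nat.primesBelow (Y + 1)) ⊆ Finset.Icc 1 Y := by
          intro p hp
          rw [Finset.mem_Icc]
          exact ⟨(Nat.prime_of_mem_primesBelow hp).pos,
            Nat.lt_succ_iff.1 (Nat.lt_of_mem_primesBelow hp)⟩
        have := Finset.card_le_card this
        rw [Nat.card_Icc] at this
        exact_mod_cast (by omega : (Nat.primesBelow (Y + 1)).card ≤ Y)

theorem sum_Icc_rpow_neg_half_le (Y : ℕ) :
    ∑ n ∈ Finset.Icc 1 Y, (n : ℝ) ^ (-(1 / 2) : ℝ) ≤ 2 * (Y : ℝ) ^ (1 / 2 : ℝ) := by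
  induction Y with
  | zero => simp
  | succ n ih =>
    rw [Finset.sum_Icc_succ_top (by omega)]
    rw [← sqrt_eq_rpow] at ih ⊢
    rw [rpow_neg (by positivity), ← sqrt_eq_rpow]
    have h1 : 0 < √((n + 1 : ℕ) : ℝ) := sqrt_pos.2 (by positivity)
    have h2 : √((n + 1 : ℕ) : ℝ) ^ 2 = n + 1 := by
      rw [sq_sqrt (by positivity)]; push_cast; ring
    have h3 : √(n : ℝ) ^ 2 = n := sq_sqrt (by positivity)
    have h4 : (√((n + 1 : ℕ) : ℝ))⁻¹ * √((n + 1 : ℕ) : ℝ) = 1 := inv_mul_cancel₀ h1.ne'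
    set a := √((n + 1 : ℕ) : ℝ)
    set b := √(n : ℝ)
    have hb : 0 ≤ b := sqrt_nonneg _
    have : a⁻¹ ≤ 2 * (a - b) := by
      rw [inv_le_iff_one_le_mul₀ h1]
      nlinarith [sq_nonneg (a - b)]
    linarith

theorem exp_neg_half_mul_log_le_sum {Y : ℕ} (hY : 1 ≤ Y) {α κ : ℝ} (hα : α ≤ 1) (hκ : 0 ≤ κ)
    (h : κ * log Y ≤ 1 / 2) :
    exp (-(1 / 2)) * log Y ≤ ∑ n ∈ Finset.Icc 1 Y, (n : ℝ) ^ (-(α + κ)) := by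
  have h1 := log_add_one_le_harmonic Y
  have hlog : log Y ≤ log ((Y + 1 : ℕ) : ℝ) := by
    refine log_le_log (by exact_mod_cast hY) (by push_cast; linarith)
  rw [harmonic_eq_sum_Icc] at h1
  push_cast at h1 hlog
  refine (mul_le_mul_of_nonneg_left (hlog.trans h1) (exp_nonneg _)).trans ?_
  rw [Finset.mul_sum]
  refine Finset.sum_le_sum fun n hn => ?_
  rw [Finset.mem_Icc] at hn
  have hn1 : (1 : ℝ) ≤ n := by exact_mod_cast hn.1
  have hn0 : (0 : ℝ) < n := by linarith
  have hnY : log n ≤ log Y := log_le_log hn0 (by exact_mod_cast hn.2)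
  have hl := log_natCast_nonneg n
  rw [rpow_def_of_pos hn0, ← exp_log hn0, log_exp, ← exp_neg, ← exp_add]
  refine exp_le_exp.2 ?_
  nlinarith [mul_le_mul_of_nonneg_left hnY hκ, mul_nonneg hl (sub_nonneg.2 hα)]

theorem log_div_sub_one_eq {p : ℕ} (hp : p.Prime) :
    log p / ((p : ℝ) - 1) = log p / p + log p / (p * ((p : ℝ) - 1)) := by
  have h1 : (1 : ℝ) < p := by exact_mod_cast hp.one_lt
  have h2 : (p : ℝ) - 1 ≠ 0 := by linarith
  field_simp
  ring

section

variable {C C₁ : ℝ} (hC : ∀ z : ℝ, 1 ≤ z → |∑ k ∈ Finset.Icc 0 ⌊z⌋₊, primeLog k - log z| ≤ C)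
include hC

theorem sum_log_div_le {Y : ℕ} (hY : 1 ≤ Y) :
    ∑ p ∈ Nat.primesBelow (Y + 1), log p / p ≤ log Y + C := by
  have := (abs_le.1 (hC Y (by exact_mod_cast hY))).2
  rw [Nat.floor_natCast, sum_primeLog_eq] at this
  linarith

theorem sub_one_mul_log_le {Y : ℕ} (hY : 1 ≤ Y) {α L : ℝ} (hα : 1 ≤ α)
    (hC₁ : ∑ p ∈ Nat.primesBelow (Y + 1), log p / (p * ((p : ℝ) - 1)) ≤ C₁)
    (h : ∑ p ∈ Nat.primesBelow (Y + 1), log p / ((p : ℝ) ^ α - 1) = L)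
    (hL : log Y ≤ L) (hW : 4 * C₁ + 8 * C < log Y) : (α - 1) * log Y ≤ 2 := by
  have hY1 : (1 : ℝ) ≤ Y := by exact_mod_cast hY
  have hY0 : (0 : ℝ) < Y := by linarith
  have hC0 : 0 ≤ C := (abs_nonneg _).trans (hC 1 le_rfl)
  have hsq : (1 : ℝ) ≤ (Y : ℝ) ^ (1 / 2 : ℝ) := one_le_rpow hY1 (by norm_num)
  have hsqY : (Y : ℝ) ^ (1 / 2 : ℝ) ≤ Y := rpow_le_self_of_one_le hY1 (by norm_num)
  set e := (Y : ℝ) ^ (1 / 2 * (1 - α)) with he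
  have he0 : 0 < e := by positivity
  have hbound : L ≤ C₁ + ∑ p ∈ Nat.primesBelow (Y + 1), log p / p * (p : ℝ) ^ (1 - α) := by
    rw [← h]
    refine le_trans ?_ (add_le_add_left hC₁ _)
    rw [← Finset.sum_add_distrib]
    refine Finset.sum_le_sum fun p hp => ?_
    have hpp := Nat.prime_of_mem_primesBelow hp
    have h1 : (1 : ℝ) < p := by exact_mod_cast hpp.one_lt
    have h0 : (0 : ℝ) < p := by linarith
    have hl : 0 ≤ log p := log_natCast_nonneg p
    have hκ : (1 : ℝ) ≤ (p : ℝ) ^ (α - 1) := one_le_rpow h1.le (by linarith)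
    have hκ' : (p : ℝ) ^ (1 - α) ≤ 1 := rpow_le_one_of_one_le_of_nonpos h1.le (by linarith)
    have e1 : (p : ℝ) ^ α = (p : ℝ) ^ (α - 1) * p := by rw [← rpow_add_one h0.ne']; ring_nf
    have e2 : (p : ℝ) ^ (1 - α) * (p : ℝ) ^ (α - 1) = 1 := by rw [← rpow_add h0]; simp
    have h3 : (p : ℝ) ^ (α - 1) * (p - 1) ≤ (p : ℝ) ^ α - 1 := by rw [e1]; linarith
    have h4 : 0 < (p : ℝ) ^ (α - 1) * ((p : ℝ) - 1) := by
      apply mul_pos <;> linarith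
    calc log p / ((p : ℝ) ^ α - 1) ≤ log p / ((p : ℝ) ^ (α - 1) * (p - 1)) :=
          div_le_div_of_nonneg_left hl h4 h3
      _ = (p : ℝ) ^ (1 - α) * (log p / (p - 1)) := by
          rw [mul_comm ((p : ℝ) ^ (α - 1)), ← div_div, eq_comm, eq_div_iff (by positivity)]
          linear_combination (log p / ((p : ℝ) - 1)) * e2
      _ = log p / (p * (p - 1)) * (p : ℝ) ^ (1 - α) + log p / p * (p : ℝ) ^ (1 - α) := by
          rw [log_div_sub_one_eq hpp]; ring
      _ ≤ _ := by
          gcongr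
          refine mul_le_of_le_one_right (div_nonneg hl ?_) hκ'
          apply mul_nonneg <;> linarith
  have hsplit : ∑ p ∈ Nat.primesBelow (Y + 1), log p / p * (p : ℝ) ^ (1 - α)
      = ∑ k ∈ Finset.Icc 0 ⌊(Y : ℝ) ^ (1 / 2 : ℝ)⌋₊, primeLog k * (k : ℝ) ^ (1 - α)
        + ∑ k ∈ Finset.Ioc ⌊(Y : ℝ) ^ (1 / 2 : ℝ)⌋₊ Y, primeLog k * (k : ℝ) ^ (1 - α) := by
    have hfl : ⌊(Y : ℝ) ^ (1 / 2 : ℝ)⌋₊ ≤ Y := Nat.floor_le_of_le hsqY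
    rw [← Finset.sum_union]
    · have : Finset.Icc 0 ⌊(Y : ℝ) ^ (1 / 2 : ℝ)⌋₊ ∪ Finset.Ioc ⌊(Y : ℝ) ^ (1 / 2 : ℝ)⌋₊ Y
          = Finset.range (Y + 1) := by
        ext k
        simp only [Finset.mem_union, Finset.mem_Icc, Finset.mem_Ioc, Finset.mem_range]
        omega
      rw [this, Nat.primesBelow, Finset.sum_filter]
      refine Finset.sum_congr rfl fun k _ => ?_
      unfold primeLog
      split_ifs <;> simp
    · rw [Finset.disjoint_left]
      intro k
      simp only [Finset.mem_Icc, Finset.mem_Ioc]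
      omega
  have hlow : ∑ k ∈ Finset.Icc 0 ⌊(Y : ℝ) ^ (1 / 2 : ℝ)⌋₊, primeLog k * (k : ℝ) ^ (1 - α)
      ≤ log Y / 2 + C := by
    have := (abs_le.1 (hC _ hsq)).2
    rw [log_rpow hY0] at this
    refine le_trans (Finset.sum_le_sum (g := primeLog) fun k _ => ?_) (by linarith)
    rcases Nat.eq_zero_or_pos k with rfl | hk
    · simp [primeLog]
    · exact mul_le_of_le_one_right (primeLog_nonneg k)
        (rpow_le_one_of_one_le_of_nonpos (by exact_mod_cast hk) (by linarith))
  have hhigh : ∑ k ∈ Finset.Ioc ⌊(Y : ℝ) ^ (1 / 2 : ℝ)⌋₊ Y, primeLog k * (k : ℝ) ^ (1 - α)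
      ≤ (log Y / 2 + 2 * C) * e := by
    have := sum_Ioc_primeLog_le hC hsq hsqY
    rw [log_rpow hY0, Nat.floor_natCast] at this
    refine le_trans ?_ (mul_le_mul_of_nonneg_right (this.trans (by linarith)) he0.le)
    rw [Finset.sum_mul]
    refine Finset.sum_le_sum fun k hk => mul_le_mul_of_nonneg_left ?_ (primeLog_nonneg k)
    have hk' := (Finset.mem_Ioc.1 hk).1
    have h1 : (Y : ℝ) ^ (1 / 2 : ℝ) ≤ k := ((Nat.floor_lt (by positivity)).1 hk').le
    rw [he, rpow_mul hY0.le]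
    exact rpow_le_rpow_of_nonpos (by positivity) h1 (by linarith)
  by_contra hcon
  push Not at hcon
  have he2 : e ≤ 1 / 2 := by
    rw [he, rpow_def_of_pos hY0]
    have h1 : log Y * (1 / 2 * (1 - α)) ≤ -1 := by nlinarith
    refine (exp_le_exp.2 h1).trans ?_
    rw [exp_neg, one_div]
    refine inv_anti₀ (by norm_num) ?_
    linarith [add_one_le_exp (1 : ℝ)]
  have hlogY := log_natCast_nonneg Y
  have : (log Y / 2 + 2 * C) * e ≤ (log Y / 2 + 2 * C) * (1 / 2) :=
    mul_le_mul_of_nonneg_left he2 (by linarith)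
  linarith

theorem sum_log_div_le_of_one_le {Y : ℕ} (hY : 1 ≤ Y) {α L : ℝ} (hα : 1 ≤ α)
    (hC₁ : ∑ p ∈ Nat.primesBelow (Y + 1), log p / (p * ((p : ℝ) - 1)) ≤ C₁)
    (h : ∑ p ∈ Nat.primesBelow (Y + 1), log p / ((p : ℝ) ^ α - 1) = L) :
    L ≤ log Y + C + C₁ := by
  have h1 := sum_log_div_le hC hY
  rw [← h]
  refine le_trans ?_ (add_le_add h1 hC₁)
  rw [← Finset.sum_add_distrib]
  refine Finset.sum_le_sum fun p hp => ?_
  have hpp := Nat.prime_of_mem_primesBelow hp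
  have h1 : (1 : ℝ) < p := by exact_mod_cast hpp.one_lt
  rw [← log_div_sub_one_eq hpp]
  refine div_le_div_of_nonneg_left (log_natCast_nonneg p) (by linarith) ?_
  have := rpow_le_rpow_of_exponent_le h1.le hα
  rw [rpow_one] at this
  linarith

theorem le_four_mul_rpow_mul {Y : ℕ} (hY : 2 ≤ Y) {α L : ℝ} (hα : 0 < α) (hα1 : α ≤ 1)
    (hαY : 1 ≤ α * log Y)
    (h : ∑ p ∈ Nat.primesBelow (Y + 1), log p / ((p : ℝ) ^ α - 1) = L) :
    L ≤ 4 * (Y : ℝ) ^ (1 - α) * (log Y + C) := by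
  have hY1 : (1 : ℝ) ≤ Y := by exact_mod_cast (by omega : 1 ≤ Y)
  have hY0 : (0 : ℝ) < Y := by linarith
  have hC0 : 0 ≤ C := (abs_nonneg _).trans (hC 1 le_rfl)
  have hW := log_natCast_nonneg Y
  set T := (Y : ℝ) ^ (1 - α) with hT
  have hT0 : 0 < T := by positivity
  have hinv : 1 / α ≤ log Y := by rw [div_le_iff₀ hα]; linarith
  have hpT : ∀ p ∈ Nat.primesBelow (Y + 1), (p : ℝ) ^ (-α) ≤ T / p := by
    intro p hp
    have hpp := Nat.prime_of_mem_primesBelow hp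
    have h0 : (0 : ℝ) < p := by exact_mod_cast hpp.pos
    rw [show -α = (1 - α) - 1 by ring, rpow_sub_one h0.ne']
    gcongr
    exact rpow_le_rpow h0.le (le_of_mem_primesBelow_succ hp) (by linarith)
  have hmain : L ≤ ∑ p ∈ Nat.primesBelow (Y + 1), (p : ℝ) ^ (-α) * (log p + 1 / α) := by
    rw [← h]
    refine Finset.sum_le_sum fun p hp => ?_
    have hpp := Nat.prime_of_mem_primesBelow hp
    rw [← mul_one_div, ← rpow_neg_div_one_sub hpp α]
    calc _ = (p : ℝ) ^ (-α) * (log p / (1 - (p : ℝ) ^ (-α))) := by ring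
      _ ≤ _ := mul_le_mul_of_nonneg_left (log_div_le hpp hα) (rpow_neg_pos_of_prime hpp α).le
  have hM := sum_log_div_le hC (by omega : 1 ≤ Y)
  rcases le_or_gt (1 / 2) α with h2 | h2
  · have h3 : 1 / α ≤ 2 := by rw [div_le_iff₀ hα]; linarith
    calc L ≤ _ := hmain
      _ ≤ ∑ p ∈ Nat.primesBelow (Y + 1), (4 * T) * (log p / p) := by
        refine Finset.sum_le_sum fun p hp => ?_
        have hpp := Nat.prime_of_mem_primesBelow hp
        have h0 : (0 : ℝ) < p := by exact_mod_cast hpp.pos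
        have hl2 : log 2 ≤ log p := log_le_log (by norm_num) (two_le_of_mem_primesBelow hp)
        have := log_two_gt_d9
        calc _ ≤ T / p * (4 * log p) := by
              refine mul_le_mul (hpT p hp) (by linarith) ?_ (by positivity)
              have : 0 < 1 / α := by positivity
              linarith
          _ = _ := by ring
      _ = 4 * T * ∑ p ∈ Nat.primesBelow (Y + 1), log p / p := by rw [Finset.mul_sum]
      _ ≤ _ := mul_le_mul_of_nonneg_left hM (by positivity)
  · have hA : ∑ p ∈ Nat.primesBelow (Y + 1), (p : ℝ) ^ (-α) * log p ≤ T * (log Y + C) := by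
      refine le_trans ?_ (mul_le_mul_of_nonneg_left hM hT0.le)
      rw [Finset.mul_sum]
      refine Finset.sum_le_sum fun p hp => ?_
      refine (mul_le_mul_of_nonneg_right (hpT p hp) (log_natCast_nonneg p)).trans_eq ?_
      ring
    have hB : ∑ p ∈ Nat.primesBelow (Y + 1), (p : ℝ) ^ (-α) ≤ 2 * T := by
      have hsub : Nat.primesBelow (Y + 1) ⊆ Finset.Icc 1 Y := by
        intro p hp
        rw [Finset.mem_Icc]
        exact ⟨(Nat.prime_of_mem_primesBelow hp).pos,
          Nat.lt_succ_iff.1 (Nat.lt_of_mem_primesBelow hp)⟩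
      refine (Finset.sum_le_sum_of_subset_of_nonneg hsub fun n _ _ => by positivity).trans ?_
      have e : T = (Y : ℝ) ^ (1 / 2 - α) * (Y : ℝ) ^ (1 / 2 : ℝ) := by
        rw [← rpow_add hY0, hT]; ring_nf
      have := mul_le_mul_of_nonneg_left (sum_Icc_rpow_neg_half_le Y)
        (by positivity : 0 ≤ (Y : ℝ) ^ (1 / 2 - α))
      refine le_trans ?_ (this.trans_eq (by rw [e]; ring))
      rw [Finset.mul_sum]
      refine Finset.sum_le_sum fun n hn => ?_
      rw [Finset.mem_Icc] at hn
      have hn0 : (0 : ℝ) < n := by exact_mod_cast hn.1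
      rw [show -α = (1 / 2 - α) + (-(1 / 2)) by ring, rpow_add hn0]
      refine mul_le_mul_of_nonneg_right ?_ (by positivity)
      exact rpow_le_rpow hn0.le (by exact_mod_cast hn.2) (by linarith)
    have hB' : (∑ p ∈ Nat.primesBelow (Y + 1), (p : ℝ) ^ (-α)) * (1 / α) ≤ 2 * T * log Y := by
      refine mul_le_mul hB hinv (by positivity) (by positivity)
    have : L ≤ T * (log Y + C) + 2 * T * log Y := by
      refine hmain.trans (le_trans (le_of_eq ?_) (add_le_add hA hB'))
      rw [Finset.sum_mul, ← Finset.sum_add_distrib]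
      refine Finset.sum_congr rfl fun p _ => by ring
    nlinarith [mul_nonneg hT0.le hW, mul_nonneg hT0.le hC0]

end

theorem sum_log_le_log_of_dvd {s : Finset ℕ} {n : ℕ} (hn : n ≠ 0)
    (hs : ∀ p ∈ s, p.Prime) (hd : ∀ p ∈ s, p ∣ n) : ∑ p ∈ s, log p ≤ log n := by
  have h := Finset.prod_primes_dvd n (fun p hp => (hs p hp).prime) hd
  have h1 : ∏ p ∈ s, p ≤ n := Nat.le_of_dvd (Nat.pos_of_ne_zero hn) h
  rw [← log_prod fun p hp => by exact_mod_cast (hs p hp).ne_zero]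
  refine log_le_log (Finset.prod_pos fun p hp => by exact_mod_cast (hs p hp).pos) ?_
  rw [← Nat.cast_prod]
  exact_mod_cast h1

theorem sum_log_mul_Psi_le (Y : ℕ) {z : ℝ} (hz : 1 ≤ z) {s : Finset ℕ}
    (hs : ∀ p ∈ s, p.Prime) (hY : ∀ p ∈ s, p ≤ Y) :
    ∑ p ∈ s, log p * (Psi (z / p) Y : ℝ) ≤ log z * Psi z Y := by
  have hz0 : 0 < z := by linarith
  set A := (Finset.Icc 1 ⌊z⌋₊).filter fun n => n ∈ Nat.smoothNumbers (Y + 1) with hA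
  have hPsi : Psi z Y = A.card := by
    rw [Psi_eq_card (Nat.cast_nonneg _), Nat.floor_natCast]
  have hcard : ∀ p ∈ s, Psi (z / p) Y ≤ (A.filter fun n => p ∣ n).card := by
    intro p hp
    have hp0 : 0 < p := (hs p hp).pos
    have hp0' : (0 : ℝ) < p := by exact_mod_cast hp0
    rw [Psi_eq_card (Nat.cast_nonneg _), Nat.floor_natCast]
    refine Finset.card_le_card_of_injOn (fun m => p * m) ?_ ?_
    · intro m hm
      simp only [Finset.coe_filter, Finset.mem_Icc, mem_ofPred_eq, hA, Finset.mem_filter] at hm ⊢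
      refine ⟨⟨⟨Nat.mul_pos hp0 hm.1.1, ?_⟩, ?_⟩, dvd_mul_right _ _⟩
      · have h1 : (m : ℝ) ≤ z / p := (Nat.le_floor_iff (by positivity)).1 hm.1.2
        rw [le_div_iff₀ hp0'] at h1
        refine Nat.le_floor ?_
        push_cast; linarith
      · exact Nat.mul_mem_smoothNumbers
          (Nat.mem_smoothNumbers_of_lt hp0 (Nat.lt_succ_of_le (hY p hp))) hm.2
    · intro a _ b _ hab
      exact Nat.eq_of_mul_eq_mul_left hp0 hab
  calc _ ≤ ∑ p ∈ s, ∑ n ∈ A with p ∣ n, log p := by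
        refine Finset.sum_le_sum fun p hp => ?_
        rw [Finset.sum_const, nsmul_eq_mul, mul_comm]
        exact mul_le_mul_of_nonneg_right (by exact_mod_cast hcard p hp) (log_natCast_nonneg p)
    _ = ∑ n ∈ A, ∑ p ∈ s with p ∣ n, log p := by
        refine Finset.sum_comm' fun p n => ?_
        simp only [Finset.mem_filter]; tauto
    _ ≤ ∑ n ∈ A, log z := by
        refine Finset.sum_le_sum fun n hn => ?_
        simp only [hA, Finset.mem_filter, Finset.mem_Icc] at hn
        refine (sum_log_le_log_of_dvd (by omega) (fun p hp => hs p (Finset.mem_filter.1 hp).1)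
          fun p hp => (Finset.mem_filter.1 hp).2).trans ?_
        exact log_le_log (by exact_mod_cast hn.1.1) ((Nat.le_floor_iff hz0.le).1 hn.1.2)
    _ = _ := by rw [Finset.sum_const, nsmul_eq_mul, hPsi, mul_comm]

theorem half_le_Psi {Y : ℕ} {z : ℝ} (hz : 1 ≤ z) (hzY : z ≤ Y) : 1 / 2 * z ≤ Psi z Y := by
  rw [Psi_eq_floor (Nat.cast_nonneg _) hzY]
  have h1 := Nat.lt_floor_add_one z
  have h2 : (1 : ℝ) ≤ ⌊z⌋₊ := by exact_mod_cast Nat.le_floor (by exact_mod_cast hz)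
  linarith

/-- For bounded `log z / log Y` a positive proportion of the integers up to `z` is `Y`-smooth. -/
theorem exists_mul_le_Psi {C : ℝ}
    (hC : ∀ z : ℝ, 1 ≤ z → |∑ k ∈ Finset.Icc 0 ⌊z⌋₊, primeLog k - log z| ≤ C) (k : ℕ) :
    ∃ c > 0, ∀ Y : ℕ, 2 ≤ Y → 8 * C ≤ log Y → ∀ z : ℝ, 1 ≤ z → log z ≤ (k + 2) / 2 * log Y →
      c * z ≤ Psi z Y := by
  induction k with
  | zero =>
    refine ⟨1 / 2, by norm_num, fun Y hY _ z hz hzY => half_le_Psi hz ?_⟩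
    have hY0 : (0 : ℝ) < Y := by exact_mod_cast (by omega : 0 < Y)
    refine (log_le_log_iff (by linarith) hY0).1 (hzY.trans_eq ?_)
    norm_num
  | succ k ih =>
    obtain ⟨c, hc, ih⟩ := ih
    set c' := c / (2 * (k + 3)) with hc'
    have hc'0 : 0 < c' := by positivity
    refine ⟨min (1 / 2) c', lt_min (by norm_num) hc'0, fun Y hY hW z hz hzY => ?_⟩
    have hz0 : 0 < z := by linarith
    rcases le_or_gt z Y with h | h
    · exact (mul_le_mul_of_nonneg_right (min_le_left _ _) hz0.le).trans (half_le_Psi hz h)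
    refine (mul_le_mul_of_nonneg_right (min_le_right _ _) hz0.le).trans ?_
    have hY1 : (1 : ℝ) < Y := by exact_mod_cast (by omega : 1 < Y)
    have hlog : 0 < log Y := log_pos hY1
    set s := (Finset.Ioc ⌊(Y : ℝ) ^ (1 / 2 : ℝ)⌋₊ Y).filter Nat.Prime with hs
    have h1 := sum_log_mul_Psi_le Y hz (s := s) (fun p hp => (Finset.mem_filter.1 hp).2)
      (fun p hp => (Finset.mem_Ioc.1 (Finset.mem_filter.1 hp).1).2)
    have h2 : c * z * (log Y / 4) ≤ ∑ p ∈ s, log p * (Psi (z / p) Y : ℝ) := by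
      refine (mul_le_mul_of_nonneg_left (half_range_ge hC (by omega) hW)
        (by positivity)).trans ?_
      have e : ∑ k ∈ Finset.Ioc ⌊(Y : ℝ) ^ (1 / 2 : ℝ)⌋₊ Y, primeLog k = ∑ p ∈ s, log p / p := by
        rw [hs, Finset.sum_filter]
        refine Finset.sum_congr rfl fun k _ => rfl
      rw [e, Finset.mul_sum]
      refine Finset.sum_le_sum fun p hp => ?_
      rw [hs, Finset.mem_filter] at hp
      have hpY := log_ge_of_mem_half (by omega) hp.1
      have hp0 : (0 : ℝ) < p := by exact_mod_cast hp.2.pos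
      have hpY' : (p : ℝ) ≤ Y := by exact_mod_cast (Finset.mem_Ioc.1 hp.1).2
      have := ih Y hY hW (z / p) (by rw [le_div_iff₀ hp0]; linarith) (by
        rw [log_div hz0.ne' hp0.ne']
        push_cast at hzY
        linarith [hpY.1])
      calc _ = log p * (c * (z / p)) := by ring
        _ ≤ _ := mul_le_mul_of_nonneg_left this (log_natCast_nonneg p)
    have h3 : log z * (Psi z Y : ℝ) ≤ (k + 3) / 2 * log Y * Psi z Y := by
      refine mul_le_mul_of_nonneg_right (hzY.trans_eq ?_) (Nat.cast_nonneg _)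
      push_cast; ring
    have h4 : log Y * (c * z / 4) ≤ log Y * ((k + 3) / 2 * (Psi z Y : ℝ)) := by nlinarith
    have h5 := le_of_mul_le_mul_left h4 hlog
    rw [hc', div_mul_eq_mul_div, div_le_iff₀ (by positivity)]
    linarith


theorem exists_pow_mul_exp_neg_le (n : ℕ) {c δ : ℝ} (hc : 0 < c) (hδ : 0 < δ) :
    ∃ R, ∀ r ≥ R, r ^ n * exp (-(c * r)) ≤ δ := by
  have h := tendsto_rpow_mul_exp_neg_mul_atTop_nhds_zero n c hc
  obtain ⟨R, hR⟩ := Filter.eventually_atTop.1 (h.eventually (Iic_mem_nhds hδ))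
  refine ⟨R, fun r hr => ?_⟩
  have := hR r hr
  rwa [rpow_natCast, neg_mul] at this

theorem SizeBiased.smoothed_eq_zero {μ q : Measure ℝ} {L : ℝ} (h : SizeBiased μ q L) (α : ℝ)
    {r : ℝ} (hr : r < 0) : smoothed α q r = 0 := by
  refine integral_eq_zero_of_ae ?_
  filter_upwards [h.pos] with s hs
  exact if_neg (by linarith)

theorem SizeBiased.smoothed_conv_le_mul_measure {μ q : Measure ℝ} [IsFiniteMeasure μ]
    [IsProbabilityMeasure q] {L : ℝ} (h : SizeBiased μ q L) {α S : ℝ} (hα : 0 ≤ α)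
    (hS : ∀ t, smoothed α q t ≤ S) (t : ℝ) :
    smoothed α (μ ∗ q) t ≤ S * μ.real (Iic t) := by
  have e : smoothed α (μ ∗ q) t = ∫ s, smoothed α q (t - s) ∂μ := by
    rw [smoothed, integral_conv (integrable_expKer hα _ t)]
    congr 1; ext v
    simp only [smoothed]
    congr 1; ext s
    congr 1; ring
  rw [e, ← integral_indicator_one measurableSet_Iic, ← integral_const_mul]
  refine integral_mono_of_nonneg (Filter.Eventually.of_forall fun s => smoothed_nonneg _ _ _)
    (((integrable_const 1).indicator measurableSet_Iic).const_mul _)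
    (Filter.Eventually.of_forall fun s => ?_)
  by_cases hs : s ≤ t
  · simpa [indicator_of_mem (show s ∈ Iic t from hs)] using hS (t - s)
  · simp [indicator_of_notMem (show s ∉ Iic t from hs), h.smoothed_eq_zero α (by linarith : t - s < 0)]

/-- The regime where every prime `p ≤ Y` satisfies `α * log p ≤ 1`. -/
theorem exists_smoothed_le_of_mul_log_le_one :
    ∃ K > 0, ∃ C > 0, ∀ (Y : ℕ) (α L : ℝ), 1 ≤ Y → 0 < α → 0 < L →
      ∑ p ∈ Nat.primesBelow (Y + 1), log p / ((p : ℝ) ^ α - 1) = L →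
      α * log Y ≤ 1 → K ≤ α * L →
      ∀ t, smoothed α (smoothMeasure Y α) t ≤ C * smoothed α (smoothMeasure Y α) L := by
  obtain ⟨δ, hδ, C, hC, core⟩ := exists_smoothed_le_smoothed (ε := 1 / 4) (by norm_num) (by norm_num)
  refine ⟨256 + 1 / δ + 4 / δ ^ 2, by positivity, C, hC, fun Y α L hY hα hL h hαY hK => ?_⟩
  have := isFiniteMeasure_smoothMeasure Y hα
  have := isProbabilityMeasure_primeMeasure hα hL h
  have hsb : SizeBiased (smoothMeasure Y α) (primeMeasure Y α L) L := sizeBiased_smooth hL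
  have hd1 : 0 < 1 / δ := by positivity
  have hd2 : 0 < 4 / δ ^ 2 := by positivity
  have hM : ∀ p ∈ Nat.primesBelow (Y + 1), log p / (1 - (p : ℝ) ^ (-α)) ≤ 2 / α := by
    intro p hp
    have hpp := Nat.prime_of_mem_primesBelow hp
    refine (log_div_le hpp hα).trans ?_
    have h1 : log p ≤ log Y :=
      log_le_log (by exact_mod_cast hpp.pos) (le_of_mem_primesBelow_succ hp)
    have h2 : log Y ≤ 1 / α := by rw [le_div_iff₀ hα]; linarith
    rw [show 2 / α = 1 / α + 1 / α by ring]
    linarith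
  set m := ∫ s, s ∂(primeMeasure Y α L) with hm
  have hmM : m ≤ 2 / α := primeMeasure_mean_le hα hL h hM
  have hm1 : 1 / α ≤ m := inv_le_primeMeasure_mean hα hL h
  have hα1 : 0 < 1 / α := by positivity
  have hm0 : 0 < m := by linarith
  have hV : L / α ≤ L * m := by
    rw [div_eq_mul_one_div]; exact mul_le_mul_of_nonneg_left hm1 hL.le
  have hV2 : L * m ≤ 2 * (α * L) / α ^ 2 := by
    calc L * m ≤ L * (2 / α) := mul_le_mul_of_nonneg_left hmM hL.le
      _ = _ := by field_simp
  refine core (smoothMeasure Y α) (primeMeasure Y α L) L α (2 / α) 0 1 hsb hα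
    (primeMeasure_moment_one hα hL).1 (primeMeasure_moment_two hα hL).1
    (primeMeasure_second_moment_le hα hL hM) hmM
    (by rw [show 2 / α = 1 / α + 1 / α by ring]; linarith) hm0 ?_ (by linarith) le_rfl ?_ ?_ ?_ ?_
  · rw [← div_le_iff₀' hδ]
    refine le_sqrt_of_sq_le (le_trans ?_ hV)
    rw [show (2 / α / δ) ^ 2 = 4 / δ ^ 2 / α ^ 2 by field_simp; norm_num,
      div_le_div_iff₀ (by positivity) hα]
    have : 4 / δ ^ 2 * α ≤ α * L * α := mul_le_mul_of_nonneg_right (by linarith) hα.le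
    linarith
  · intro τ h1 h2
    exfalso
    have e : π / (4 * (2 / α)) = π * α / 8 := by field_simp; norm_num
    rw [e] at h2
    nlinarith [pi_gt_three]
  · intro t
    exact (smoothed_le_univ hα.le _ t).trans_eq probReal_univ
  · simpa using hδ.le
  · intro t ht
    have hVs : 0 < √(L * m) := sqrt_pos.2 (by positivity)
    rw [le_div_iff₀ (by positivity)]
    have h1 := (smoothed_le_measure hα.le (smoothMeasure Y α) t).trans
      (hsb.measureReal_Iic_half_le (primeMeasure_moment_one hα hL).1 (by positivity) hmM ht)
    have e : L / (8 * (2 / α)) = α * L / 16 := by field_simp; norm_num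
    rw [e] at h1
    set X := α * L
    have hX : 256 ≤ X := by linarith
    have h2 : α * √(L * m) ≤ exp (X / 16) := by
      refine le_of_sq_le_sq ?_ (exp_nonneg _)
      rw [mul_pow, sq_sqrt (by positivity), ← exp_nat_mul]
      have h3 := quadratic_le_exp_of_nonneg (x := X / 8) (by linarith)
      rw [show ((2 : ℕ) : ℝ) * (X / 16) = X / 8 by push_cast; ring]
      rw [le_div_iff₀ (by positivity)] at hV2
      nlinarith
    calc _ ≤ (smoothMeasure Y α).real univ * exp (-(X / 16)) * exp (X / 16) := by
          refine mul_le_mul h1 h2 (by positivity) (by positivity)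
      _ = _ := by rw [mul_assoc, ← exp_add]; simp


theorem log_div_le_two_mul_log {Y : ℕ} {α : ℝ} (hα : 0 < α) (hαY : 1 ≤ α * log Y) :
    ∀ p ∈ Nat.primesBelow (Y + 1), log p / (1 - (p : ℝ) ^ (-α)) ≤ 2 * log Y := by
  intro p hp
  have hpp := Nat.prime_of_mem_primesBelow hp
  refine (log_div_le hpp hα).trans ?_
  have h1 : log p ≤ log Y :=
    log_le_log (by exact_mod_cast hpp.pos) (le_of_mem_primesBelow_succ hp)
  have h2 : 1 / α ≤ log Y := by rw [div_le_iff₀ hα]; linarith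
  linarith

theorem smoothed_mul_le_of_le_half {Y : ℕ} {α L u : ℝ} (hY : 2 ≤ Y) (hα : 0 < α) (hα1 : α ≤ 1)
    (hL : 0 < L) (h : ∑ p ∈ Nat.primesBelow (Y + 1), log p / ((p : ℝ) ^ α - 1) = L)
    (hαY : 1 ≤ α * log Y) (hu : L = u * log Y) (hu2 : 2 ≤ u)
    (hT : (Y : ℝ) ^ (1 - α) ≤ 16 * u ^ 2) (hexp2 : 162 * u ^ 3 ≤ exp (u / 16))
    {t : ℝ} (ht : t ≤ L / 2) :
    smoothed α (smoothMeasure Y α) t * (α * (u * log Y)) ≤ (smoothMeasure Y α).real univ := by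
  have := isFiniteMeasure_smoothMeasure Y hα
  have := isProbabilityMeasure_primeMeasure hα hL h
  have hsb : SizeBiased (smoothMeasure Y α) (primeMeasure Y α L) L := sizeBiased_smooth hL
  have hY1 : (1 : ℝ) < Y := by exact_mod_cast (by omega : 1 < Y)
  have hY0 : (0 : ℝ) < Y := by linarith
  have hu0 : 0 < u := by linarith
  have hM := log_div_le_two_mul_log (Y := Y) hα hαY
  have hS := smoothed_primeMeasure_le hY hα1 hL hαY
  have hq1 := (primeMeasure_moment_one (Y := Y) hα hL).1
  have hmM := primeMeasure_mean_le hα hL h hM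
  set W := log Y with hWdef
  have hW0 : 0 < W := log_pos hY1
  have hf0 := smoothed_nonneg α (smoothMeasure Y α) t
  set T := (Y : ℝ) ^ (1 - α) with hTdef
  have hT0 : 0 < T := by positivity
  set Z := (smoothMeasure Y α).real univ with hZ
  have hZ0 : 0 ≤ Z := measureReal_nonneg
  rcases le_or_gt W t with h1 | h1
  · have h2 := hsb.mul_smoothed_le hα t
    have h3 := mul_le_mul_of_nonneg_left (hsb.smoothed_conv_le_mul_measure hα.le hS t) hL.le
    have h4 : L * (5 * T / L * (smoothMeasure Y α).real (Iic t))
        = 5 * T * (smoothMeasure Y α).real (Iic t) := by field_simp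
    rw [h4] at h3
    have h5 := hsb.measureReal_Iic_half_le hq1 (M := 2 * W) (by positivity) hmM ht
    rw [show L / (8 * (2 * W)) = u / 16 by rw [hu]; field_simp; norm_num] at h5
    set F := smoothed α (smoothMeasure Y α) t
    set B := (smoothMeasure Y α).real (Iic t)
    have hB0 : 0 ≤ B := measureReal_nonneg
    have h6 : α * (W * F) ≤ (5 * T + 1) * B := by
      have h7 : W * F ≤ t * F := mul_le_mul_of_nonneg_right h1 hf0
      have h8 : α * (W * F) ≤ α * (5 * T * B + B / α) :=
        mul_le_mul_of_nonneg_left (by linarith) hα.le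
      have h9 : α * (5 * T * B + B / α) = α * (5 * T * B) + B := by field_simp
      have h10 : α * (5 * T * B) ≤ 5 * T * B :=
        mul_le_of_le_one_left (by positivity) hα1
      linarith
    have h7 : (5 * T + 1) * u ≤ exp (u / 16) := by
      refine le_trans ?_ hexp2
      have : (5 * T + 1) * u ≤ (5 * (16 * u ^ 2) + 1) * u :=
        mul_le_mul_of_nonneg_right (by linarith) hu0.le
      have h8 : u * 1 ≤ u * u ^ 2 := mul_le_mul_of_nonneg_left (by nlinarith) hu0.le
      have h9 : 0 < u ^ 3 := by positivity
      linarith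
    calc F * (α * (u * W)) = α * (W * F) * u := by ring
      _ ≤ (5 * T + 1) * B * u := mul_le_mul_of_nonneg_right h6 hu0.le
      _ = (5 * T + 1) * u * B := by ring
      _ ≤ exp (u / 16) * (Z * exp (-(u / 16))) := mul_le_mul h7 h5 hB0 (exp_nonneg _)
      _ = Z := by rw [mul_left_comm, ← exp_add]; simp
  · have h2 : smoothed α (smoothMeasure Y α) t ≤ T := by
      rw [← log_exp t, smoothed_smoothMeasure Y α (exp_pos t)]
      refine (mul_le_mul_of_nonneg_left (Psi_le (Nat.cast_nonneg Y) (exp_pos t).le)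
        (by positivity)).trans ?_
      rw [hTdef, rpow_def_of_pos (exp_pos t), rpow_def_of_pos hY0, log_exp, ← exp_add]
      refine exp_le_exp.2 ?_
      have : (1 - α) * t ≤ (1 - α) * W := mul_le_mul_of_nonneg_left h1.le (by linarith)
      linarith
    have h3 := hsb.laplace_mul_exp_le hq1 (M := 2 * W) (by positivity) hmM
    have h4 := (exp_neg_half_mul_log_le_sum (Y := Y) (by omega) hα1
      (κ := 1 / (2 * (2 * W))) (by positivity)
      (by rw [← hWdef]; field_simp; norm_num)).trans
      (laplace_smoothMeasure_ge Y hα (κ := 1 / (2 * (2 * W))) (by positivity))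
    rw [show 3 * L / (8 * (2 * W)) = u / 16 + u / 8 by rw [hu]; field_simp; norm_num] at h3
    have h5 : exp (-(1 / 2)) * W * exp (u / 16 + u / 8) ≤ Z :=
      (mul_le_mul_of_nonneg_right h4 (exp_nonneg _)).trans h3
    have h6 : exp (u / 16) ≤ exp (-(1 / 2)) * exp (u / 16 + u / 8) * 2 := by
      have h7 : exp (1 / 2) ≤ 2 := by
        have := exp_one_lt_d9
        have e : exp (1 / 2) ^ 2 = exp 1 := by rw [← exp_nat_mul]; norm_num
        nlinarith [exp_pos (1 / 2 : ℝ)]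
      have h8 : exp (u / 16 + u / 8) = exp (u / 16) * exp (u / 8) := exp_add _ _
      have h9 : 1 ≤ exp (u / 8) := one_le_exp (by positivity)
      have h10 : exp (-(1 / 2)) * exp (1 / 2) = 1 := by rw [← exp_add]; norm_num
      have h11 : 1 ≤ exp (-(1 / 2)) * 2 := by
        exact h10.symm.le.trans (mul_le_mul_of_nonneg_left h7 (exp_nonneg _))
      have h12 : 1 ≤ exp (-(1 / 2)) * 2 * exp (u / 8) := by nlinarith
      rw [h8]
      have := mul_le_mul_of_nonneg_left h12 (exp_nonneg (u / 16))
      linarith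
    calc _ ≤ T * (1 * (u * W)) := by
          exact mul_le_mul h2 (mul_le_mul_of_nonneg_right hα1 (by positivity))
            (by positivity) (by positivity)
      _ ≤ 16 * u ^ 2 * (1 * (u * W)) := mul_le_mul_of_nonneg_right hT (by positivity)
      _ = W * (16 * u ^ 3) := by ring
      _ ≤ W * (exp (-(1 / 2)) * exp (u / 16 + u / 8)) := by
          refine mul_le_mul_of_nonneg_left ?_ hW0.le
          have : 0 < u ^ 3 := by positivity
          linarith
      _ = exp (-(1 / 2)) * W * exp (u / 16 + u / 8) := by ring
      _ ≤ Z := h5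

/-- The regime where `α ≤ 1` and `log Y` is small compared to `L`. -/
theorem exists_smoothed_le_of_one_le_mul_log {C₀ : ℝ}
    (hC₀ : ∀ z : ℝ, 1 ≤ z → |∑ k ∈ Finset.Icc 0 ⌊z⌋₊, primeLog k - log z| ≤ C₀) :
    ∃ K > 0, ∃ U > 0, ∃ C > 0, ∀ (Y : ℕ) (α L : ℝ), 2 ≤ Y → 0 < α → α ≤ 1 → 0 < L →
      ∑ p ∈ Nat.primesBelow (Y + 1), log p / ((p : ℝ) ^ α - 1) = L →
      1 ≤ α * log Y → K ≤ α * L → 80 * C₀ ≤ log Y → U * log Y ≤ L →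
      ∀ t, smoothed α (smoothMeasure Y α) t ≤ C * smoothed α (smoothMeasure Y α) L := by
  have hC₀0 : 0 ≤ C₀ := (abs_nonneg _).trans (hC₀ 1 le_rfl)
  set ε := 1 / (100 * (C₀ + 1)) with hε
  have hε0 : 0 < ε := by positivity
  have hε1 : ε ≤ 1 := by rw [hε, div_le_one (by positivity)]; linarith
  have hεC : ε * C₀ ≤ 1 / 100 := by
    rw [hε, div_mul_eq_mul_div, div_le_div_iff₀ (by positivity) (by norm_num)]; linarith
  obtain ⟨δ, hδ, C, hC, core⟩ := exists_smoothed_le_smoothed hε0 hε1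
  obtain ⟨R₁, hR₁⟩ := exists_pow_mul_exp_neg_le 4 (c := 1 / 512) (δ := δ / 5)
    (by norm_num) (by positivity)
  obtain ⟨R₂, hR₂⟩ := exists_pow_mul_exp_neg_le 3 (c := 1 / 16) (δ := 1 / 162)
    (by norm_num) (by norm_num)
  set R := max 1 (max R₁ (6 / δ)) with hR
  have hR1 : 1 ≤ R := le_max_left _ _
  refine ⟨1 / δ, by positivity, max (8 * R ^ 4) (max R₂ 2), by positivity, C, hC,
    fun Y α L hY hα hα1 hL h hαY hK hW hU => ?_⟩
  have := isFiniteMeasure_smoothMeasure Y hα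
  have := isProbabilityMeasure_primeMeasure hα hL h
  have hsb : SizeBiased (smoothMeasure Y α) (primeMeasure Y α L) L := sizeBiased_smooth hL
  have hY1 : (1 : ℝ) < Y := by exact_mod_cast (by omega : 1 < Y)
  have hY0 : (0 : ℝ) < Y := by linarith
  set W := log Y with hWdef
  have hW0 : 0 < W := log_pos hY1
  set r := (Y : ℝ) ^ (1 / 4 * (1 - α)) with hr
  have hr0 : 0 < r := by positivity
  have hr1 : 1 ≤ r := one_le_rpow hY1.le (mul_nonneg (by norm_num) (by linarith))
  have hr2 : (Y : ℝ) ^ (1 / 2 * (1 - α)) = r ^ 2 := by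
    rw [hr, ← rpow_natCast, ← rpow_mul hY0.le]; congr 1; push_cast; ring
  have hr4 : (Y : ℝ) ^ (1 - α) = r ^ 4 := by
    rw [hr, ← rpow_natCast, ← rpow_mul hY0.le]; congr 1; push_cast; ring
  obtain ⟨u, hu⟩ : ∃ u, L = u * W := ⟨L / W, by field_simp⟩
  have hUu : max (8 * R ^ 4) (max R₂ 2) ≤ u := by
    rw [hu] at hU; exact le_of_mul_le_mul_right hU hW0
  have hu2 : 2 ≤ u := ((le_max_right _ _).trans (le_max_right _ _)).trans hUu
  have hu0 : 0 < u := by linarith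
  have hur : u ≤ 8 * r ^ 4 := by
    have h1 := le_four_mul_rpow_mul hC₀ hY hα hα1 hαY h
    rw [hr4, hu] at h1
    refine le_of_mul_le_mul_right (h1.trans ?_) hW0
    have : 4 * r ^ 4 * (W + C₀) ≤ 4 * r ^ 4 * (2 * W) :=
      mul_le_mul_of_nonneg_left (by linarith) (by positivity)
    linarith
  have hru : r ^ 2 ≤ 4 * u := by
    have h1 := (sum_log_mul_rpow_ge hC₀ (by omega) (by linarith) hα1).trans
      (sum_log_mul_rpow_le hα h)
    rw [hr2, hu] at h1
    have : W * (r ^ 2 / 4) ≤ W * u := by linarith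
    linarith [le_of_mul_le_mul_left this hW0]
  have hRr : R ≤ r := by
    have : R ^ 4 ≤ r ^ 4 := by linarith [(le_max_left _ _).trans hUu]
    exact le_of_pow_le_pow_left₀ (by norm_num) hr0.le this
  have hrR₁ : R₁ ≤ r := ((le_max_left _ _).trans (le_max_right _ _)).trans hRr
  have hrδ : 6 / δ ≤ r := ((le_max_right _ _).trans (le_max_right _ _)).trans hRr
  have hexp1 : 5 * r ^ 4 * exp (-(r / 512)) ≤ δ := by
    have := hR₁ r hrR₁
    rw [show 1 / 512 * r = r / 512 by ring] at this
    linarith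
  have hexp2 : 162 * u ^ 3 ≤ exp (u / 16) := by
    have := hR₂ u (((le_max_left _ _).trans (le_max_right _ _)).trans hUu)
    rw [show 1 / 16 * u = u / 16 by ring, exp_neg, ← div_eq_mul_inv,
      div_le_iff₀ (exp_pos _)] at this
    linarith
  have hM := log_div_le_two_mul_log (Y := Y) hα hαY
  set m := ∫ s, s ∂(primeMeasure Y α L) with hm
  have hq1 := (primeMeasure_moment_one (Y := Y) hα hL).1
  have hmM : m ≤ 2 * W := primeMeasure_mean_le hα hL h hM
  have hm1 : 1 / α ≤ m := inv_le_primeMeasure_mean hα hL h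
  have hα2 : 0 < 1 / α := by positivity
  have hα3 : 1 / α ≤ W := by rw [div_le_iff₀ hα]; linarith
  have hm0 : 0 < m := by linarith
  have hV : r ^ 2 * (W ^ 2 / 8) ≤ L * m := by
    rw [← hr2]
    exact (sum_log_sq_mul_rpow_ge hC₀ (by omega) (by linarith) hα1).trans
      (sum_log_sq_le_primeMeasure_mean hα hL)
  have hsqrt : √(L * m) ≤ u * W := by
    refine sqrt_le_iff.2 ⟨by positivity, ?_⟩
    calc L * m ≤ (u * W) * (2 * W) := by
          rw [← hu]; exact mul_le_mul_of_nonneg_left hmM hL.le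
      _ ≤ (u * W) * (u * W) := by
          refine mul_le_mul_of_nonneg_left ?_ (by positivity)
          exact mul_le_mul_of_nonneg_right hu2 hW0.le
      _ = _ := by ring
  have hVs : 0 < √(L * m) := sqrt_pos.2 (by positivity)
  have hS := smoothed_primeMeasure_le hY hα1 hL hαY
  rw [hr4] at hS
  set Z := (smoothMeasure Y α).real univ with hZ
  have hZ0 : 0 ≤ Z := measureReal_nonneg
  refine core (smoothMeasure Y α) (primeMeasure Y α L) L α (2 * W) (exp (-(r / 512)))
    (5 * r ^ 4 / L) hsb hα hq1 (primeMeasure_moment_two hα hL).1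
    (primeMeasure_second_moment_le hα hL hM) hmM (by linarith) hm0 ?_ hK (exp_nonneg _) ?_ hS ?_ ?_
  · rw [← div_le_iff₀' hδ]
    refine le_sqrt_of_sq_le (le_trans ?_ hV)
    have h1 : (6 / δ) ^ 2 ≤ r ^ 2 := pow_le_pow_left₀ (by positivity) hrδ 2
    have h2 : (6 / δ) ^ 2 * (W ^ 2 / 8) ≤ r ^ 2 * (W ^ 2 / 8) :=
      mul_le_mul_of_nonneg_right h1 (by positivity)
    refine le_trans (le_of_sub_nonneg ?_) h2
    have : (6 / δ) ^ 2 * (W ^ 2 / 8) - (2 * W / δ) ^ 2 = (W / δ) ^ 2 / 2 := by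
      field_simp; norm_num
    rw [this]; positivity
  · intro τ h1 h2
    refine (norm_charFun_smoothMeasure_le hα hL h τ).trans ?_
    refine mul_le_mul_of_nonneg_left (exp_le_exp.2 (neg_le_neg ?_)) hZ0
    refine sum_rpow_mul_one_sub_cos_ge hC₀ hY hW hα1 ?_ ?_
    · rw [show 8 * log (Y : ℝ) = 4 * (2 * W) by rw [← hWdef]; ring]; exact h2
    · refine (mul_le_mul_of_nonneg_right (h1.trans ?_) hC₀0).trans hεC
      exact mul_le_of_le_one_right hε0.le hα1
  · have h1 : α * √(L * m) ≤ L := by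
      rw [hu] at hsqrt ⊢
      calc _ ≤ 1 * (u * W) := mul_le_mul hα1 hsqrt (sqrt_nonneg _) zero_le_one
        _ = _ := one_mul _
    calc _ ≤ exp (-(r / 512)) * (5 * r ^ 4 / L) * L :=
          mul_le_mul_of_nonneg_left h1 (by positivity)
      _ = 5 * r ^ 4 * exp (-(r / 512)) := by field_simp
      _ ≤ δ := hexp1
  · intro t ht
    rw [le_div_iff₀ (by positivity)]
    have hr4u : r ^ 4 ≤ 16 * u ^ 2 := by
      calc r ^ 4 = (r ^ 2) ^ 2 := by ring
        _ ≤ (4 * u) ^ 2 := pow_le_pow_left₀ (by positivity) hru 2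
        _ = _ := by ring
    refine le_trans ?_ (smoothed_mul_le_of_le_half hY hα hα1 hL h hαY hu hu2 (hr4 ▸ hr4u) hexp2 ht)
    exact mul_le_mul_of_nonneg_left (mul_le_mul_of_nonneg_left hsqrt hα.le)
      (smoothed_nonneg _ _ _)


theorem Psi_div_le_of_smoothed_le {Y : ℕ} {x d α C : ℝ} (hx : 0 < x) (hd : 0 < d)
    (h : smoothed α (smoothMeasure Y α) (log (x / d)) ≤
      C * smoothed α (smoothMeasure Y α) (log x)) :
    (Psi (x / d) Y : ℝ) ≤ C * d ^ (-α) * Psi x Y := by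
  rw [smoothed_smoothMeasure Y α (div_pos hx hd), smoothed_smoothMeasure Y α hx,
    div_rpow hx.le hd.le] at h
  have h1 : 0 < x ^ (-α) := by positivity
  have h2 : 0 < d ^ (-α) := by positivity
  have h3 := mul_le_mul_of_nonneg_left h h2.le
  have h4 : x ^ (-α) * (Psi (x / d) Y : ℝ) ≤ x ^ (-α) * (C * d ^ (-α) * Psi x Y) := by
    calc _ = d ^ (-α) * (x ^ (-α) / d ^ (-α) * Psi (x / d) Y) := by field_simp
      _ ≤ _ := h3
      _ = _ := by ring
  exact le_of_mul_le_mul_left h4 h1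

theorem pos_of_sum_log_div_pos {Y : ℕ} {α : ℝ}
    (h : 0 < ∑ p ∈ Nat.primesBelow (Y + 1), log p / ((p : ℝ) ^ α - 1)) : 0 < α := by
  by_contra hα
  push Not at hα
  refine h.not_ge (Finset.sum_nonpos fun p hp => ?_)
  have hpp := Nat.prime_of_mem_primesBelow hp
  refine div_nonpos_of_nonneg_of_nonpos (log_natCast_nonneg p) (sub_nonpos.2 ?_)
  exact rpow_le_one_of_one_le_of_nonpos (by exact_mod_cast hpp.one_le) hα

theorem exists_Psi_div_le_nat : ∃ C > 0, ∀ (Y : ℕ) (x d α : ℝ), 2 ≤ Y → (Y : ℝ) ≤ x → 1 ≤ d →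
    ∑ p ∈ Nat.primesBelow (Y + 1), log p / ((p : ℝ) ^ α - 1) = log x →
    (Psi (x / d) Y : ℝ) ≤ C * d ^ (-α) * Psi x Y := by
  obtain ⟨C₀, hC₀0, hC₀⟩ := exists_abs_sum_primeLog_le
  obtain ⟨C₁, hC₁0, hC₁⟩ := exists_sum_log_div_mul_le
  obtain ⟨K₁, -, A₁, hA₁, h₁⟩ := exists_smoothed_le_of_mul_log_le_one
  obtain ⟨K₂, -, U, hU, A₂, hA₂, h₂⟩ := exists_smoothed_le_of_one_le_mul_log hC₀
  set U' := max U (C₀ + C₁ + 2) with hU'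
  have hU'0 : 0 < U' := lt_of_lt_of_le hU (le_max_left _ _)
  obtain ⟨c, hc, hsmall⟩ := exists_mul_le_Psi hC₀ (2 * ⌈U'⌉₊)
  set K := max (max K₁ K₂) (exp (1 + 80 * C₀ + 4 * C₁)) with hK
  refine ⟨max (max A₁ A₂) (max (exp K) (exp (2 * U') / c)), by positivity, ?_⟩
  set A := max (max A₁ A₂) (max (exp K) (exp (2 * U') / c)) with hA
  intro Y x d α hY hYx hd h
  have hY1 : (1 : ℝ) < Y := by exact_mod_cast (by omega : 1 < Y)
  have hx1 : 1 < x := by linarith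
  have hx0 : 0 < x := by linarith
  have hd0 : 0 < d := by linarith
  have hL : 0 < log x := log_pos hx1
  have hα : 0 < α := pos_of_sum_log_div_pos (h ▸ hL)
  have hdα : 0 < d ^ (-α) := by positivity
  have mono : ∀ {B : ℝ}, B ≤ A → (Psi (x / d) Y : ℝ) ≤ B * d ^ (-α) * Psi x Y →
      (Psi (x / d) Y : ℝ) ≤ A * d ^ (-α) * Psi x Y := fun hB hle => hle.trans
    (mul_le_mul_of_nonneg_right (mul_le_mul_of_nonneg_right hB hdα.le) (Nat.cast_nonneg _))
  have hA0 : 0 ≤ A := hA₁.le.trans ((le_max_left _ _).trans (le_max_left _ _))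
  rcases lt_or_ge x d with hdx | hdx
  · rw [Psi_eq_zero (Nat.cast_nonneg _) ((div_lt_one hd0).2 hdx)]
    push_cast
    positivity
  have hlogd : log d ≤ log x := log_le_log hd0 hdx
  have hlogd0 : 0 ≤ log d := log_nonneg hd
  rcases le_or_gt (α * log x) K with hαK | hαK
  · refine mono ((le_max_left _ _).trans (le_max_right _ _)) ?_
    have h1 : 1 ≤ exp K * d ^ (-α) := by
      rw [rpow_def_of_pos hd0, ← exp_add]
      refine one_le_exp ?_
      have := mul_le_mul_of_nonneg_left hlogd hα.le
      linarith
    have h2 : (Psi (x / d) Y : ℝ) ≤ Psi x Y := by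
      exact_mod_cast Psi_mono (Nat.cast_nonneg _) (div_le_self hx0.le hd)
    exact h2.trans (le_mul_of_one_le_left (Nat.cast_nonneg _) h1)
  have hKY : K ≤ Y := hαK.le.trans (mul_sum_log_div_le hα h)
  have hW : 1 + 80 * C₀ + 4 * C₁ ≤ log Y := by
    rw [le_log_iff_exp_le (by linarith)]
    exact (le_max_right _ _).trans hKY
  have hW0 : 0 < log Y := log_pos hY1
  have hWL : log Y ≤ log x := log_le_log (by linarith) hYx
  rcases le_or_gt (α * log Y) 1 with hαY | hαY
  · refine mono ((le_max_left _ _).trans (le_max_left _ _))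
      (Psi_div_le_of_smoothed_le hx0 hd0 (h₁ Y α (log x) (by omega) hα hL h hαY ?_ _))
    exact ((le_max_left _ _).trans (le_max_left _ _)).trans hαK.le
  rcases le_or_gt (log x) (U' * log Y) with hu | hu
  · refine mono ((le_max_right _ _).trans (le_max_right _ _)) ?_
    have h3 : c * x ≤ Psi x Y := by
      refine hsmall Y hY (by linarith) x hx1.le (hu.trans ?_)
      refine mul_le_mul_of_nonneg_right ?_ hW0.le
      have := Nat.le_ceil U'
      push_cast
      linarith
    have h4 : (Psi (x / d) Y : ℝ) ≤ x / d := Psi_le (Nat.cast_nonneg _) (by positivity)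
    have h5 : (α - 1) * log d ≤ 2 * U' := by
      rcases le_or_gt α 1 with h6 | h6
      · have : (α - 1) * log d ≤ 0 := mul_nonpos_of_nonpos_of_nonneg (by linarith) hlogd0
        linarith
      · have h7 := sub_one_mul_log_le hC₀ (by omega) h6.le (hC₁ Y) h hWL (by linarith)
        have h8 := mul_le_mul_of_nonneg_left (hlogd.trans hu) (by linarith : 0 ≤ α - 1)
        have h9 := mul_le_mul_of_nonneg_right h7 hU'0.le
        linarith
    have h6 : 1 / d ≤ exp (2 * U') * d ^ (-α) := by
      rw [one_div, ← rpow_neg_one, rpow_def_of_pos hd0, rpow_def_of_pos hd0, ← exp_add]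
      exact exp_le_exp.2 (by linarith)
    calc _ ≤ x / d := h4
      _ = x * (1 / d) := by ring
      _ ≤ x * (exp (2 * U') * d ^ (-α)) := mul_le_mul_of_nonneg_left h6 hx0.le
      _ = exp (2 * U') / c * d ^ (-α) * (c * x) := by field_simp
      _ ≤ _ := mul_le_mul_of_nonneg_left h3 (by positivity)
  · have hα1 : α ≤ 1 := by
      by_contra hcon
      push Not at hcon
      have h3 := sum_log_div_le_of_one_le hC₀ (by omega) hcon.le (hC₁ Y) h
      have h4 := mul_le_mul_of_nonneg_right (le_max_right U (C₀ + C₁ + 2)) hW0.le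
      have h5 : (C₀ + C₁) * 1 ≤ (C₀ + C₁) * log Y :=
        mul_le_mul_of_nonneg_left (by linarith) (by linarith)
      linarith
    refine mono ((le_max_right _ _).trans (le_max_left _ _))
      (Psi_div_le_of_smoothed_le hx0 hd0
        (h₂ Y α (log x) hY hα hα1 hL h hαY.le ?_ (by linarith) ?_ _))
    · exact ((le_max_right _ _).trans (le_max_left _ _)).trans hαK.le
    · exact (mul_le_mul_of_nonneg_right (le_max_left _ _) hW0.le).trans hu.le

end SmoothCount

/-- Lemma 1 (de la Bretèche–Tenenbaum): Ψ(x/d, y) ≪ d^(−α(x,y)) Ψ(x, y). -/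
theorem Psi_div_le :
    ∃ C : ℝ, 0 < C ∧
      ∀ (x y d α : ℝ), 2 ≤ y → y ≤ x → 1 ≤ d → alphaEq x y α →
        (Psi (x / d) y : ℝ) ≤ C * d ^ (-α) * (Psi x y : ℝ) := by
  obtain ⟨C, hC, h⟩ := SmoothCount.exists_Psi_div_le_nat
  refine ⟨C, hC, fun x y d α hy hyx hd hα => ?_⟩
  have hy0 : 0 ≤ y := by linarith
  rw [← SmoothCount.Psi_floor hy0, ← SmoothCount.Psi_floor hy0]
  refine h ⌊y⌋₊ x d α (Nat.le_floor (by exact_mod_cast hy)) ((Nat.floor_le hy0).trans hyx) hd ?_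
  rw [← hα]
  refine Finset.sum_congr ?_ fun _ _ => rfl
  ext p
  simp [Nat.primesBelow]
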